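/- arXiv:1909.04752 — 10 statements merged into one kernel-verified Lean document; each statement's English description precedes it below -/
import Mathlib

section
/- Let n ≥ 2 and let M ⊂ ℂ^{n+1} be the codimension-2 real submanifold given near the origin by w = ρ(z,z̄) = z*Az + conj(zᵀBz) + zᵀCz + E(z,z̄), where ρ is real-analytic, A, B, C are complex n×n matrices with B and C symmetric, and E(z,z̄) = O(|z|³). Assume that the (2n)×n matrix obtained by stacking A* (the conjugate transpose of A) on top of B has rank at least 2. Suppose f(z,z̄) is a real-analytic function defined near 0 ∈ ℂⁿ that is CR on M, i.e., ρ_{z̄_ℓ} ∂f/∂z̄_k − ρ_{z̄_k} ∂f/∂z̄_ℓ = 0 for all 1 ≤ k,ℓ ≤ n on a neighborhood of 0 (Wirtinger derivatives). Then there exists a unique holomorphic function F(z,w) on a neighborhood of 0 ∈ ℂ^{n+1} such that f(z,z̄) = F(z, ρ(z,z̄)) for all z in a neighborhood of 0 ∈ ℂⁿ. -/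
open Matrix Filter Asymptotics Topology

open MeasureTheory Metric Complex in
/-- The iterated Cauchy formula on a polydisc. -/
theorem torusIntegral_prod_inv_smul {n : ℕ} {f : (Fin n → ℂ) → ℂ} {U : Set (Fin n → ℂ)}
    {c y : Fin n → ℂ} {r : ℝ} (hr : 0 < r) (hU : IsOpen U) (hcU : closedBall c r ⊆ U)
    (hf : ContinuousOn f U)
    (hd : ∀ x ∈ U, ∀ i, DifferentiableAt ℂ (fun s => f (Function.update x i s)) (x i))
    (hy : y ∈ ball c r) :
    torusIntegral (fun x => (∏ i, (x i - y i)⁻¹) * f x) c (fun _ => r) =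
      (2 * Real.pi * I) ^ n * f y := by
  induction n with
  | zero => 
    rw [torusIntegral_dim0, Subsingleton.elim c y]; simp
  | succ n ih =>
    have hy' : ∀ i, ‖y i - c i‖ < r := fun i => by
      rw [← dist_eq_norm]; exact (dist_pi_lt_iff hr).1 hy i
    have hcons : ∀ x ∈ closedBall (c 0) r, ∀ z ∈ closedBall (c ∘ Fin.succ) r,
        (Fin.cons x z : Fin (n + 1) → ℂ) ∈ closedBall c r := by
      intro x hx z hz
      rw [mem_closedBall, dist_pi_le_iff hr.le] at hz ⊢
      intro i
      refine Fin.cases ?_ (fun i => ?_) i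
      · simpa using hx
      · simpa using hz i
    have htorus : ∀ θ, torusMap c (fun _ => r) θ ∈ closedBall c r := by
      intro θ
      rw [mem_closedBall, dist_pi_le_iff hr.le]
      intro i
      simp [torusMap, dist_eq_norm, abs_of_pos hr]
    have hne : ∀ θ i, torusMap c (fun _ => r) θ i - y i ≠ 0 := by
      intro θ i h
      have := hy' i
      rw [← sub_eq_zero.1 h] at this
      simp [torusMap, abs_of_pos hr] at this
    have hint : TorusIntegrable (fun x => (∏ i, (x i - y i)⁻¹) * f x) c (fun _ => r) := by
      refine Continuous.integrableOn_Icc ?_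
      have h1 : Continuous (torusMap c (fun _ => r)) := by unfold torusMap; fun_prop
      have h2 : Continuous fun θ => f (torusMap c (fun _ => r) θ) :=
        hf.comp_continuous h1 fun θ => hcU (htorus θ)
      refine Continuous.mul (continuous_finsetProd _ fun i _ =>
        Continuous.inv₀ ?_ fun θ => hne θ i) h2
      fun_prop
    rw [torusIntegral_succ hint]
    have hinner : ∀ x ∈ sphere (c 0) r,
        torusIntegral (fun z => (∏ i, ((Fin.cons x z : Fin (n + 1) → ℂ) i - y i)⁻¹) *
          f (Fin.cons x z)) (c ∘ Fin.succ) ((fun _ => r) ∘ Fin.succ) =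
        (2 * Real.pi * I) ^ n * ((x - y 0)⁻¹ • f (Fin.cons x (Fin.tail y))) := by
      intro x hx
      have hx' := sphere_subset_closedBall hx
      let e : (Fin n → ℂ) → (Fin (n + 1) → ℂ) := fun z => Fin.cons x z
      have hcont : Continuous e := by
        refine continuous_pi fun i => ?_
        refine Fin.cases ?_ (fun i => ?_) i
        · simpa [e] using continuous_const
        · simpa [e] using continuous_apply i
      have hde : ∀ z ∈ e ⁻¹' U, ∀ i,
          DifferentiableAt ℂ (fun s => (f ∘ e) (Function.update z i s)) (z i) := by
        intro z hz i
        have h1 := hd _ hz i.succ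
        have h2 : ∀ s, Function.update (e z) i.succ s = e (Function.update z i s) := fun s => by
          simp only [e, Fin.cons_update]
        simp only [h2] at h1
        simpa [e] using h1
      have hyt : Fin.tail y ∈ ball (c ∘ Fin.succ) r := by
        rw [mem_ball, dist_pi_lt_iff hr]
        intro i
        simpa [dist_eq_norm, Fin.tail] using hy' i.succ
      have := ih (f := f ∘ e) (U := e ⁻¹' U) (hU.preimage hcont)
        (fun z hz => hcU (hcons x hx' z hz)) (hf.comp hcont.continuousOn fun z hz => hz) hde hyt
      calc _ = torusIntegral (fun z => (x - y 0)⁻¹ * ((∏ i, (z i - Fin.tail y i)⁻¹) *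
            f (Fin.cons x z))) (c ∘ Fin.succ) (fun _ => r) := by
              congr 1
              ext z
              rw [Fin.prod_univ_succ]
              simp [Fin.tail, mul_assoc]
        _ = _ := by
              rw [torusIntegral_const_mul]
              refine (congrArg _ this).trans ?_
              rw [smul_eq_mul, Function.comp_apply]; ring
    have hy0 : y 0 ∈ ball (c 0) r := by simpa [dist_eq_norm] using hy' 0
    have htail : Fin.tail y ∈ closedBall (c ∘ Fin.succ) r := by
      rw [mem_closedBall, dist_pi_le_iff hr.le]
      intro i
      simpa [dist_eq_norm, Fin.tail] using (hy' i.succ).le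
    have hdx : ∀ x ∈ closedBall (c 0) r,
        DifferentiableAt ℂ (fun s => f (Fin.cons s (Fin.tail y))) x := by
      intro x hx
      have := hd _ (hcU (hcons x hx _ htail)) 0
      simpa using this
    rw [circleIntegral.integral_congr hr.le hinner, circleIntegral.integral_const_mul,
      DiffContOnCl.circleIntegral_sub_inv_smul (f := fun s => f (Fin.cons s (Fin.tail y))) ?_ hy0]
    · rw [Fin.cons_self_tail, smul_eq_mul]; ring
    · refine DifferentiableOn.diffContOnCl fun x hx => ?_
      exact (hdx x (closure_ball_subset_closedBall hx)).differentiableWithinAt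

open MeasureTheory Metric Complex BoundedContinuousFunction in
theorem analyticAt_of_continuousOn_of_differentiableAt_update {n : ℕ} {f : (Fin n → ℂ) → ℂ}
    {U : Set (Fin n → ℂ)} {c : Fin n → ℂ} (hU : IsOpen U) (hc : c ∈ U) (hf : ContinuousOn f U)
    (hd : ∀ x ∈ U, ∀ i, DifferentiableAt ℂ (fun s => f (Function.update x i s)) (x i)) :
    AnalyticAt ℂ f c := by
  obtain ⟨r, hr, hrU⟩ := nhds_basis_closedBall.mem_iff.1 (hU.mem_nhds hc)
  let Z : Fin n → ((Fin n → ℝ) →ᵇ ℂ) := fun i =>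
    BoundedContinuousFunction.ofNormedAddCommGroup (fun θ => r * exp (θ i * I)) (by fun_prop) r
      (fun θ => by simp [abs_of_pos hr])
  let Z' : Fin n → ((Fin n → ℝ) →ᵇ ℂ) := fun i =>
    BoundedContinuousFunction.ofNormedAddCommGroup (fun θ => r⁻¹ * exp (-(θ i * I))) (by fun_prop)
      r⁻¹ (fun θ => by simp [abs_of_pos hr, norm_exp])
  have hZ : ∀ i, Z i * Z' i = 1 := by
    intro i
    ext θ
    have hr' : (r : ℂ) ≠ 0 := by exact_mod_cast hr.ne'
    have := exp_ne_zero (θ i * I)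
    simp only [Z, Z', BoundedContinuousFunction.coe_mul, Pi.mul_apply,
      BoundedContinuousFunction.coe_ofNormedAddCommGroup, BoundedContinuousFunction.coe_one,
      Pi.one_apply, exp_neg, ofReal_inv]
    field_simp
  let u : Fin n → ((Fin n → ℝ) →ᵇ ℂ)ˣ := fun i => ⟨Z i, Z' i, hZ i, (mul_comm _ _).trans (hZ i)⟩
  let D : Fin n → (Fin n → ℂ) → ((Fin n → ℝ) →ᵇ ℂ) := fun i y =>
    Z i - algebraMap ℂ _ (y i - c i)
  have hDan : ∀ i, AnalyticAt ℂ (D i) c := by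
    intro i
    have h1 : AnalyticAt ℂ (fun y : Fin n → ℂ => y i - c i) c :=
      ((ContinuousLinearMap.proj (R := ℂ) (φ := fun _ : Fin n => ℂ) i).analyticAt c).sub
        analyticAt_const
    exact analyticAt_const.sub
      (((algebraMapCLM ℂ ((Fin n → ℝ) →ᵇ ℂ)).analyticAt _).comp h1)
  have hDc : ∀ i, D i c = u i := by
    intro i; simp [D, u]
  have hK : AnalyticAt ℂ (fun y => ∏ i, Ring.inverse (D i y)) c := by
    refine Finset.analyticAt_fun_prod _ fun i _ => ?_
    have h1 : AnalyticAt ℂ Ring.inverse (D i c) := by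
      rw [hDc]
      exact analyticAt_inverse _
    exact h1.comp (hDan i)
  let w : (Fin n → ℝ) → ℂ := fun θ =>
    (∏ i, r * exp (θ i * I) * I : ℂ) * f (torusMap c (fun _ => r) θ)
  have hw : Continuous w := by
    have h1 : Continuous (torusMap c (fun _ => r)) := by unfold torusMap; fun_prop
    have h2 : Continuous fun θ => f (torusMap c (fun _ => r) θ) :=
      hf.comp_continuous h1 fun θ => hrU (by
        rw [mem_closedBall, dist_pi_le_iff hr.le]
        intro i
        simp [torusMap, dist_eq_norm, abs_of_pos hr])
    refine Continuous.mul ?_ h2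
    fun_prop
  set μ : Measure (Fin n → ℝ) := volume.restrict (Set.Icc 0 fun _ => 2 * Real.pi)
  have hwi : Integrable w μ := hw.integrableOn_Icc
  have hint : ∀ φ : (Fin n → ℝ) →ᵇ ℂ, Integrable (fun θ => φ θ * w θ) μ := fun φ =>
    hwi.bdd_mul φ.continuous.aestronglyMeasurable (Eventually.of_forall φ.norm_coe_le_norm)
  let L : ((Fin n → ℝ) →ᵇ ℂ) →L[ℂ] ℂ := LinearMap.mkContinuous
    { toFun := fun φ => ∫ θ, φ θ * w θ ∂μ
      map_add' := fun φ ψ => by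
        simp only [BoundedContinuousFunction.coe_add, Pi.add_apply, add_mul]
        exact integral_add (hint φ) (hint ψ)
      map_smul' := fun a φ => by
        simp only [BoundedContinuousFunction.coe_smul, smul_eq_mul, mul_assoc, RingHom.id_apply]
        exact integral_const_mul _ _ }
    (∫ θ, ‖w θ‖ ∂μ) (fun φ => by
      refine (norm_integral_le_of_norm_le (hwi.norm.const_mul ‖φ‖)
        (Eventually.of_forall fun θ => ?_)).trans_eq ?_
      · rw [norm_mul]
        exact mul_le_mul_of_nonneg_right (φ.norm_coe_le_norm θ) (norm_nonneg _)
      · rw [integral_const_mul, mul_comm])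
  have hLK : AnalyticAt ℂ (fun y => ((2 * Real.pi * I) ^ n)⁻¹ *
      L (∏ i, Ring.inverse (D i y))) c :=
    analyticAt_const.mul ((L.analyticAt _).comp hK)
  refine hLK.congr ?_
  have hunit : ∀ᶠ y in 𝓝 c, ∀ i, IsUnit (D i y) := by
    refine eventually_all.2 fun i => (hDan i).continuousAt.eventually ?_
    rw [hDc]
    exact Units.nhds (u i)
  filter_upwards [hunit, ball_mem_nhds c hr] with y hy hyb
  have hpi : (2 * Real.pi * I : ℂ) ^ n ≠ 0 := pow_ne_zero _ two_pi_I_ne_zero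
  rw [inv_mul_eq_iff_eq_mul₀ hpi, ← torusIntegral_prod_inv_smul hr hU hrU hf hd hyb]
  change ∫ θ, (∏ i, Ring.inverse (D i y)) θ * w θ ∂μ = _
  rw [torusIntegral]
  refine integral_congr_ae (Eventually.of_forall fun θ => ?_)
  have hinv : ∀ i, (Ring.inverse (D i y)) θ = (torusMap c (fun _ => r) θ i - y i)⁻¹ := by
    intro i
    refine eq_inv_of_mul_eq_one_left ?_
    have := congrArg (fun φ : (Fin n → ℝ) →ᵇ ℂ => φ θ) (Ring.inverse_mul_cancel _ (hy i))
    simp only [BoundedContinuousFunction.coe_mul, Pi.mul_apply,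
      BoundedContinuousFunction.coe_one, Pi.one_apply] at this
    rw [← this]
    congr 1
    simp only [D, Z, torusMap, BoundedContinuousFunction.coe_sub, Pi.sub_apply,
      BoundedContinuousFunction.coe_ofNormedAddCommGroup,
      BoundedContinuousFunction.algebraMap_apply,
      smul_eq_mul]
    ring
  simp only [BoundedContinuousFunction.coe_prod, Finset.prod_apply, hinv, w, smul_eq_mul]
  ring

open Metric in
/-- A continuous function that is complex differentiable along every line is analytic. -/
theorem analyticOnNhd_of_continuousOn_of_differentiableAt_line {E : Type*} [NormedAddCommGroup E]
    [NormedSpace ℂ E] [FiniteDimensional ℂ E] {f : E → ℂ} {U : Set E} (hU : IsOpen U)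
    (hf : ContinuousOn f U)
    (hd : ∀ x ∈ U, ∀ v : E, DifferentiableAt ℂ (fun s : ℂ => f (x + s • v)) 0) :
    AnalyticOnNhd ℂ f U := by
  intro p hp
  let e : E ≃L[ℂ] (Fin (Module.finrank ℂ E) → ℂ) :=
    (Module.finBasis ℂ E).equivFunL
  have key : AnalyticAt ℂ (f ∘ e.symm) (e p) := by
    refine analyticAt_of_continuousOn_of_differentiableAt_update
      (hU.preimage e.symm.continuous) (by simpa using hp)
      (hf.comp e.symm.continuous.continuousOn fun x hx => hx) fun x hx i => ?_
    have h1 := hd _ hx (e.symm (Pi.single i 1))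
    have h2 : DifferentiableAt ℂ (fun s : ℂ => s - x i) (x i) := by fun_prop
    have h3 : DifferentiableAt ℂ (fun s : ℂ => f (e.symm x + s • e.symm (Pi.single i 1)))
      ((fun s : ℂ => s - x i) (x i)) := by simpa using h1
    refine (DifferentiableAt.comp (f := fun s : ℂ => s - x i) (x i) h3 h2).congr_of_eventuallyEq
      (Eventually.of_forall fun s => ?_)
    simp only [Function.comp, ← map_smul, ← map_add]
    congr 2
    ext j
    by_cases hj : j = i
    · subst hj; simp
    · simp [hj]
  have := AnalyticAt.comp (f := e) (x := p) key (e.toContinuousLinearMap.analyticAt p)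
  refine this.congr (Eventually.of_forall fun x => ?_)
  simp

theorem DifferentiableOn.analyticOnNhd_of_finiteDimensional {E : Type*} [NormedAddCommGroup E]
    [NormedSpace ℂ E] [FiniteDimensional ℂ E] {f : E → ℂ} {U : Set E}
    (hf : DifferentiableOn ℂ f U) (hU : IsOpen U) : AnalyticOnNhd ℂ f U := by
  refine analyticOnNhd_of_continuousOn_of_differentiableAt_line hU hf.continuousOn fun x hx v => ?_
  have h1 : DifferentiableAt ℂ f (x + (0 : ℂ) • v) := by
    simpa using hf.differentiableAt (hU.mem_nhds hx)
  exact DifferentiableAt.comp (f := fun s : ℂ => x + s • v) 0 h1 (by fun_prop)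

open MeasureTheory Metric Complex in
theorem differentiableAt_circleIntegral_translate {E : Type*} [NormedAddCommGroup E]
    [NormedSpace ℂ E] [FiniteDimensional ℂ E] {q : E → ℂ} {W : Set E} {p v : E} {δ : ℝ}
    (hδ : 0 < δ) (hW : IsOpen W) (hq : AnalyticOnNhd ℂ q W)
    (hp : ∀ s ∈ sphere (0 : ℂ) δ, p + s • v ∈ W) :
    DifferentiableAt ℂ (fun x => ∮ s in C(0, δ), s⁻¹ • q (x + s • v)) p := by
  have : ProperSpace E := FiniteDimensional.proper ℂ E
  let γ : ℝ → ℂ := circleMap 0 δ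
  have hγ : Continuous γ := continuous_circleMap 0 δ
  have hγs : ∀ t, γ t ∈ sphere (0 : ℂ) δ := fun t => circleMap_mem_sphere 0 hδ.le t
  have hγ0 : ∀ t, γ t ≠ 0 := fun t => circleMap_ne_center hδ.ne'
  have hK : IsCompact ((fun s : ℂ => p + s • v) '' sphere 0 δ) :=
    (isCompact_sphere 0 δ).image (by fun_prop)
  obtain ⟨ε, hε, hεW⟩ := hK.exists_cthickening_subset_open hW (by
    rintro _ ⟨s, hs, rfl⟩; exact hp s hs)
  have hmem : ∀ x ∈ ball p ε, ∀ t, x + γ t • v ∈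
      cthickening ε ((fun s : ℂ => p + s • v) '' sphere 0 δ) := by
    intro x hx t
    refine mem_cthickening_of_dist_le _ _ _ _ ⟨γ t, hγs t, rfl⟩ ?_
    simpa using (mem_ball.1 hx).le
  obtain ⟨B, hB⟩ := (hK.cthickening (r := ε)).exists_bound_of_continuousOn
    (f := fderiv ℂ q) (hq.fderiv.continuousOn.mono hεW)
  have hk : Continuous fun t => deriv γ t * (γ t)⁻¹ := by
    refine Continuous.mul ?_ (hγ.inv₀ hγ0)
    simp only [γ]
    have : deriv (circleMap 0 δ) = fun t => circleMap 0 δ t * I := by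
      ext t; simp
    rw [this]
    fun_prop
  have hcont : ∀ x ∈ ball p ε, Continuous fun t => deriv γ t • (γ t)⁻¹ • q (x + γ t • v) := by
    intro x hx
    have h1 : Continuous fun t => q (x + γ t • v) :=
      hq.continuousOn.comp_continuous (by fun_prop) fun t => hεW (hmem x hx t)
    simp only [smul_smul]
    exact hk.smul h1
  have hcont' : Continuous fun t => (deriv γ t * (γ t)⁻¹) • fderiv ℂ q (p + γ t • v) := by
    have h1 : Continuous fun t => fderiv ℂ q (p + γ t • v) :=
      hq.fderiv.continuousOn.comp_continuous (by fun_prop)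
        fun t => hεW (hmem p (mem_ball_self hε) t)
    exact hk.smul h1
  have := intervalIntegral.hasFDerivAt_integral_of_dominated_of_fderiv_le (𝕜 := ℂ) (μ := volume)
    (F := fun x t => deriv γ t • (γ t)⁻¹ • q (x + γ t • v))
    (F' := fun x t => (deriv γ t * (γ t)⁻¹) • fderiv ℂ q (x + γ t • v))
    (a := 0) (b := 2 * Real.pi) (x₀ := p) (s := ball p ε)
    (bound := fun t => ‖deriv γ t * (γ t)⁻¹‖ * B) (ball_mem_nhds p hε)
    (by filter_upwards [ball_mem_nhds p hε] with x hx using (hcont x hx).aestronglyMeasurable)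
    ((hcont p (mem_ball_self hε)).intervalIntegrable _ _)
    hcont'.aestronglyMeasurable
    (Eventually.of_forall fun t _ x hx => by
      rw [norm_smul]
      exact mul_le_mul_of_nonneg_left (hB _ (hmem x hx t)) (norm_nonneg _))
    ((hk.norm.mul continuous_const).intervalIntegrable _ _)
    (Eventually.of_forall fun t _ x hx => by
      have h1 : HasFDerivAt q (fderiv ℂ q (x + γ t • v)) (x + γ t • v) :=
        (hq _ (hεW (hmem x hx t))).differentiableAt.hasFDerivAt
      have h2 := (h1.comp x ((hasFDerivAt_id x).add_const (γ t • v))).const_smul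
        (deriv γ t * (γ t)⁻¹)
      simp only [smul_smul]
      exact h2)
  exact this.differentiableAt

open Metric Complex in
/-- Removable singularities on a disc: a quotient whose only possible pole is simple and
cancelled by a zero of the numerator extends holomorphically. -/
theorem exists_diffContOnCl_mul_eq {φ χ : ℂ → ℂ} {W : Set ℂ} {δ : ℝ} (hδ : 0 < δ) (hW : IsOpen W)
    (hδW : closedBall 0 δ ⊆ W) (hφ : DifferentiableOn ℂ φ W) (hχ : DifferentiableOn ℂ χ W)
    (hinj : Set.InjOn χ (closedBall 0 δ))
    (hz : ∀ s ∈ closedBall 0 δ, χ s = 0 → φ s = 0 ∧ deriv χ s ≠ 0) :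
    ∃ ψ : ℂ → ℂ, DiffContOnCl ℂ ψ (ball 0 δ) ∧ ∀ s ∈ closedBall 0 δ, φ s = ψ s * χ s := by
  have hcl : closure (ball (0 : ℂ) δ) = closedBall 0 δ := closure_ball 0 hδ.ne'
  by_cases h0 : ∃ s₀ ∈ closedBall (0 : ℂ) δ, χ s₀ = 0
  · obtain ⟨s₀, hs₀, hχ0⟩ := h0
    have hφ0 := (hz s₀ hs₀ hχ0).1
    have hWn := hW.mem_nhds (hδW hs₀)
    have hne : ∀ s ∈ closedBall (0 : ℂ) δ, dslope χ s₀ s ≠ 0 := by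
      intro s hsm
      by_cases hss : s = s₀
      · rw [hss, dslope_same]; exact (hz s₀ hs₀ hχ0).2
      · rw [dslope_of_ne _ hss, slope_def_field, hχ0, sub_zero]
        refine div_ne_zero (fun h => hss (hinj hsm hs₀ (h.trans hχ0.symm))) (sub_ne_zero.2 hss)
    refine ⟨fun s => dslope φ s₀ s / dslope χ s₀ s, ?_, fun s hsm => ?_⟩
    · refine DifferentiableOn.diffContOnCl ?_
      rw [hcl]
      exact ((differentiableOn_dslope hWn).2 hφ |>.mono hδW).div
        ((differentiableOn_dslope hWn).2 hχ |>.mono hδW) hne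
    · have h1 := sub_smul_dslope φ s₀ s
      have h2 := sub_smul_dslope χ s₀ s
      rw [hφ0, sub_zero, smul_eq_mul] at h1
      rw [hχ0, sub_zero, smul_eq_mul] at h2
      have := hne s hsm
      rw [← h1, ← h2]
      field_simp
  · push Not at h0
    refine ⟨fun s => φ s / χ s, ?_, fun s hsm => ?_⟩
    · refine DifferentiableOn.diffContOnCl ?_
      rw [hcl]
      exact (hφ.mono hδW).div (hχ.mono hδW) h0
    · have := h0 s hsm
      field_simp

open Metric in
/-- Near a regular zero of `h`, small circles in a transversal direction stay away from the zero
set of `h`. -/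
theorem exists_transversal_circle {E : Type*} [NormedAddCommGroup E] [NormedSpace ℂ E]
    {h : E → ℂ} {U : Set E} {p₀ : E} (hU : U ∈ 𝓝 p₀) (hh : AnalyticAt ℂ h p₀) (h0 : h p₀ = 0)
    (hd : fderiv ℂ h p₀ ≠ 0) :
    ∃ (v : E) (δ r : ℝ), 0 < δ ∧ 0 < r ∧
      (∀ p ∈ ball p₀ r, ∀ s ∈ closedBall (0 : ℂ) δ, p + s • v ∈ U) ∧
      (∀ p ∈ ball p₀ r, ∀ s ∈ closedBall (0 : ℂ) δ, fderiv ℂ h (p + s • v) v ≠ 0) ∧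
      (∀ p ∈ ball p₀ r, Set.InjOn (fun s : ℂ => h (p + s • v)) (closedBall 0 δ)) ∧
      (∀ p ∈ ball p₀ r, ∀ s ∈ sphere (0 : ℂ) δ, δ / 2 ≤ ‖h (p + s • v)‖) := by
  obtain ⟨v, hv⟩ : ∃ v, fderiv ℂ h p₀ v = 1 := by
    obtain ⟨u, hu⟩ : ∃ u, fderiv ℂ h p₀ u ≠ 0 := by
      by_contra! H
      exact hd (ContinuousLinearMap.ext H)
    exact ⟨(fderiv ℂ h p₀ u)⁻¹ • u, by simp [hu]⟩
  have hv0 : 0 < ‖v‖ := by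
    rw [norm_pos_iff]
    rintro rfl
    simp at hv
  have hc : (0 : ℝ) < 1 / (4 * ‖v‖) := by positivity
  have e1 := (hh.hasStrictFDerivAt.isLittleO.def hc)
  have e2 : ∀ᶠ q in 𝓝 p₀, fderiv ℂ h q v ≠ 0 := by
    have : ContinuousAt (fun q => fderiv ℂ h q v) p₀ :=
      hh.fderiv.continuousAt.clm_apply continuousAt_const
    exact this.eventually_ne (by rw [hv]; exact one_ne_zero)
  rw [nhds_prod_eq] at e1
  obtain ⟨R, hR, hRU⟩ := Metric.eventually_nhds_iff_ball.1
    ((e1.diag_of_prod.and (e2.and hU)))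
  obtain ⟨R', hR', hRU'⟩ := Metric.eventually_nhds_iff_ball.1
    (show ∀ᶠ x in 𝓝 (p₀, p₀), ‖h x.1 - h x.2 - fderiv ℂ h p₀ (x.1 - x.2)‖ ≤
      1 / (4 * ‖v‖) * ‖x.1 - x.2‖ by rw [nhds_prod_eq]; exact e1)
  set ε := min R R'
  have hε : 0 < ε := lt_min hR hR'
  let δ := ε / (2 * ‖v‖)
  have hδ : 0 < δ := by positivity
  obtain ⟨r', hr', hrh⟩ := Metric.eventually_nhds_iff_ball.1
    (show ∀ᶠ q in 𝓝 p₀, ‖h q‖ < δ / 4 by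
      have := hh.continuousAt.norm
      refine this.eventually_lt continuousAt_const ?_
      rw [h0, norm_zero]
      positivity)
  have hin : ∀ p ∈ ball p₀ (min (ε / 2) r'), ∀ s ∈ closedBall (0 : ℂ) δ,
      p + s • v ∈ ball p₀ ε := by
    intro p hp s hs
    rw [mem_ball, dist_eq_norm] at hp ⊢
    have h1 : ‖p - p₀‖ < ε / 2 := hp.trans_le (min_le_left _ _)
    have h2 : ‖s • v‖ ≤ ε / 2 := by
      rw [norm_smul]
      have : ‖s‖ ≤ δ := by simpa using hs
      calc ‖s‖ * ‖v‖ ≤ δ * ‖v‖ := by gcongr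
        _ = ε / 2 := by simp only [δ]; field_simp
    calc ‖p + s • v - p₀‖ = ‖(p - p₀) + s • v‖ := by congr 1; abel
      _ ≤ ‖p - p₀‖ + ‖s • v‖ := norm_add_le _ _
      _ < ε := by linarith
  have hdiff : ∀ p ∈ ball p₀ (min (ε / 2) r'), ∀ s ∈ closedBall (0 : ℂ) δ,
      ∀ t ∈ closedBall (0 : ℂ) δ,
      ‖h (p + s • v) - h (p + t • v) - (s - t)‖ ≤ ‖s - t‖ / 4 := by
    intro p hp s hs t ht
    have h1 := hRU' (p + s • v, p + t • v) (by
      rw [← ball_prod_same]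
      exact ⟨ball_subset_ball (min_le_right _ _) (hin p hp s hs),
        ball_subset_ball (min_le_right _ _) (hin p hp t ht)⟩)
    have h2 : p + s • v - (p + t • v) = (s - t) • v := by rw [sub_smul]; abel
    simp only [h2, map_smul, hv, smul_eq_mul, mul_one, norm_smul] at h1
    refine h1.trans_eq ?_
    field_simp
  refine ⟨v, δ, min (ε / 2) r', hδ, lt_min (by positivity) hr', ?_, ?_, ?_, ?_⟩
  · exact fun p hp s hs => (hRU _ (ball_subset_ball (min_le_left _ _) (hin p hp s hs))).2.2
  · exact fun p hp s hs => (hRU _ (ball_subset_ball (min_le_left _ _) (hin p hp s hs))).2.1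
  · intro p hp s hs t ht hst
    have h1 := hdiff p hp s hs t ht
    simp only at hst
    rw [hst, sub_self, zero_sub, norm_neg] at h1
    have : ‖s - t‖ = 0 := by linarith [norm_nonneg (s - t)]
    exact sub_eq_zero.1 (norm_eq_zero.1 this)
  · intro p hp s hs
    have h1 := hdiff p hp s (sphere_subset_closedBall hs) 0 (by simp [hδ.le])
    have h2 := hrh p (ball_subset_ball (min_le_right _ _) hp)
    have h3 : ‖s‖ = δ := by simpa using hs
    simp only [zero_smul, add_zero, sub_zero] at h1
    have h4 : ‖s‖ ≤ ‖h (p + s • v) - h p - s‖ + ‖h p‖ + ‖h (p + s • v)‖ := by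
      calc ‖s‖ = ‖-(h (p + s • v) - h p - s) - h p + h (p + s • v)‖ := by congr 1; ring
        _ ≤ _ := by
          refine (norm_add_le _ _).trans ?_
          gcongr
          exact (norm_sub_le _ _).trans_eq (by rw [norm_neg])
    linarith

open Metric in
theorem exists_analytic_div_nhds {E : Type*} [NormedAddCommGroup E] [NormedSpace ℂ E]
    [FiniteDimensional ℂ E] {f h : E → ℂ} {U : Set E} (hU : IsOpen U)
    (hf : AnalyticOnNhd ℂ f U) (hh : AnalyticOnNhd ℂ h U) (hz : ∀ p ∈ U, h p = 0 → f p = 0)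
    {p₀ : E} (hp₀ : p₀ ∈ U) (hd : h p₀ = 0 → fderiv ℂ h p₀ ≠ 0) :
    ∃ (r : ℝ) (g : E → ℂ), 0 < r ∧ AnalyticOnNhd ℂ g (ball p₀ r) ∧
      ∀ p ∈ ball p₀ r, f p = g p * h p := by
  by_cases h0 : h p₀ = 0
  · obtain ⟨v, δ, r, hδ, hr, hin, hdv, hinj, hs⟩ :=
      exists_transversal_circle (hU.mem_nhds hp₀) (hh p₀ hp₀) h0 (hd h0)
    have hne : ∀ p ∈ ball p₀ r, ∀ s ∈ sphere (0 : ℂ) δ, h (p + s • v) ≠ 0 := fun p hp s hsm => by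
      rw [← norm_pos_iff]
      exact lt_of_lt_of_le (by positivity) (hs p hp s hsm)
    let W := U ∩ h ⁻¹' {0}ᶜ
    have hW : IsOpen W := hh.continuousOn.isOpen_inter_preimage hU isOpen_compl_singleton
    have hq : AnalyticOnNhd ℂ (fun p => f p / h p) W := fun p hp =>
      (hf p hp.1).div (hh p hp.1) hp.2
    refine ⟨r, fun p => (2 * Real.pi * Complex.I)⁻¹ *
      ∮ s in C(0, δ), s⁻¹ • (f (p + s • v) / h (p + s • v)), hr, ?_, fun p hp => ?_⟩
    · refine DifferentiableOn.analyticOnNhd_of_finiteDimensional (fun p hp => ?_) isOpen_ball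
      have h1 := differentiableAt_circleIntegral_translate (q := fun p => f p / h p) (p := p)
        (v := v) hδ hW hq fun s hsm =>
          ⟨hin p hp s (sphere_subset_closedBall hsm), hne p hp s hsm⟩
      exact (h1.const_mul _).differentiableWithinAt
    · have hline : ∀ {k : E → ℂ}, AnalyticOnNhd ℂ k U → DifferentiableOn ℂ
          (fun s : ℂ => k (p + s • v)) ((fun s : ℂ => p + s • v) ⁻¹' U) := fun hk =>
        hk.differentiableOn.comp (by fun_prop) fun s hs => hs
      obtain ⟨ψ, hψ, hψeq⟩ := exists_diffContOnCl_mul_eq hδ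
        (hU.preimage (by fun_prop : Continuous fun s : ℂ => p + s • v)) (fun s hs => hin p hp s hs)
        (hline hf) (hline hh) (hinj p hp) (fun s hsm h0 => ⟨hz _ (hin p hp s hsm) h0, by
          have h1 := (hh _ (hin p hp s hsm)).differentiableAt.hasFDerivAt
          have h2 : HasDerivAt (fun s : ℂ => p + s • v) v s := by
            simpa using ((hasDerivAt_id s).smul_const v).const_add p
          rw [show deriv (fun s : ℂ => h (p + s • v)) s = _ from (h1.comp_hasDerivAt s h2).deriv]
          exact hdv p hp s hsm⟩)
      have hC := hψ.circleIntegral_sub_inv_smul (w := 0) (by simpa using hδ)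
      have hψ0 := hψeq 0 (by simpa using hδ.le)
      simp only [zero_smul, add_zero] at hψ0
      rw [hψ0]
      congr 1
      rw [eq_inv_mul_iff_mul_eq₀ Complex.two_pi_I_ne_zero]
      refine hC.symm.trans (circleIntegral.integral_congr hδ.le fun s hsm => ?_)
      simp only [sub_zero]
      rw [hψeq s (sphere_subset_closedBall hsm), mul_div_cancel_right₀ _ (hne p hp s hsm)]
  · obtain ⟨r, hr, hrU⟩ := Metric.eventually_nhds_iff_ball.1
      (((hh p₀ hp₀).continuousAt.eventually_ne h0).and (hU.mem_nhds hp₀))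
    refine ⟨r, fun p => f p / h p, hr, fun p hp => (hf p (hrU p hp).2).div (hh p (hrU p hp).2)
      (hrU p hp).1, fun p hp => ?_⟩
    rw [div_mul_cancel₀ _ (hrU p hp).1]

theorem frequently_ne_zero_of_fderiv {E : Type*} [NormedAddCommGroup E] [NormedSpace ℂ E]
    {h : E → ℂ} {p : E} (hd : h p = 0 → fderiv ℂ h p ≠ 0) : ∃ᶠ q in 𝓝 p, h q ≠ 0 := by
  intro H
  have H' : h =ᶠ[𝓝 p] fun _ => 0 := by simpa using! H
  refine hd H'.eq_of_nhds ?_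
  rw [H'.fderiv_eq]
  simp

/-- Two functions continuous at `p` agree at `p` if they agree after multiplication by a function
that does not vanish identically near `p`. -/
theorem eq_of_eventually_mul_eq {E : Type*} [TopologicalSpace E] {g₁ g₂ h : E → ℂ} {p : E}
    (h₁ : ContinuousAt g₁ p) (h₂ : ContinuousAt g₂ p) (hh : ∃ᶠ q in 𝓝 p, h q ≠ 0)
    (heq : ∀ᶠ q in 𝓝 p, g₁ q * h q = g₂ q * h q) : g₁ p = g₂ p := by
  by_contra hne
  have := ((h₁.sub h₂).eventually_ne (sub_ne_zero.2 hne)).and heq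
  obtain ⟨q, hq, hq1, hq2⟩ := (hh.and_eventually this).exists
  exact hq1 (sub_eq_zero.2 (mul_right_cancel₀ hq hq2))

open Metric in
/-- An analytic function vanishing on a smooth analytic hypersurface is divisible by its defining
function. -/
theorem exists_analytic_div {E : Type*} [NormedAddCommGroup E] [NormedSpace ℂ E]
    [FiniteDimensional ℂ E] {f h : E → ℂ} {U : Set E} (hU : IsOpen U)
    (hf : AnalyticOnNhd ℂ f U) (hh : AnalyticOnNhd ℂ h U) (hz : ∀ p ∈ U, h p = 0 → f p = 0)
    (hd : ∀ p ∈ U, h p = 0 → fderiv ℂ h p ≠ 0) :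
    ∃ g : E → ℂ, AnalyticOnNhd ℂ g U ∧ ∀ p ∈ U, f p = g p * h p := by
  choose! r g hr hg hfg using fun p (hp : p ∈ U) =>
    exists_analytic_div_nhds hU hf hh hz hp (hd p hp)
  have hloc : ∀ p ∈ U, ∀ᶠ q in 𝓝 p, g p q = g q q := by
    intro p hp
    filter_upwards [ball_mem_nhds p (hr p hp), hU.mem_nhds hp] with q hq hqU
    refine eq_of_eventually_mul_eq (hg p hp q hq).continuousAt
      (hg q hqU q (mem_ball_self (hr q hqU))).continuousAt
      (frequently_ne_zero_of_fderiv (hd q hqU)) ?_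
    filter_upwards [isOpen_ball.mem_nhds hq, ball_mem_nhds q (hr q hqU)] with x hx hx'
    rw [← hfg p hp x hx, ← hfg q hqU x hx']
  exact ⟨fun p => g p p, fun p hp => (hg p hp p (mem_ball_self (hr p hp))).congr (hloc p hp),
    fun p hp => hfg p hp p (mem_ball_self (hr p hp))⟩

theorem fderiv_fderiv_apply_comm {E : Type*} [NormedAddCommGroup E] [NormedSpace ℂ E]
    {f : E → ℂ} {x : E} (hf : AnalyticAt ℂ f x) (c d : E) :
    fderiv ℂ (fun y => fderiv ℂ f y c) x d = fderiv ℂ (fun y => fderiv ℂ f y d) x c := by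
  have h1 : ∀ e, fderiv ℂ (fun y => fderiv ℂ f y e) x = (fderiv ℂ (fderiv ℂ f) x).flip e := by
    intro e
    have := (hf.fderiv.differentiableAt.hasFDerivAt).clm_apply (hasFDerivAt_const e x)
    rw [this.fderiv]
    ext
    simp
  rw [h1, h1]
  exact (hf.contDiffAt (n := 2)).isSymmSndFDerivAt (by simp) d c

theorem AnalyticAt.fderiv_apply {E : Type*} [NormedAddCommGroup E] [NormedSpace ℂ E]
    {f : E → ℂ} {x : E} (hf : AnalyticAt ℂ f x) (c : E) :
    AnalyticAt ℂ (fun y => fderiv ℂ f y c) x :=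
  ((ContinuousLinearMap.apply ℂ ℂ c).analyticAt _).comp hf.fderiv

/-- If `df` is proportional to `dρ` along the directions in `S` and the critical set of `ρ` along
`S` has codimension at least two, then `df = g dρ` along `S` with `g` analytic, and `dg` is again
proportional to `dρ` along `S`. -/
theorem exists_analytic_quotient {E : Type*} [NormedAddCommGroup E] [NormedSpace ℂ E]
    [FiniteDimensional ℂ E] {ρ f : E → ℂ} {U S : Set E} (hU : IsOpen U)
    (hρ : AnalyticOnNhd ℂ ρ U) (hf : AnalyticOnNhd ℂ f U) {a b u v : E} (ha : a ∈ S) (hb : b ∈ S)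
    (hdet : ∀ x ∈ U,
      fderiv ℂ (fun y => fderiv ℂ ρ y a) x u * fderiv ℂ (fun y => fderiv ℂ ρ y b) x v -
      fderiv ℂ (fun y => fderiv ℂ ρ y a) x v * fderiv ℂ (fun y => fderiv ℂ ρ y b) x u ≠ 0)
    (hCR : ∀ x ∈ U, ∀ c ∈ S, ∀ d ∈ S,
      fderiv ℂ ρ x c * fderiv ℂ f x d = fderiv ℂ ρ x d * fderiv ℂ f x c) :
    ∃ g : E → ℂ, AnalyticOnNhd ℂ g U ∧
      (∀ x ∈ U, ∀ c ∈ S, fderiv ℂ f x c = g x * fderiv ℂ ρ x c) ∧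
      ∀ x ∈ U, ∀ c ∈ S, ∀ d ∈ S,
        fderiv ℂ ρ x c * fderiv ℂ g x d = fderiv ℂ ρ x d * fderiv ℂ g x c := by
  have hd : ∀ p ∈ U, fderiv ℂ ρ p a = 0 → fderiv ℂ (fun y => fderiv ℂ ρ y a) p ≠ 0 := by
    intro p hp _ h
    refine hdet p hp ?_
    rw [h]
    simp
  have hz : ∀ p ∈ U, fderiv ℂ ρ p a = 0 → fderiv ℂ f p a = 0 := by
    intro p hp h0
    by_contra hne
    have hfa := (hf p hp).fderiv_apply a
    have hk : AnalyticAt ℂ (fun x => fderiv ℂ f x b / fderiv ℂ f x a) p :=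
      ((hf p hp).fderiv_apply b).div hfa hne
    have heq : (fun y => fderiv ℂ ρ y b) =ᶠ[𝓝 p]
        fun y => (fderiv ℂ f y b / fderiv ℂ f y a) * fderiv ℂ ρ y a := by
      filter_upwards [hfa.continuousAt.eventually_ne hne, hU.mem_nhds hp] with y hy hyU
      have := hCR y hyU a ha b hb
      rw [div_mul_eq_mul_div, eq_div_iff hy, ← this, mul_comm]
    have hder : fderiv ℂ (fun y => fderiv ℂ ρ y b) p =
        (fderiv ℂ f p b / fderiv ℂ f p a) • fderiv ℂ (fun y => fderiv ℂ ρ y a) p := by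
      rw [heq.fderiv_eq]
      rw [fderiv_fun_mul hk.differentiableAt ((hρ p hp).fderiv_apply a).differentiableAt, h0]
      ext w
      exact (congrArg _ (zero_mul _)).trans (add_zero (_ : ℂ))
    refine hdet p hp ?_
    rw [hder]
    simp only [_root_.smul_apply, smul_eq_mul]
    ring
  obtain ⟨g, hg, hfg⟩ := exists_analytic_div hU (fun x hx => (hf x hx).fderiv_apply a)
    (fun x hx => (hρ x hx).fderiv_apply a) hz hd
  have hgS : ∀ x ∈ U, ∀ c ∈ S, fderiv ℂ f x c = g x * fderiv ℂ ρ x c := by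
    intro x hx c hc
    refine eq_of_eventually_mul_eq (g₁ := fun x => fderiv ℂ f x c)
      (g₂ := fun x => g x * fderiv ℂ ρ x c) ((hf x hx).fderiv_apply c).continuousAt
      ((hg x hx).mul ((hρ x hx).fderiv_apply c)).continuousAt
      (frequently_ne_zero_of_fderiv (h := fun y => fderiv ℂ ρ y a) (hd x hx)) ?_
    filter_upwards [hU.mem_nhds hx] with y hy
    linear_combination hCR y hy a ha c hc + fderiv ℂ ρ y c * hfg y hy
  refine ⟨g, hg, hgS, fun x hx c hc d hd => ?_⟩
  have hsnd : ∀ c ∈ S, ∀ d, fderiv ℂ (fun y => fderiv ℂ f y c) x d =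
      g x * fderiv ℂ (fun y => fderiv ℂ ρ y c) x d + fderiv ℂ ρ x c * fderiv ℂ g x d := by
    intro c hc d
    have heq : (fun y => fderiv ℂ f y c) =ᶠ[𝓝 x] fun y => g y * fderiv ℂ ρ y c := by
      filter_upwards [hU.mem_nhds hx] with y hy using hgS y hy c hc
    rw [heq.fderiv_eq, fderiv_fun_mul (hg x hx).differentiableAt
      ((hρ x hx).fderiv_apply c).differentiableAt]
    simp
  have h1 := hsnd c hc d
  have h2 := hsnd d hd c
  rw [fderiv_fderiv_apply_comm (hf x hx), h2, fderiv_fderiv_apply_comm (hρ x hx) d c] at h1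
  exact (add_left_cancel h1).symm

/-- The iterated derivatives of `f` with respect to `ρ` along `S`. -/
theorem exists_analytic_quotient_seq {E : Type*} [NormedAddCommGroup E] [NormedSpace ℂ E]
    [FiniteDimensional ℂ E] {ρ f : E → ℂ} {U S : Set E} (hU : IsOpen U)
    (hρ : AnalyticOnNhd ℂ ρ U) (hf : AnalyticOnNhd ℂ f U) {a b u v : E} (ha : a ∈ S) (hb : b ∈ S)
    (hdet : ∀ x ∈ U,
      fderiv ℂ (fun y => fderiv ℂ ρ y a) x u * fderiv ℂ (fun y => fderiv ℂ ρ y b) x v -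
      fderiv ℂ (fun y => fderiv ℂ ρ y a) x v * fderiv ℂ (fun y => fderiv ℂ ρ y b) x u ≠ 0)
    (hCR : ∀ x ∈ U, ∀ c ∈ S, ∀ d ∈ S,
      fderiv ℂ ρ x c * fderiv ℂ f x d = fderiv ℂ ρ x d * fderiv ℂ f x c) :
    ∃ F : ℕ → E → ℂ, F 0 = f ∧ (∀ j, AnalyticOnNhd ℂ (F j) U) ∧
      ∀ j, ∀ x ∈ U, ∀ c ∈ S, fderiv ℂ (F j) x c = F (j + 1) x * fderiv ℂ ρ x c := by
  let T := {f : E → ℂ // AnalyticOnNhd ℂ f U ∧ ∀ x ∈ U, ∀ c ∈ S, ∀ d ∈ S,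
      fderiv ℂ ρ x c * fderiv ℂ f x d = fderiv ℂ ρ x d * fderiv ℂ f x c}
  have step : ∀ k : T, ∃ g : T, ∀ x ∈ U, ∀ c ∈ S, fderiv ℂ k.1 x c = g.1 x * fderiv ℂ ρ x c := by
    intro k
    obtain ⟨g, h1, h2, h3⟩ := exists_analytic_quotient hU hρ k.2.1 ha hb hdet k.2.2
    exact ⟨⟨g, h1, h3⟩, h2⟩
  choose next hnext using step
  let F : ℕ → T := fun j => next^[j] ⟨f, hf, hCR⟩
  refine ⟨fun j => (F j).1, rfl, fun j => (F j).2.1, fun j => ?_⟩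
  have : F (j + 1) = next (F j) := Function.iterate_succ_apply' next j _
  change ∀ x ∈ U, ∀ c ∈ S, fderiv ℂ (F j).1 x c = (F (j + 1)).1 x * fderiv ℂ ρ x c
  rw [this]
  exact hnext (F j)

open Metric in
theorem norm_le_of_fderiv_eq_mul {E : Type*} [NormedAddCommGroup E] [NormedSpace ℂ E]
    {h : E → ℂ} {F : ℕ → E → ℂ} {U : Set E} {a q : E} {c r M : ℝ} (hc : 0 < c) (hr : 0 < r)
    (hF : ∀ j, AnalyticOnNhd ℂ (F j) U)
    (hder : ∀ j, ∀ x ∈ U, fderiv ℂ (F j) x a = F (j + 1) x * h x)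
    (hU : ∀ t : ℂ, ‖t‖ ≤ r → q + t • a ∈ U)
    (hh : ∀ t : ℂ, ‖t‖ ≤ r → c ≤ ‖h (q + t • a)‖)
    (hM : ∀ t : ℂ, ‖t‖ ≤ r → ‖F 0 (q + t • a)‖ ≤ M) (j : ℕ) :
    ‖F j q‖ ≤ M * (Real.exp 1 / (c * r)) ^ j * j.factorial := by
  have hM0 : 0 ≤ M := (norm_nonneg _).trans (hM 0 (by simpa using hr.le))
  have key : ∀ η : ℝ, 0 < η → ∀ k : ℕ, ∀ t : ℂ, ‖t‖ + k * η ≤ r →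
      ‖F k (q + t • a)‖ ≤ M / (c * η) ^ k := by
    intro η hη k
    induction k with
    | zero =>
      intro t ht
      simpa using hM t (by simpa using ht)
    | succ k ih =>
      intro t ht
      push_cast at ht
      have hball : ∀ s ∈ closedBall t η, ‖s‖ ≤ ‖t‖ + η := by
        intro s hs
        have h1 := norm_le_norm_add_norm_sub' s t
        rw [mem_closedBall_iff_norm] at hs
        linarith
      have hk : 0 ≤ k * η := by positivity
      have hd : ∀ s ∈ closedBall t η, HasDerivAt (fun s : ℂ => F k (q + s • a))
          (fderiv ℂ (F k) (q + s • a) a) s := by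
        intro s hs
        have h1 := (hF k _ (hU s ((hball s hs).trans (by linarith)))).differentiableAt.hasFDerivAt
        have h2 : HasDerivAt (fun s : ℂ => q + s • a) a s := by
          simpa using ((hasDerivAt_id s).smul_const a).const_add q
        exact h1.comp_hasDerivAt s h2
      have hC := Complex.norm_deriv_le_of_forall_mem_sphere_norm_le (c := t) hη
        (f := fun s : ℂ => F k (q + s • a)) (C := M / (c * η) ^ k)
        (DifferentiableOn.diffContOnCl_ball (U := closedBall t η)
          (fun s hs => (hd s hs).differentiableAt.differentiableWithinAt) subset_rfl)
        (fun s hs => ih s (by have := hball s (sphere_subset_closedBall hs); linarith))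
      rw [(hd t (mem_closedBall_self hη.le)).deriv] at hC
      have ht' : ‖t‖ ≤ r := by nlinarith
      rw [hder k _ (hU t ht'), norm_mul] at hC
      have h3 : ‖F (k + 1) (q + t • a)‖ * c ≤ M / (c * η) ^ k / η :=
        (mul_le_mul_of_nonneg_left (hh t ht') (norm_nonneg _)).trans hC
      rw [← le_div_iff₀ hc] at h3
      refine h3.trans_eq ?_
      rw [pow_succ]
      field_simp
  rcases Nat.eq_zero_or_pos j with rfl | hj
  · simpa using hM 0 (by simpa using hr.le)
  have hj' : (0 : ℝ) < j := by exact_mod_cast hj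
  have h1 := key (r / j) (by positivity) j 0 (by simp [mul_div_cancel₀ r hj'.ne'])
  rw [zero_smul, add_zero] at h1
  refine h1.trans ?_
  have h2 := Real.pow_div_factorial_le_exp (x := (j : ℝ)) hj'.le j
  rw [div_le_iff₀ (by positivity), ← mul_one (j : ℝ), Real.exp_nat_mul, mul_one] at h2
  calc M / (c * (r / j)) ^ j = M / (c * r) ^ j * (j : ℝ) ^ j := by
        rw [← mul_div_assoc, div_pow, div_div_eq_mul_div, div_mul_eq_mul_div]
    _ ≤ M / (c * r) ^ j * (Real.exp 1 ^ j * j.factorial) := by gcongr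
    _ = _ := by rw [div_pow]; ring

open Metric in
/-- A sequence of iterated quotients `F (j + 1) = (∂ₐ F j) / h` of analytic functions satisfies
Cauchy type estimates at a regular zero of `h`. -/
theorem exists_norm_le_of_fderiv_eq_mul {E : Type*} [NormedAddCommGroup E] [NormedSpace ℂ E]
    {h : E → ℂ} {F : ℕ → E → ℂ} {U : Set E} {a p₀ : E} (hU : U ∈ 𝓝 p₀)
    (hh : AnalyticAt ℂ h p₀) (h0 : h p₀ = 0) (hd : fderiv ℂ h p₀ ≠ 0)
    (hF : ∀ j, AnalyticOnNhd ℂ (F j) U)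
    (hder : ∀ j, ∀ x ∈ U, fderiv ℂ (F j) x a = F (j + 1) x * h x) :
    ∃ M K r : ℝ, 0 ≤ M ∧ 0 < K ∧ 0 < r ∧
      ∀ j, ∀ x ∈ ball p₀ r, ‖F j x‖ ≤ M * K ^ j * j.factorial := by
  obtain ⟨L, T, hT, hL⟩ := (hh.contDiffAt (n := 1)).exists_lipschitzOnWith
  have hF0 : ∀ᶠ x in 𝓝 p₀, ‖F 0 x‖ < ‖F 0 p₀‖ + 1 :=
    (hF 0 p₀ (mem_of_mem_nhds hU)).continuousAt.norm.eventually_lt_const (lt_add_one _)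
  obtain ⟨ε, hε, hεU⟩ := Metric.mem_nhds_iff.1 (inter_mem (inter_mem hU hT) hF0)
  obtain ⟨v, δ, r, hδ, hr, hvU, -, -, hvh⟩ :=
    exists_transversal_circle (ball_mem_nhds p₀ (half_pos hε)) hh h0 hd
  set r₁ := min (ε / 4) (δ / 4) / ((L + 1) * (‖a‖ + 1)) with hr₁
  have hm : 0 < min (ε / 4) (δ / 4) := by positivity
  have hr₁0 : 0 < r₁ := by positivity
  have hr₁' : r₁ * ((L + 1) * (‖a‖ + 1)) = min (ε / 4) (δ / 4) := by
    rw [hr₁]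
    field_simp
  have hta : ∀ t : ℂ, ‖t‖ ≤ r₁ → (L + 1) * ‖t • a‖ ≤ min (ε / 4) (δ / 4) := by
    intro t ht
    rw [← hr₁', norm_smul]
    have : ‖t‖ * ‖a‖ ≤ r₁ * (‖a‖ + 1) := by gcongr; linarith
    calc (L + 1) * (‖t‖ * ‖a‖) ≤ (L + 1) * (r₁ * (‖a‖ + 1)) := by gcongr
      _ = _ := by ring
  have hmem : ∀ q ∈ ball p₀ (ε / 2), ∀ t : ℂ, ‖t‖ ≤ r₁ → q + t • a ∈ ball p₀ ε := by
    intro q hq t ht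
    have h1 := (hta t ht).trans (min_le_left _ _)
    have h2 : 0 ≤ L * ‖t • a‖ := by positivity
    rw [mem_ball_iff_norm] at hq ⊢
    have h3 := norm_add_le (q - p₀) (t • a)
    rw [show q + t • a - p₀ = q - p₀ + t • a by abel]
    nlinarith
  refine ⟨‖F 0 p₀‖ + 1, Real.exp 1 / (δ / 4 * r₁), r, by positivity, by positivity, hr,
    fun j x hx => ?_⟩
  have hdiff : DifferentiableOn ℂ (fun s : ℂ => F j (x + s • v)) (closedBall 0 δ) := by
    intro s hs
    have hxs : x + s • v ∈ U := (hεU (ball_subset_ball (half_le_self hε.le) (hvU x hx s hs))).1.1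
    exact ((hF j _ hxs).differentiableAt.comp s (f := fun s : ℂ => x + s • v)
      (by fun_prop)).differentiableWithinAt
  have := Complex.norm_le_of_forall_mem_frontier_norm_le (U := ball (0 : ℂ) δ) (z := 0)
    (C := (‖F 0 p₀‖ + 1) * (Real.exp 1 / (δ / 4 * r₁)) ^ j * j.factorial) isBounded_ball
    (hdiff.diffContOnCl_ball subset_rfl) ?_ (subset_closure (mem_ball_self hδ))
  · simpa using this
  intro s hs
  rw [frontier_ball _ hδ.ne'] at hs
  have hq := hvU x hx s (sphere_subset_closedBall hs)
  refine norm_le_of_fderiv_eq_mul (by positivity) hr₁0 hF hder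
    (fun t ht => (hεU (hmem _ hq t ht)).1.1) (fun t ht => ?_)
    (fun t ht => (hεU (hmem _ hq t ht)).2.le) j
  have h1 := hL.norm_sub_le (hεU (hmem _ hq t ht)).1.2
    (hεU (ball_subset_ball (half_le_self hε.le) hq)).1.2
  have h2 := (hta t ht).trans (min_le_right _ _)
  have h3 := hvh x hx s hs
  have h4 := norm_le_norm_add_norm_sub (h (x + s • v + t • a)) (h (x + s • v))
  rw [add_sub_cancel_left] at h1
  have h5 : 0 ≤ ‖t • a‖ := norm_nonneg _
  linarith

theorem hasDerivAt_sum_mul_pow_div_factorial {F : ℕ → ℂ → ℂ} {τ : ℂ → ℂ} {D s : ℂ}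
    (hτ : HasDerivAt τ (-D) s) (hF : ∀ j, HasDerivAt (F j) (F (j + 1) s * D) s) (N : ℕ) :
    HasDerivAt (fun s => ∑ j ∈ Finset.range (N + 1), F j s * τ s ^ j / j.factorial)
      (F (N + 1) s * D * τ s ^ N / N.factorial) s := by
  induction N with
  | zero => simpa using hF 0
  | succ N ih =>
    simp_rw [Finset.sum_range_succ _ (N + 1)]
    refine (ih.add (((hF (N + 1)).mul (hτ.pow (N + 1))).div_const _)).congr_deriv ?_
    have h1 : ((N + 1 : ℕ) : ℂ) ≠ 0 := by exact_mod_cast N.succ_ne_zero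
    have h2 : (N.factorial : ℂ) ≠ 0 := by exact_mod_cast N.factorial_ne_zero
    rw [Nat.factorial_succ, Nat.cast_mul]
    simp only [Pi.pow_apply, add_tsub_cancel_right]
    field_simp
    ring

open Metric in
theorem analyticAt_tsum_mul_pow_div_factorial {Z : Type*} [NormedAddCommGroup Z] [NormedSpace ℂ Z]
    [FiniteDimensional ℂ Z] {φ : ℕ → Z → ℂ} {σ : Z → ℂ} {r M K : ℝ} (hr : 0 < r) (hK : 0 < K)
    (hφ : ∀ j, AnalyticOnNhd ℂ (φ j) (ball 0 r)) (hσ : AnalyticOnNhd ℂ σ (ball 0 r))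
    (hM : ∀ j, ∀ z ∈ ball 0 r, ‖φ j z‖ ≤ M * K ^ j * j.factorial)
    (hσK : ∀ z ∈ ball 0 r, ‖σ z‖ ≤ 1 / (4 * K)) :
    AnalyticAt ℂ (fun x : Z × ℂ => ∑' j : ℕ, φ j x.1 * (x.2 - σ x.1) ^ j / j.factorial) 0 ∧
      ∀ z ∈ ball 0 r, ∀ w : ℂ, ‖w‖ ≤ 1 / (4 * K) →
        Summable fun j : ℕ => φ j z * (w - σ z) ^ j / j.factorial := by
  have hbound : ∀ z ∈ ball 0 r, ∀ w : ℂ, ‖w‖ ≤ 1 / (4 * K) → ∀ j : ℕ,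
      ‖φ j z * (w - σ z) ^ j / j.factorial‖ ≤ M * (1 / 2) ^ j := by
    intro z hz w hw j
    have h1 : ‖w - σ z‖ ≤ 1 / (2 * K) := by
      refine (norm_sub_le _ _).trans ((add_le_add hw (hσK z hz)).trans_eq ?_)
      field_simp
      norm_num
    have h2 := hM j z hz
    have h3 : (0 : ℝ) < j.factorial := by exact_mod_cast j.factorial_pos
    rw [norm_div, norm_mul, norm_pow, Complex.norm_natCast, div_le_iff₀ h3]
    have h4 : 0 ≤ M * K ^ j * j.factorial := (norm_nonneg _).trans h2
    calc ‖φ j z‖ * ‖w - σ z‖ ^ j ≤ M * K ^ j * j.factorial * (1 / (2 * K)) ^ j := by gcongr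
      _ = M * (1 / 2) ^ j * j.factorial := by
        rw [one_div, mul_inv, mul_pow, ← one_div, inv_pow]
        field_simp
  have hsum : Summable fun j : ℕ => M * (1 / 2 : ℝ) ^ j := summable_geometric_two.mul_left M
  refine ⟨?_, fun z hz w hw => .of_norm_bounded hsum (hbound z hz w hw)⟩
  set V : Set (Z × ℂ) := ball 0 r ×ˢ ball 0 (1 / (4 * K)) with hV
  have hVo : IsOpen V := isOpen_ball.prod isOpen_ball
  have hterm : ∀ j : ℕ, DifferentiableOn ℂ
      (fun x : Z × ℂ => φ j x.1 * (x.2 - σ x.1) ^ j / j.factorial) V := by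
    rintro j x ⟨h1, -⟩
    have h2 : DifferentiableAt ℂ (fun x : Z × ℂ => φ j x.1) x :=
      (hφ j _ h1).differentiableAt.comp x differentiableAt_fst
    have h3 : DifferentiableAt ℂ (fun x : Z × ℂ => σ x.1) x :=
      (hσ _ h1).differentiableAt.comp x differentiableAt_fst
    have h4 : DifferentiableAt ℂ (fun x : Z × ℂ => φ j x.1 * (x.2 - σ x.1) ^ j) x :=
      h2.mul ((differentiableAt_snd.sub h3).pow j)
    simpa only [div_eq_mul_inv] using (h4.mul_const _).differentiableWithinAt
  have hVb : ∀ j : ℕ, ∀ x ∈ V, ‖φ j x.1 * (x.2 - σ x.1) ^ j / j.factorial‖ ≤ M * (1 / 2) ^ j :=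
    fun j x hx => hbound _ hx.1 _ (mem_ball_zero_iff.1 hx.2).le j
  refine analyticOnNhd_of_continuousOn_of_differentiableAt_line hVo
    (continuousOn_tsum (fun j => (hterm j).continuousOn) hsum hVb) (fun x hx v => ?_) 0
    ⟨mem_ball_self hr, mem_ball_self (by positivity)⟩
  have hline : Continuous fun s : ℂ => x + s • v := by fun_prop
  have hW := hVo.preimage hline
  have h0 : (0 : ℂ) ∈ (fun s : ℂ => x + s • v) ⁻¹' V := by simpa using hx
  exact (Complex.differentiableOn_tsum_of_summable_norm hsum
    (fun j => (hterm j).comp (g := fun x : Z × ℂ => φ j x.1 * (x.2 - σ x.1) ^ j / j.factorial)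
      (f := fun s : ℂ => x + s • v)
      (by fun_prop) (Set.mapsTo_preimage _ _)) hW (fun j s hs => hVb j _ hs)).differentiableAt
    (hW.mem_nhds h0)

open Metric in
/-- Taylor summation: if `∂_ξ (F j) = F (j + 1) ∂_ξ ρ` with Cauchy type estimates on the `F j`,
then `F 0` is an analytic function of `(z, ρ)`. -/
theorem exists_analyticAt_comp_of_fderiv_eq_mul {Z X : Type*} [NormedAddCommGroup Z]
    [NormedSpace ℂ Z] [FiniteDimensional ℂ Z] [NormedAddCommGroup X] [NormedSpace ℂ X]
    {ρ : Z × X → ℂ} {F : ℕ → Z × X → ℂ} {U : Set (Z × X)} (hU : U ∈ 𝓝 0)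
    (hρ : AnalyticAt ℂ ρ 0) (hρ0 : ρ 0 = 0) (hF : ∀ j, AnalyticOnNhd ℂ (F j) U)
    (hder : ∀ j, ∀ x ∈ U, ∀ c : X, fderiv ℂ (F j) x (0, c) = F (j + 1) x * fderiv ℂ ρ x (0, c))
    {M K r : ℝ} (hM0 : 0 ≤ M) (hK : 0 < K) (hr : 0 < r)
    (hM : ∀ j, ∀ x ∈ ball 0 r, ‖F j x‖ ≤ M * K ^ j * j.factorial) :
    ∃ G : Z × ℂ → ℂ, AnalyticAt ℂ G 0 ∧ ∀ᶠ p in 𝓝 0, F 0 p = G (p.1, ρ p) := by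
  have hρs : ∀ᶠ p in 𝓝 0, ‖ρ p‖ < 1 / (8 * K) :=
    hρ.continuousAt.norm.eventually_lt_const (by simp [hρ0, hK])
  have hρd : ∀ᶠ p in 𝓝 0, ‖fderiv ℂ ρ p‖ < ‖fderiv ℂ ρ 0‖ + 1 :=
    hρ.fderiv.continuousAt.norm.eventually_lt_const (lt_add_one _)
  obtain ⟨ε, hε, hεU⟩ := Metric.mem_nhds_iff.1 (inter_mem (inter_mem (inter_mem hU
    (ball_mem_nhds 0 hr)) hρ.eventually_analyticAt) (inter_mem hρs hρd))
  have hin : ∀ z ∈ ball (0 : Z) ε, (z, (0 : X)) ∈ ball (0 : Z × X) ε := by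
    intro z hz
    simpa [mem_ball_zero_iff, Prod.norm_def, hε] using hz
  have hinl : ∀ z : Z, AnalyticAt ℂ (fun z : Z => (z, (0 : X))) z :=
    fun z => analyticAt_id.prod analyticAt_const
  have hle : 1 / (8 * K) ≤ 1 / (4 * K) := by gcongr; norm_num
  obtain ⟨hG, hsum⟩ := analyticAt_tsum_mul_pow_div_factorial (φ := fun j z => F j (z, 0))
    (σ := fun z => ρ (z, 0)) (M := M) hε hK
    (fun j z hz => AnalyticAt.fun_comp (g := F j) (hF j _ (hεU (hin z hz)).1.1.1) (hinl z))
    (fun z hz => AnalyticAt.fun_comp (g := ρ) (hεU (hin z hz)).1.2 (hinl z))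
    (fun j z hz => hM j _ (hεU (hin z hz)).1.1.2)
    (fun z hz => (hεU (hin z hz)).2.1.le.trans hle)
  refine ⟨_, hG, ?_⟩
  filter_upwards [ball_mem_nhds 0 hε] with p hp
  have hseg : ∀ s ∈ closedBall (0 : ℂ) 1, (p.1, s • p.2) ∈ ball (0 : Z × X) ε := by
    intro s hs
    rw [mem_ball_zero_iff, Prod.norm_def, max_lt_iff] at hp ⊢
    rw [mem_closedBall_zero_iff] at hs
    exact ⟨hp.1, (norm_smul_le _ _).trans_lt
      ((mul_le_of_le_one_left (norm_nonneg _) hs).trans_lt hp.2)⟩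
  have hz : p.1 ∈ ball (0 : Z) ε := by
    rw [mem_ball_zero_iff] at hp ⊢
    exact (norm_fst_le p).trans_lt hp
  let Φ : ℕ → ℂ → ℂ := fun N s => ∑ j ∈ Finset.range (N + 1),
    F j (p.1, s • p.2) * (ρ p - ρ (p.1, s • p.2)) ^ j / j.factorial
  have hΦ1 : ∀ N, Φ N 1 = F 0 p := by
    intro N
    simp only [Φ]
    rw [Finset.sum_range_succ']
    simp
  have hΦ0 : Tendsto (fun N => Φ N 0) atTop
      (𝓝 (∑' j : ℕ, F j (p.1, 0) * (ρ p - ρ (p.1, 0)) ^ j / j.factorial)) := by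
    have := (tendsto_add_atTop_iff_nat 1).2
      (hsum p.1 hz (ρ p) ((hεU hp).2.1.le.trans hle)).hasSum.tendsto_sum_nat
    simpa [Φ] using this
  refine tendsto_nhds_unique (f := fun N => Φ N 0) ?_ hΦ0
  rw [tendsto_iff_norm_sub_tendsto_zero]
  set D := (‖fderiv ℂ ρ 0‖ + 1) * ‖p.2‖ with hD
  have hD0 : 0 ≤ D := by positivity
  refine squeeze_zero (g := fun N : ℕ => M * K * D * (((N + 1 : ℕ) : ℝ) * (1 / 4) ^ N))
    (fun _ => norm_nonneg _) (fun N => ?_) ?_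
  · have hcurve : ∀ s : ℂ, HasDerivAt (fun s : ℂ => (p.1, s • p.2)) ((0 : Z), p.2) s := by
      intro s
      have h2 : HasDerivAt (fun s : ℂ => s • p.2) p.2 s := by
        simpa using (hasDerivAt_id s).smul_const p.2
      exact (hasDerivAt_const s p.1).prodMk h2
    have hder' : ∀ s ∈ closedBall (0 : ℂ) 1, HasDerivWithinAt (Φ N)
        (F (N + 1) (p.1, s • p.2) * fderiv ℂ ρ (p.1, s • p.2) (0, p.2) *
          (ρ p - ρ (p.1, s • p.2)) ^ N / N.factorial) (closedBall 0 1) s := by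
      intro s hs
      have hsU := hεU (hseg s hs)
      have h1 : HasDerivAt (fun s : ℂ => ρ (p.1, s • p.2))
          (fderiv ℂ ρ (p.1, s • p.2) (0, p.2)) s :=
        (AnalyticAt.differentiableAt hsU.1.2).hasFDerivAt.comp_hasDerivAt s (hcurve s)
      refine (hasDerivAt_sum_mul_pow_div_factorial (F := fun j s => F j (p.1, s • p.2))
        (h1.const_sub (ρ p)) (fun j => ?_) N).hasDerivWithinAt
      rw [← hder j _ hsU.1.1.1]
      exact (hF j _ hsU.1.1.1).differentiableAt.hasFDerivAt.comp_hasDerivAt s (hcurve s)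
    have := (convex_closedBall (0 : ℂ) 1).norm_image_sub_le_of_norm_hasDerivWithin_le hder'
      (C := M * K * D * (((N + 1 : ℕ) : ℝ) * (1 / 4) ^ N)) (fun s hs => ?_)
      (x := 1) (y := 0) (by simp) (by simp)
    · rw [hΦ1] at this
      simpa using this
    have hsU := hεU (hseg s hs)
    have h1 : ‖F (N + 1) (p.1, s • p.2)‖ ≤ M * K ^ (N + 1) * (N + 1).factorial :=
      hM _ _ hsU.1.1.2
    have h2 : ‖fderiv ℂ ρ (p.1, s • p.2) (0, p.2)‖ ≤ D := by
      refine (ContinuousLinearMap.le_opNorm _ _).trans ?_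
      have h3 : ‖((0 : Z), p.2)‖ = ‖p.2‖ := by simp [Prod.norm_def]
      rw [h3, hD]
      exact mul_le_mul_of_nonneg_right (le_of_lt hsU.2.2) (norm_nonneg _)
    have h3 : ‖ρ p - ρ (p.1, s • p.2)‖ ≤ 1 / (4 * K) := by
      refine (norm_sub_le _ _).trans ((add_le_add (hεU hp).2.1.le hsU.2.1.le).trans_eq ?_)
      field_simp
      norm_num
    have h4 : (0 : ℝ) < N.factorial := by exact_mod_cast N.factorial_pos
    rw [norm_div, norm_mul, norm_mul, norm_pow, Complex.norm_natCast, div_le_iff₀ h4]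
    calc _ ≤ M * K ^ (N + 1) * (N + 1).factorial * D * (1 / (4 * K)) ^ N := by gcongr
      _ = _ := by
        rw [Nat.factorial_succ, Nat.cast_mul, pow_succ, one_div (4 * K), mul_inv, mul_pow,
          ← one_div, inv_pow]
        field_simp
  · have h1 := tendsto_self_mul_const_pow_of_lt_one (r := (1 / 4 : ℝ)) (by norm_num) (by norm_num)
    have h2 := tendsto_pow_atTop_nhds_zero_of_lt_one (r := (1 / 4 : ℝ)) (by norm_num) (by norm_num)
    have h3 := (h1.add h2).const_mul (M * K * D)
    simp only [add_zero, mul_zero] at h3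
    refine h3.congr fun N => ?_
    push_cast
    ring

theorem ContinuousLinearMap.eq_zero_of_forall_star {V W : Type*} [NormedAddCommGroup V]
    [NormedSpace ℂ V] [StarAddMonoid V] [StarModule ℂ V] [NormedAddCommGroup W] [NormedSpace ℂ W]
    {L : V × V →L[ℂ] W} (h : ∀ v, L (v, star v) = 0) : L = 0 := by
  have h1 : ∀ v, L (v, 0) = 0 := by
    intro v
    have h2 : L (v, -star v) = 0 := by
      have h3 := h (Complex.I • v)
      rw [star_smul, RCLike.star_def, Complex.conj_I, neg_smul, ← smul_neg, ← Prod.smul_mk,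
        map_smul] at h3
      exact (smul_eq_zero_iff_right Complex.I_ne_zero).1 h3
    have h3 : (2 : ℂ) • L (v, 0) = L (v, star v) + L (v, -star v) := by
      rw [← map_add, ← map_smul]
      simp [two_smul]
    rw [h, h2, add_zero] at h3
    exact (smul_eq_zero_iff_right two_ne_zero).1 h3
  ext x
  · simpa using h1 x
  · have h2 : L (star x, x) = L (star x, 0) + L (0, x) := by
      rw [← map_add]
      simp
    have h3 := h (star x)
    rw [star_star, h2, h1, zero_add] at h3
    simpa using h3

theorem eventually_fderiv_eq_zero_of_star {n : ℕ} {W : Type*} [NormedAddCommGroup W]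
    [NormedSpace ℂ W] {g : (Fin n → ℂ) × (Fin n → ℂ) → W}
    (hg : ∀ᶠ p in 𝓝 0, DifferentiableAt ℂ g p)
    (h : ∀ᶠ z : Fin n → ℂ in 𝓝 0, g (z, star z) = 0) :
    ∀ᶠ z : Fin n → ℂ in 𝓝 0, fderiv ℂ g (z, star z) = 0 := by
  have hι : Tendsto (fun z : Fin n → ℂ => (z, star z)) (𝓝 0) (𝓝 0) := by
    have : Continuous (fun z : Fin n → ℂ => (z, star z)) := by fun_prop
    simpa using! this.tendsto 0
  filter_upwards [hι.eventually hg, eventually_eventually_nhds.2 h] with z hz hz0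
  refine ContinuousLinearMap.eq_zero_of_forall_star fun v => ?_
  have h1 : HasDerivAt (fun t : ℝ => z + t • v) v 0 := by
    simpa using ((hasDerivAt_id (0 : ℝ)).smul_const v).const_add z
  have h2 : HasDerivAt (fun t : ℝ => (z + t • v, star (z + t • v))) (v, star v) 0 :=
    h1.prodMk h1.star
  have hz' : HasFDerivAt g ((fderiv ℂ g (z, star z)).restrictScalars ℝ)
      (z + (0 : ℝ) • v, star (z + (0 : ℝ) • v)) := by
    simpa using hz.hasFDerivAt.restrictScalars ℝ
  have h3 := hz'.comp_hasDerivAt (0 : ℝ) h2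
  have h4 : (g ∘ fun t : ℝ => (z + t • v, star (z + t • v))) =ᶠ[𝓝 0] fun _ => 0 := by
    have : Tendsto (fun t : ℝ => z + t • v) (𝓝 0) (𝓝 z) := by
      simpa using h1.continuousAt.tendsto
    exact this.eventually hz0
  simpa using h3.unique ((hasDerivAt_const (0 : ℝ) (0 : W)).congr_of_eventuallyEq h4)

/-- An analytic function of `(z, ξ)` vanishing for `ξ = z̄` vanishes identically. -/
theorem AnalyticAt.eventually_eq_zero_of_star {n : ℕ} {g : (Fin n → ℂ) × (Fin n → ℂ) → ℂ}
    (hg : AnalyticAt ℂ g 0) (h : ∀ᶠ z : Fin n → ℂ in 𝓝 0, g (z, star z) = 0) :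
    ∀ᶠ p in 𝓝 0, g p = 0 := by
  have key : ∀ k, ∀ᶠ z : Fin n → ℂ in 𝓝 0, iteratedFDeriv ℂ k g (z, star z) = 0 := by
    intro k
    induction k with
    | zero =>
      filter_upwards [h] with z hz
      ext
      simpa using hz
    | succ k ih =>
      have hd : ∀ᶠ p in 𝓝 0, DifferentiableAt ℂ (iteratedFDeriv ℂ k g) p := by
        obtain ⟨s, hs, hgs⟩ := hg.exists_mem_nhds_analyticOnNhd
        filter_upwards [eventually_mem_nhds_iff.2 hs] with p hp
          using (hgs.iteratedFDeriv k p (mem_of_mem_nhds hp)).differentiableAt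
      filter_upwards [eventually_fderiv_eq_zero_of_star hd ih] with z hz
      rw [iteratedFDeriv_succ_eq_comp_left, Function.comp_apply, hz, LinearIsometryEquiv.map_zero]
  obtain ⟨p, r, hp⟩ := hg
  filter_upwards [hp.eventually_hasSum] with y hy
  have h0 : ∀ k, p k (fun _ => y) = 0 := by
    intro k
    have h1 := hp.factorial_smul y k
    have h2 := (key k).self_of_nhds
    rw [star_zero] at h2
    change k.factorial • p k (fun _ => y) = iteratedFDeriv ℂ k g (0, 0) _ at h1
    rw [h2] at h1
    simpa [Nat.factorial_ne_zero] using h1.symm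
  simp only [h0, zero_add] at hy
  exact hy.unique hasSum_zero

theorem Matrix.exists_minor_ne_zero_of_two_le_rank {m p K : Type*} [Fintype m] [Fintype p]
    [Field K] {N : Matrix m p K} (h : 2 ≤ N.rank) :
    ∃ k l i j, N k i * N l j - N k j * N l i ≠ 0 := by
  by_contra! H
  have h1 : N.rank ≤ 1 := by
    by_cases h0 : N = 0
    · simp [h0]
    obtain ⟨k, i, hki⟩ : ∃ k i, N k i ≠ 0 := by
      by_contra! h2
      exact h0 (Matrix.ext h2)
    have h2 : N = vecMulVec (fun l => N l i) (fun j => N k j / N k i) := by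
      ext l j
      rw [vecMulVec_apply]
      field_simp
      linear_combination H k l i j
    rw [h2]
    exact rank_vecMulVec_le _ _
  omega

theorem eq_zero_of_quadratic_isBigO {W : Type*} [NormedAddCommGroup W] [NormedSpace ℝ W]
    {a b c : W} (h : (fun t : ℝ => a + t • b + t ^ 2 • c) =O[𝓝[≠] 0] fun t : ℝ => t ^ 3) :
    a = 0 ∧ b = 0 ∧ c = 0 := by
  have hdiv : ∀ {g : ℝ → W} {k : ℕ}, ((fun t : ℝ => t • g t) =O[𝓝[≠] 0] fun t : ℝ => t ^ (k + 1)) →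
      g =O[𝓝[≠] 0] fun t : ℝ => t ^ k := by
    intro g k hg
    refine ((isBigO_refl (fun t : ℝ => t⁻¹) _).smul hg).congr' ?_ ?_
    · filter_upwards [self_mem_nhdsWithin] with t ht
      rw [smul_smul, inv_mul_cancel₀ ht, one_smul]
    · filter_upwards [self_mem_nhdsWithin] with t ht
      rw [smul_eq_mul, pow_succ', inv_mul_cancel_left₀ ht]
  have hzero : ∀ {g : ℝ → W} {k : ℕ}, Continuous g →
      (g =O[𝓝[≠] 0] fun t : ℝ => t ^ (k + 1)) → g 0 = 0 := by
    intro g k hg h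
    refine tendsto_nhds_unique (hg.tendsto' 0 _ rfl |>.mono_left nhdsWithin_le_nhds)
      (h.trans_tendsto ?_)
    exact ((continuous_pow (k + 1)).tendsto' (0 : ℝ) 0 (by simp)).mono_left nhdsWithin_le_nhds
  have ha : a = 0 := by simpa using hzero (by fun_prop) h
  subst ha
  have h1 : (fun t : ℝ => b + t • c) =O[𝓝[≠] 0] fun t : ℝ => t ^ 2 := by
    refine hdiv (h.congr_left fun t => ?_)
    rw [zero_add, smul_add, smul_smul, sq]
  have hb : b = 0 := by simpa using hzero (by fun_prop) h1
  subst hb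
  have h2 : (fun _ : ℝ => c) =O[𝓝[≠] 0] fun t : ℝ => t ^ 1 :=
    hdiv (h1.congr_left fun t => by rw [zero_add])
  exact ⟨rfl, rfl, hzero continuous_const h2⟩

theorem fderiv_fderiv_apply {E : Type*} [NormedAddCommGroup E] [NormedSpace ℂ E]
    {f : E → ℂ} {x : E} (hf : AnalyticAt ℂ f x) (c d : E) :
    fderiv ℂ (fun y => fderiv ℂ f y c) x d = fderiv ℂ (fderiv ℂ f) x d c := by
  rw [((hf.fderiv.differentiableAt.hasFDerivAt).clm_apply (hasFDerivAt_const c x)).fderiv]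
  simp

/-- An analytic function of `(z, ξ)` which is `O(|z|³)` for `ξ = z̄` has vanishing 2-jet. -/
theorem AnalyticAt.two_jet_eq_zero_of_isBigO_star {n : ℕ} {R : (Fin n → ℂ) × (Fin n → ℂ) → ℂ}
    (hR : AnalyticAt ℂ R 0)
    (h : (fun z : Fin n → ℂ => R (z, star z)) =O[𝓝 0] fun z : Fin n → ℂ => ‖z‖ ^ 3) :
    R 0 = 0 ∧ fderiv ℂ R 0 = 0 ∧ fderiv ℂ (fderiv ℂ R) 0 = 0 := by
  obtain ⟨p, r, hp⟩ := id hR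
  have key : ∀ v : Fin n → ℂ, R 0 = 0 ∧ fderiv ℂ R 0 (v, star v) = 0 ∧
      fderiv ℂ (fderiv ℂ R) 0 (v, star v) (v, star v) = 0 := by
    intro v
    set y : (Fin n → ℂ) × (Fin n → ℂ) := (v, star v) with hy
    have h1 := hp.hasFPowerSeriesAt.isBigO_sub_partialSum_pow 3
    have hty : Tendsto (fun t : ℝ => t • y) (𝓝[≠] 0) (𝓝 0) :=
      (Continuous.tendsto' (by fun_prop) 0 _ (by simp)).mono_left nhdsWithin_le_nhds
    have htv : Tendsto (fun t : ℝ => t • v) (𝓝[≠] 0) (𝓝 0) :=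
      (Continuous.tendsto' (by fun_prop) 0 _ (by simp)).mono_left nhdsWithin_le_nhds
    have hbig : ∀ {V : Type} [NormedAddCommGroup V] [NormedSpace ℝ V] (w : V),
        (fun t : ℝ => ‖t • w‖ ^ 3) =O[𝓝[≠] 0] fun t : ℝ => t ^ 3 := by
      intro V _ _ w
      refine IsBigO.of_bound (‖w‖ ^ 3) (.of_forall fun t => ?_)
      simp [norm_smul, mul_pow, mul_comm]
    have h2 := (h1.comp_tendsto hty).trans (hbig y)
    have h3 := (h.comp_tendsto htv).trans (hbig v)
    have h4 := eq_zero_of_quadratic_isBigO (a := p 0 fun _ => y) (b := p 1 fun _ => y)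
      (c := p 2 fun _ => y) ((h3.sub h2).congr_left fun t => ?_)
    · have f0 := hp.factorial_smul y 0
      have f1 := hp.factorial_smul y 1
      have f2 := hp.factorial_smul y 2
      rw [h4.1] at f0
      rw [h4.2.1] at f1
      rw [h4.2.2, iteratedFDeriv_two_apply] at f2
      refine ⟨?_, ?_, ?_⟩
      · simpa using f0.symm
      · simpa using f1.symm
      · simpa using f2.symm
    · have e0 : (p 0 fun _ => t • y) = p 0 fun _ => y := by
        congr 1
        funext i
        exact i.elim0
      have e : ∀ k, (p k fun _ => t • y) = t ^ k • p k fun _ => y := by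
        intro k
        have := (p k).map_smul_univ (fun _ => (t : ℂ)) (fun _ => y)
        simpa using this
      have es : (t • v, star (t • v)) = t • y := by
        rw [hy, Prod.smul_mk, star_smul, star_trivial]
      simp only [Function.comp_apply, es, zero_add, FormalMultilinearSeries.partialSum,
        Finset.sum_range_succ, Finset.sum_range_zero, e]
      simp
  have hsymm : ∀ x y, fderiv ℂ (fderiv ℂ R) 0 x y = fderiv ℂ (fderiv ℂ R) 0 y x := by
    intro x y
    rw [← fderiv_fderiv_apply hR, fderiv_fderiv_apply_comm hR, fderiv_fderiv_apply hR]
  refine ⟨(key 0).1, ContinuousLinearMap.eq_zero_of_forall_star fun v => (key v).2.1, ?_⟩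
  refine ContinuousLinearMap.eq_zero_of_forall_star fun v =>
    ContinuousLinearMap.eq_zero_of_forall_star fun w => ?_
  have h1 := (key (v + w)).2.2
  rw [star_add, ← Prod.mk_add_mk] at h1
  simp only [map_add, _root_.add_apply] at h1
  rw [(key v).2.2, (key w).2.2, hsymm (w, star w), zero_add, add_zero, ← two_mul] at h1
  simpa using h1

theorem fderiv_apply_of_quadratic {E : Type*} [NormedAddCommGroup E] [NormedSpace ℂ E] {Q : E → ℂ}
    {y c : E} (hQ : DifferentiableAt ℂ Q y) {b q : ℂ}
    (h : ∀ t : ℂ, Q (y + t • c) = Q y + t * b + t ^ 2 * q) : fderiv ℂ Q y c = b := by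
  have h1 : HasDerivAt (fun t : ℂ => y + t • c) c 0 := by
    simpa using ((hasDerivAt_id (0 : ℂ)).smul_const c).const_add y
  have h2 : HasFDerivAt Q (fderiv ℂ Q y) (y + (0 : ℂ) • c) := by simpa using hQ.hasFDerivAt
  have h3 := h2.comp_hasDerivAt 0 h1
  have h4 : HasDerivAt (fun t : ℂ => Q y + t * b + t ^ 2 * q) b 0 := by
    have := ((((hasDerivAt_id (0 : ℂ)).mul_const b).const_add (Q y))).add
      ((hasDerivAt_pow 2 (0 : ℂ)).mul_const q)
    simpa using! this
  exact (h3.congr_of_eventuallyEq (.of_forall fun t => (h t).symm)).unique h4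

/-- The second derivatives at `0` of the complexification of a function whose 2-jet is
`z*Az + conj(zᵀBz) + zᵀCz`. -/
theorem AnalyticAt.jet_of_isBigO_star {n : ℕ} {A B C : Matrix (Fin n) (Fin n) ℂ} (hB : B.IsSymm)
    {ρ : (Fin n → ℂ) × (Fin n → ℂ) → ℂ} (hρ : AnalyticAt ℂ ρ 0)
    (hE : (fun z : Fin n → ℂ =>
        ρ (z, star z) - (star z ⬝ᵥ A *ᵥ z + star (z ⬝ᵥ B *ᵥ z) + z ⬝ᵥ C *ᵥ z))
      =O[𝓝 0] fun z : Fin n → ℂ => ‖z‖ ^ 3) :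
    ρ 0 = 0 ∧ (∀ c, fderiv ℂ ρ 0 (0, c) = 0) ∧
      ∀ c u, fderiv ℂ (fun y => fderiv ℂ ρ y (0, c)) 0 u =
        c ⬝ᵥ A *ᵥ u.1 + 2 * (c ⬝ᵥ Bᴴ *ᵥ u.2) := by
  have hBH : ∀ x y : Fin n → ℂ, x ⬝ᵥ Bᴴ *ᵥ y = y ⬝ᵥ Bᴴ *ᵥ x := by
    intro x y
    rw [dotProduct_mulVec, dotProduct_comm, ← mulVec_transpose, hB.conjTranspose.eq]
  let Q : (Fin n → ℂ) × (Fin n → ℂ) → ℂ :=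
    fun p => p.2 ⬝ᵥ A *ᵥ p.1 + p.2 ⬝ᵥ Bᴴ *ᵥ p.2 + p.1 ⬝ᵥ C *ᵥ p.1
  have hQd : Differentiable ℂ Q := by
    simp only [Q, dotProduct, mulVec]
    fun_prop
  have hQ : ∀ x, AnalyticAt ℂ Q x := fun x =>
    hQd.differentiableOn.analyticOnNhd_of_finiteDimensional isOpen_univ x trivial
  have hR : AnalyticAt ℂ (fun p => ρ p - Q p) 0 := hρ.sub (hQ 0)
  obtain ⟨hR0, hR1, hR2⟩ := hR.two_jet_eq_zero_of_isBigO_star (by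
    refine hE.congr_left fun z => ?_
    simp only [Q]
    rw [dotProduct_mulVec (star z) Bᴴ, ← star_mulVec, star_dotProduct_star])
  have hQ1 : ∀ y c, fderiv ℂ Q y (0, c) = c ⬝ᵥ A *ᵥ y.1 + 2 * (c ⬝ᵥ Bᴴ *ᵥ y.2) := by
    intro y c
    refine fderiv_apply_of_quadratic (q := c ⬝ᵥ Bᴴ *ᵥ c) (hQ y).differentiableAt fun t => ?_
    simp only [Q, Prod.fst_add, Prod.snd_add, Prod.smul_fst, Prod.smul_snd, smul_zero, add_zero,
      mulVec_add, mulVec_smul, add_dotProduct, dotProduct_add, smul_dotProduct, dotProduct_smul,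
      smul_eq_mul, hBH y.2 c]
    ring
  have hsplit : ∀ᶠ y in 𝓝 0, fderiv ℂ ρ y = fderiv ℂ (fun p => ρ p - Q p) y + fderiv ℂ Q y := by
    filter_upwards [hρ.eventually_analyticAt] with y hy
    rw [fderiv_fun_sub hy.differentiableAt (hQ y).differentiableAt, sub_add_cancel]
  refine ⟨?_, fun c => ?_, fun c u => ?_⟩
  · simpa [Q] using hR0
  · rw [hsplit.self_of_nhds, hR1, zero_add, hQ1]
    simp
  · have h1 : (fun y => fderiv ℂ ρ y (0, c)) =ᶠ[𝓝 0] fun y =>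
        fderiv ℂ (fun p => ρ p - Q p) y (0, c) + (c ⬝ᵥ A *ᵥ y.1 + 2 * (c ⬝ᵥ Bᴴ *ᵥ y.2)) := by
      filter_upwards [hsplit] with y hy
      rw [hy, _root_.add_apply, hQ1]
    have h2 : Differentiable ℂ (fun y : (Fin n → ℂ) × (Fin n → ℂ) =>
        c ⬝ᵥ A *ᵥ y.1 + 2 * (c ⬝ᵥ Bᴴ *ᵥ y.2)) := by
      simp only [dotProduct, mulVec]
      fun_prop
    rw [h1.fderiv_eq, fderiv_fun_add (hR.fderiv_apply _).differentiableAt (h2 0),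
      _root_.add_apply, fderiv_fderiv_apply hR, hR2]
    have h3 := fderiv_apply_of_quadratic (y := 0) (c := u) (q := 0)
      (b := c ⬝ᵥ A *ᵥ u.1 + 2 * (c ⬝ᵥ Bᴴ *ᵥ u.2)) (h2 0) fun t => by
        simp [mulVec_smul]
        ring
    rw [h3]
    simp

open scoped ComplexOrder in
/-- If `rank (A*; B) ≥ 2` then two of the mixed Hessian rows of `ρ` at `0` are independent. -/
theorem exists_det_ne_zero_of_two_le_rank {n : ℕ} {A B : Matrix (Fin n) (Fin n) ℂ}
    (hrank : 2 ≤ (Matrix.fromRows Aᴴ B).rank) :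
    ∃ (a b : Fin n → ℂ) (u v : (Fin n → ℂ) × (Fin n → ℂ)),
      (a ⬝ᵥ A *ᵥ u.1 + 2 * (a ⬝ᵥ Bᴴ *ᵥ u.2)) * (b ⬝ᵥ A *ᵥ v.1 + 2 * (b ⬝ᵥ Bᴴ *ᵥ v.2)) -
      (a ⬝ᵥ A *ᵥ v.1 + 2 * (a ⬝ᵥ Bᴴ *ᵥ v.2)) * (b ⬝ᵥ A *ᵥ u.1 + 2 * (b ⬝ᵥ Bᴴ *ᵥ u.2)) ≠ 0 := by
  rw [← rank_conjTranspose, conjTranspose_fromRows_eq_fromCols_conjTranspose,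
    conjTranspose_conjTranspose] at hrank
  obtain ⟨k, l, i, j, h⟩ := Matrix.exists_minor_ne_zero_of_two_le_rank hrank
  let dir : Fin n ⊕ Fin n → (Fin n → ℂ) × (Fin n → ℂ) :=
    Sum.elim (fun i => (Pi.single i 1, 0)) (fun i => (0, Pi.single i (1 / 2)))
  have hdir : ∀ k i, (Pi.single k 1 : Fin n → ℂ) ⬝ᵥ A *ᵥ (dir i).1 +
      2 * ((Pi.single k 1 : Fin n → ℂ) ⬝ᵥ Bᴴ *ᵥ (dir i).2) = fromCols A Bᴴ k i := by
    rintro k (i | i)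
    · simp [dir]
    · simp [dir]
      ring
  exact ⟨Pi.single k 1, Pi.single l 1, dir i, dir j, by simpa only [hdir] using h⟩

open Metric in
/-- A function analytic near `0` is determined by its pullback under `(z, ξ) ↦ (z, ρ (z, ξ))` if
`∂_ξ ρ` does not vanish identically. -/
theorem AnalyticAt.eventually_eq_zero_of_comp_graph {Z X : Type*} [NormedAddCommGroup Z]
    [NormedSpace ℂ Z] [CompleteSpace Z] [NormedAddCommGroup X] [NormedSpace ℂ X] [CompleteSpace X]
    {H : Z × ℂ → ℂ} {ρ : Z × X → ℂ} {a : X} (hH : AnalyticAt ℂ H 0) (hρ : AnalyticAt ℂ ρ 0)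
    (hρ0 : ρ 0 = 0) (ha : ∃ᶠ p in 𝓝 0, fderiv ℂ ρ p (0, a) ≠ 0)
    (h : ∀ᶠ p in 𝓝 0, H (p.1, ρ p) = 0) : H =ᶠ[𝓝 0] 0 := by
  obtain ⟨ε, hε, hεH⟩ := Metric.mem_nhds_iff.1 hH.eventually_analyticAt
  have hΦ : Tendsto (fun p : Z × X => (p.1, ρ p)) (𝓝 0) (𝓝 0) := by
    have : ContinuousAt (fun p : Z × X => (p.1, ρ p)) 0 :=
      continuousAt_fst.prodMk hρ.continuousAt
    simpa [ContinuousAt, hρ0] using! this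
  obtain ⟨q, hqa, hq, hqρ, hqH⟩ := (ha.and_eventually ((hΦ.eventually (ball_mem_nhds 0 hε)).and
    (hρ.eventually_analyticAt.and (eventually_eventually_nhds.2 h)))).exists
  have hstrict : HasStrictFDerivAt (fun p : Z × X => (p.1, ρ p))
      ((ContinuousLinearMap.fst ℂ Z X).prod (fderiv ℂ ρ q)) q :=
    hasStrictFDerivAt_fst.prodMk hqρ.hasStrictFDerivAt
  have hsurj : ((ContinuousLinearMap.fst ℂ Z X).prod (fderiv ℂ ρ q)).range = ⊤ := by
    refine LinearMap.range_eq_top.2 ?_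
    rintro ⟨z, w⟩
    refine ⟨(z, ((w - fderiv ℂ ρ q (z, 0)) / fderiv ℂ ρ q (0, a)) • a), ?_⟩
    have h1 : ∀ t : ℂ, fderiv ℂ ρ q (z, t • a) = fderiv ℂ ρ q (z, 0) + t * fderiv ℂ ρ q (0, a) := by
      intro t
      rw [← smul_eq_mul, ← map_smul, ← map_add]
      simp
    simp [h1, hqa]
  have hzero : H =ᶠ[𝓝 (q.1, ρ q)] 0 := by
    rw [← hstrict.map_nhds_eq_of_surj hsurj]
    exact hqH
  have := AnalyticOnNhd.eqOn_zero_of_preconnected_of_eventuallyEq_zero (f := H) hεH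
    (convex_ball (0 : Z × ℂ) ε).isPreconnected hq hzero
  exact this.eventuallyEq_of_mem (ball_mem_nhds 0 hε)

theorem ContinuousLinearMap.apply_inr_eq_sum {n : ℕ}
    (L : (Fin n → ℂ) × (Fin n → ℂ) →L[ℂ] ℂ) (c : Fin n → ℂ) :
    L (0, c) = ∑ k, c k * L (0, Pi.single k 1) := by
  have := LinearMap.pi_apply_eq_sum_univ (L.comp (.inr ℂ (Fin n → ℂ) (Fin n → ℂ))).toLinearMap c
  simpa [← Pi.single_apply, Pi.single_comm] using this

/-- The polarized form of the tangential Cauchy–Riemann equations. -/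
theorem AnalyticAt.eventually_forall_cr_of_star {n : ℕ}
    {ρ f : (Fin n → ℂ) × (Fin n → ℂ) → ℂ} (hρ : AnalyticAt ℂ ρ 0) (hf : AnalyticAt ℂ f 0)
    (hCR : ∀ᶠ z : Fin n → ℂ in 𝓝 0, ∀ k ℓ : Fin n,
      fderiv ℂ ρ (z, star z) (0, Pi.single ℓ 1) *
          fderiv ℂ f (z, star z) (0, Pi.single k 1) -
        fderiv ℂ ρ (z, star z) (0, Pi.single k 1) *
          fderiv ℂ f (z, star z) (0, Pi.single ℓ 1) = 0) :
    ∀ᶠ p in 𝓝 0, ∀ c d : Fin n → ℂ,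
      fderiv ℂ ρ p (0, c) * fderiv ℂ f p (0, d) = fderiv ℂ ρ p (0, d) * fderiv ℂ f p (0, c) := by
  have h1 : ∀ᶠ p in 𝓝 0, ∀ k ℓ : Fin n,
      fderiv ℂ ρ p (0, Pi.single ℓ 1) * fderiv ℂ f p (0, Pi.single k 1) -
        fderiv ℂ ρ p (0, Pi.single k 1) * fderiv ℂ f p (0, Pi.single ℓ 1) = 0 := by
    refine eventually_all.2 fun k => eventually_all.2 fun ℓ => ?_
    refine AnalyticAt.eventually_eq_zero_of_star
      (g := fun p => fderiv ℂ ρ p (0, Pi.single ℓ 1) * fderiv ℂ f p (0, Pi.single k 1) -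
        fderiv ℂ ρ p (0, Pi.single k 1) * fderiv ℂ f p (0, Pi.single ℓ 1))
      (((hρ.fderiv_apply _).mul (hf.fderiv_apply _)).sub
        ((hρ.fderiv_apply _).mul (hf.fderiv_apply _))) ?_
    filter_upwards [hCR] with z hz using hz k ℓ
  filter_upwards [h1] with p hp c d
  rw [(fderiv ℂ ρ p).apply_inr_eq_sum c, (fderiv ℂ f p).apply_inr_eq_sum d,
    (fderiv ℂ ρ p).apply_inr_eq_sum d, (fderiv ℂ f p).apply_inr_eq_sum c,
    Finset.sum_mul_sum, Finset.sum_mul_sum, Finset.sum_comm]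
  refine Finset.sum_congr rfl fun k _ => Finset.sum_congr rfl fun ℓ _ => ?_
  linear_combination c ℓ * d k * hp k ℓ

/-- **Theorem 1.1 (main extension theorem).**
A real-analytic function `f(z,z̄)` is encoded by its holomorphic complexification
`f : ℂⁿ × ℂⁿ → ℂ` (analytic near `0`), evaluated at `(z, z̄)`; likewise for `ρ`.
Wirtinger derivatives `∂/∂z̄ₖ` are the complex partial derivatives of the
complexification in the second group of variables. -/
theorem stmt_0 (n : ℕ) (hn : 2 ≤ n)
    (A B C : Matrix (Fin n) (Fin n) ℂ) (hB : B.IsSymm) (hC : C.IsSymm)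
    (hrank : 2 ≤ (Matrix.fromRows Aᴴ B).rank)
    (ρ : (Fin n → ℂ) × (Fin n → ℂ) → ℂ)
    (hρ : AnalyticAt ℂ ρ 0)
    -- `ρ(z,z̄) = z*Az + conj(zᵀBz) + zᵀCz + E(z,z̄)` with `E = O(|z|³)`
    (hE : (fun z : Fin n → ℂ =>
        ρ (z, star z) -
          (star z ⬝ᵥ A *ᵥ z + star (z ⬝ᵥ B *ᵥ z) + z ⬝ᵥ C *ᵥ z))
      =O[𝓝 0] fun z : Fin n → ℂ => ‖z‖ ^ 3)
    (f : (Fin n → ℂ) × (Fin n → ℂ) → ℂ)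
    (hf : AnalyticAt ℂ f 0)
    -- the CR condition `ρ_{z̄_ℓ} ∂f/∂z̄_k − ρ_{z̄_k} ∂f/∂z̄_ℓ = 0` near `0`
    (hCR : ∀ᶠ z : Fin n → ℂ in 𝓝 0, ∀ k ℓ : Fin n,
      fderiv ℂ ρ (z, star z) (0, Pi.single ℓ 1) *
          fderiv ℂ f (z, star z) (0, Pi.single k 1) -
        fderiv ℂ ρ (z, star z) (0, Pi.single k 1) *
          fderiv ℂ f (z, star z) (0, Pi.single ℓ 1) = 0) :
    ∃ F : (Fin n → ℂ) × ℂ → ℂ,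
      AnalyticAt ℂ F 0 ∧
      (∀ᶠ z : Fin n → ℂ in 𝓝 0, f (z, star z) = F (z, ρ (z, star z))) ∧
      ∀ G : (Fin n → ℂ) × ℂ → ℂ, AnalyticAt ℂ G 0 →
        (∀ᶠ z : Fin n → ℂ in 𝓝 0, f (z, star z) = G (z, ρ (z, star z))) →
        F =ᶠ[𝓝 0] G := by
  obtain ⟨hρ0, hρ1, hρ2⟩ := hρ.jet_of_isBigO_star hB hE
  obtain ⟨a, b, u, v, hdet⟩ := exists_det_ne_zero_of_two_le_rank hrank
  simp only [← hρ2] at hdet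
  have hda : fderiv ℂ (fun y => fderiv ℂ ρ y (0, a)) 0 ≠ 0 := by
    intro h
    rw [h] at hdet
    simp at hdet
  have hcr := hρ.eventually_forall_cr_of_star hf hCR
  have hdet' := (((((hρ.fderiv_apply (0, a)).fderiv_apply u).mul
    ((hρ.fderiv_apply (0, b)).fderiv_apply v)).sub (((hρ.fderiv_apply (0, a)).fderiv_apply v).mul
      ((hρ.fderiv_apply (0, b)).fderiv_apply u))).continuousAt).eventually_ne hdet
  obtain ⟨U, hU, hUo, hU0⟩ := eventually_nhds_iff.1 ((hρ.eventually_analyticAt.and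
    hf.eventually_analyticAt).and (hdet'.and hcr))
  obtain ⟨F, hF0, hF, hder⟩ := exists_analytic_quotient_seq (ρ := ρ) (f := f)
    (S := Set.range fun c : Fin n → ℂ => (0, c)) hUo
    (fun x hx => (hU x hx).1.1) (fun x hx => (hU x hx).1.2) ⟨a, rfl⟩ ⟨b, rfl⟩
    (fun x hx => (hU x hx).2.1) (by
      rintro x hx _ ⟨c, rfl⟩ _ ⟨d, rfl⟩
      exact (hU x hx).2.2 c d)
  have hUn : U ∈ 𝓝 0 := hUo.mem_nhds hU0
  obtain ⟨M, K, r, hM, hK, hr, hle⟩ := exists_norm_le_of_fderiv_eq_mul hUn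
    (hρ.fderiv_apply (0, a)) (hρ1 a) hda hF fun j x hx => hder j x hx _ ⟨a, rfl⟩
  obtain ⟨G, hG, hfG⟩ := exists_analyticAt_comp_of_fderiv_eq_mul hUn hρ hρ0 hF
    (fun j x hx c => hder j x hx _ ⟨c, rfl⟩) hM hK hr hle
  have hι : Tendsto (fun z : Fin n → ℂ => (z, star z)) (𝓝 0) (𝓝 0) := by
    have : Continuous (fun z : Fin n → ℂ => (z, star z)) := by fun_prop
    simpa using! this.tendsto 0
  refine ⟨G, hG, ?_, fun G' hG' hfG' => ?_⟩
  · filter_upwards [hι.eventually hfG] with z hz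
    rw [← hz, hF0]
  have hΦ : AnalyticAt ℂ (fun p : (Fin n → ℂ) × (Fin n → ℂ) => (p.1, ρ p)) 0 :=
    analyticAt_fst.prod hρ
  have hcomp : AnalyticAt ℂ (fun p : (Fin n → ℂ) × (Fin n → ℂ) => G' (p.1, ρ p)) 0 :=
    AnalyticAt.fun_comp (g := G') (by simpa [hρ0] using! hG') hΦ
  have hpol : ∀ᶠ p in 𝓝 0, f p - G' (p.1, ρ p) = 0 := by
    refine AnalyticAt.eventually_eq_zero_of_star (g := fun p => f p - G' (p.1, ρ p))
      (hf.sub hcomp) ?_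
    filter_upwards [hfG'] with z hz using sub_eq_zero.2 hz
  have hsub : G - G' =ᶠ[𝓝 0] 0 := by
    refine (hG.sub hG').eventually_eq_zero_of_comp_graph hρ hρ0
      (frequently_ne_zero_of_fderiv (h := fun y => fderiv ℂ ρ y (0, a)) fun _ => hda) ?_
    filter_upwards [hfG, hpol] with p h1 h2
    rw [Pi.sub_apply, ← h1, hF0, h2]
  filter_upwards [hsub] with x hx using sub_eq_zero.1 hx
end

section
/- Let n ≥ 2, let A, B, C be complex n×n matrices with B and C symmetric, and let M ⊂ ℂ^{n+1} be the quadric given by w = Q(z,z̄) = z*Az + conj(zᵀBz) + zᵀCz. Then the (2n)×n matrix obtained by stacking A* (the conjugate transpose of A) on top of B has rank exactly 1 if and only if M is locally biholomorphically equivalent at the origin to one of the following quadrics: (1) w = z̄₁z₂ + z̄₁², (2) w = z̄₁z₂, (3) w = |z₁|² + a z̄₁² for some real a ≥ 0, (4) w = z̄₁². That is, there exist neighborhoods U, V of 0 in ℂ^{n+1} and a biholomorphism φ : U → V with φ(0) = 0 and φ(M ∩ U) = M' ∩ V, where M' is one of the listed quadrics. -/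
open Matrix Filter Topology

/-- Two germs at `0` of subsets of `ℂⁿ × ℂ` are *locally biholomorphically
equivalent* if a biholomorphism `φ` between neighborhoods `U`, `V` of `0`, with
`φ 0 = 0`, maps one onto the other. -/
def LocBiholEquivAt (n : ℕ) (M M' : Set ((Fin n → ℂ) × ℂ)) : Prop :=
  ∃ (U V : Set ((Fin n → ℂ) × ℂ)) (φ ψ : (Fin n → ℂ) × ℂ → (Fin n → ℂ) × ℂ),
    IsOpen U ∧ IsOpen V ∧ (0 : (Fin n → ℂ) × ℂ) ∈ U ∧ (0 : (Fin n → ℂ) × ℂ) ∈ V ∧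
    AnalyticOnNhd ℂ φ U ∧ AnalyticOnNhd ℂ ψ V ∧
    Set.MapsTo φ U V ∧ Set.MapsTo ψ V U ∧
    Set.LeftInvOn ψ φ U ∧ Set.RightInvOn ψ φ V ∧
    φ 0 = 0 ∧ φ '' (M ∩ U) = M' ∩ V

section Germ

variable {E : Type*} [NormedAddCommGroup E] [NormedSpace ℂ E]

theorem tendsto_snd_div_sq_of_mapsTo_graph {Q Q' : E → ℂ} (hQ' : Continuous Q')
    (hQ'h : ∀ (t : ℝ) z, Q' ((t : ℂ) • z) = (t : ℂ) ^ 2 * Q' z)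
    {φ : E × ℂ → E × ℂ} {Φ : E × ℂ →L[ℂ] E × ℂ} (hφ : HasFDerivAt φ Φ 0) (hφ0 : φ 0 = 0)
    (hM : ∀ᶠ p in 𝓝 (0 : E × ℂ), p.2 = Q p.1 → (φ p).2 = Q' (φ p).1)
    (hQh : ∀ (t : ℝ) z, Q ((t : ℂ) • z) = (t : ℂ) ^ 2 * Q z) (z : E) :
    Tendsto (fun t : ℝ => ((t : ℂ) ^ 2)⁻¹ * (φ ((t : ℂ) • z, (t : ℂ) ^ 2 * Q z)).2) (𝓝[≠] 0)
      (𝓝 (Q' (Φ (z, 0)).1)) ∧ (Φ (z, 0)).2 = 0 := by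
  set p : ℝ → E × ℂ := fun t => ((t : ℂ) • z, (t : ℂ) ^ 2 * Q z) with hp
  have hof : HasDerivAt (fun t : ℝ => (t : ℂ)) 1 0 := by
    simpa using (hasDerivAt_id (0 : ℝ)).ofReal_comp
  have hp0 : p 0 = 0 := by simp [hp]
  have hpd : HasDerivAt p (z, 0) 0 := by
    refine HasDerivAt.prodMk ?_ ?_
    · simpa using hof.smul_const z
    · simpa using (hof.pow 2).mul_const (Q z)
  have hφp : HasDerivAt (φ ∘ p) (Φ (z, 0)) 0 := by
    have h := HasFDerivAt.restrictScalars ℝ (hp0 ▸ hφ : HasFDerivAt φ Φ (p 0))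
    exact h.comp_hasDerivAt 0 hpd
  have hslope : Tendsto (fun t : ℝ => t⁻¹ • φ (p t)) (𝓝[≠] 0) (𝓝 (Φ (z, 0))) := by
    simpa [hp0, hφ0] using hφp.tendsto_slope_zero
  have hcont : Tendsto p (𝓝[≠] 0) (𝓝 0) := by
    have := hpd.continuousAt.tendsto
    rw [hp0] at this
    exact this.mono_left nhdsWithin_le_nhds
  have hev : ∀ᶠ t : ℝ in 𝓝[≠] 0, ((t : ℂ) ^ 2)⁻¹ * (φ (p t)).2 = Q' (t⁻¹ • φ (p t)).1 := by
    filter_upwards [hcont.eventually hM, self_mem_nhdsWithin] with t ht ht0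
    have e : (t⁻¹ • φ (p t)).1 = ((t⁻¹ : ℝ) : ℂ) • (φ (p t)).1 := by
      rw [Prod.smul_fst]; exact (Complex.coe_smul _ _).symm
    rw [ht (hQh t z).symm, e, hQ'h]
    push_cast
    rw [inv_pow]
  have hlim : Tendsto (fun t : ℝ => ((t : ℂ) ^ 2)⁻¹ * (φ (p t)).2) (𝓝[≠] 0)
      (𝓝 (Q' (Φ (z, 0)).1)) :=
    ((hQ'.tendsto _).comp ((continuous_fst.tendsto _).comp hslope)).congr'
      (hev.mono fun t ht => ht.symm)
  refine ⟨hlim, ?_⟩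
  have h1 : Tendsto (fun t : ℝ => (t : ℂ) * (((t : ℂ) ^ 2)⁻¹ * (φ (p t)).2)) (𝓝[≠] 0)
      (𝓝 (0 * Q' (Φ (z, 0)).1)) := by
    refine Tendsto.mul ?_ hlim
    simpa using hof.continuousAt.tendsto.mono_left nhdsWithin_le_nhds
  have h2 : Tendsto (fun t : ℝ => (t⁻¹ • φ (p t)).2) (𝓝[≠] 0) (𝓝 (Φ (z, 0)).2) :=
    (continuous_snd.tendsto _).comp hslope
  rw [zero_mul] at h1
  refine tendsto_nhds_unique h2 (h1.congr' ?_)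
  filter_upwards [self_mem_nhdsWithin] with t ht
  have ht' : (t : ℂ) ≠ 0 := by exact_mod_cast ht
  rw [Prod.smul_snd, Complex.real_smul]
  push_cast
  field_simp

theorem exists_analytic_quadratic_part {Q Q' : E → ℂ} (hQ' : Continuous Q')
    (hQ'h : ∀ (t : ℝ) z, Q' ((t : ℂ) • z) = (t : ℂ) ^ 2 * Q' z)
    (hQh : ∀ (t : ℝ) z, Q ((t : ℂ) • z) = (t : ℂ) ^ 2 * Q z)
    {φ : E × ℂ → E × ℂ} (hφ : AnalyticAt ℂ φ 0) (hφ0 : φ 0 = 0)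
    (hM : ∀ᶠ p in 𝓝 (0 : E × ℂ), p.2 = Q p.1 → (φ p).2 = Q' (φ p).1) (z : E) :
    ∃ h : ℂ, ∀ c : ℂ, (fderiv ℂ φ 0 (0, 1)).2 * Q (c • z) + c ^ 2 * h =
      Q' (fderiv ℂ φ 0 (c • z, 0)).1 := by
  set Φ := fderiv ℂ φ 0
  have hstrict : HasStrictFDerivAt φ Φ 0 := hφ.hasStrictFDerivAt
  have key := tendsto_snd_div_sq_of_mapsTo_graph hQ' hQ'h hstrict.hasFDerivAt hφ0 hM hQh
  set ι : ℂ → E × ℂ := fun t => (t • z, 0) with hι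
  have hι0 : ι 0 = 0 := by simp [hι]
  have hιd : HasDerivAt ι (z, 0) 0 :=
    HasDerivAt.prodMk (by simpa using (hasDerivAt_id (0 : ℂ)).smul_const z) (hasDerivAt_const _ _)
  have hιa : AnalyticAt ℂ ι 0 := by
    refine AnalyticAt.prod ?_ analyticAt_const
    exact analyticAt_id.smul analyticAt_const
  set H : ℂ → ℂ := fun t => (φ (ι t)).2 with hH
  have hφι : AnalyticAt ℂ φ (ι 0) := by rw [hι0]; exact hφ
  have hHa : AnalyticAt ℂ H 0 := analyticAt_snd.comp (hφι.comp hιa)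
  have hHd : HasDerivAt H 0 0 := by
    have h1 : HasDerivAt (φ ∘ ι) (Φ (z, 0)) 0 :=
      (hι0 ▸ hstrict.hasFDerivAt : HasFDerivAt φ Φ (ι 0)).comp_hasDerivAt 0 hιd
    have h2 := (hasFDerivAt_snd (𝕜 := ℂ) (p := (φ ∘ ι) 0)).comp_hasDerivAt 0 h1
    have h3 : (ContinuousLinearMap.snd ℂ E ℂ) (Φ (z, 0)) = 0 := (key z).2
    rwa [h3] at h2
  have hord : ((2 : ℕ) : ℕ∞) ≤ analyticOrderAt H 0 := by
    rw [natCast_le_analyticOrderAt_iff_iteratedDeriv_eq_zero hHa]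
    intro i hi
    interval_cases i
    · simp [hH, hι0, hφ0]
    · simpa using hHd.deriv
  obtain ⟨K, hKa, hK⟩ := (natCast_le_analyticOrderAt hHa).1 hord
  refine ⟨K 0, fun c => ?_⟩
  have hof : Tendsto (fun t : ℝ => (t : ℂ)) (𝓝[≠] 0) (𝓝 0) := by
    have : Tendsto (fun t : ℝ => (t : ℂ)) (𝓝 0) (𝓝 ((0 : ℝ) : ℂ)) :=
      Complex.continuous_ofReal.tendsto _
    simpa using this.mono_left nhdsWithin_le_nhds
  have hmulc : Tendsto (fun t : ℝ => (t : ℂ) * c) (𝓝[≠] 0) (𝓝 0) := by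
    simpa using hof.mul_const c
  -- the holomorphic term
  have hA : Tendsto (fun t : ℝ => ((t : ℂ) ^ 2)⁻¹ * H (t * c)) (𝓝[≠] 0) (𝓝 (c ^ 2 * K 0)) := by
    have h1 : Tendsto (fun t : ℝ => c ^ 2 * K (t * c)) (𝓝[≠] 0) (𝓝 (c ^ 2 * K 0)) :=
      (hKa.continuousAt.tendsto.comp hmulc).const_mul _
    refine h1.congr' ?_
    filter_upwards [hmulc.eventually hK, self_mem_nhdsWithin] with t ht ht0
    have ht' : (t : ℂ) ≠ 0 := by exact_mod_cast ht0
    rw [ht]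
    simp only [sub_zero, smul_eq_mul]
    field_simp
  set q := Q (c • z)
  set p : ℝ → E × ℂ := fun t => ((t : ℂ) • c • z, (t : ℂ) ^ 2 * q) with hp
  have hp0 : Tendsto p (𝓝[≠] 0) (𝓝 0) := by
    have h : Tendsto p (𝓝[≠] 0) (𝓝 ((0 : ℂ) • c • z, (0 : ℂ) ^ 2 * q)) :=
      (hof.smul_const _).prodMk_nhds ((hof.pow 2).mul_const _)
    rwa [zero_smul, zero_pow two_ne_zero, zero_mul, Prod.mk_zero_zero] at h
  have hι0' : Tendsto (fun t : ℝ => ι (t * c)) (𝓝[≠] 0) (𝓝 0) := by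
    have h := hιa.continuousAt.tendsto.comp hmulc
    rwa [hι0] at h
  -- the transversal term
  have hB : Tendsto (fun t : ℝ => ((t : ℂ) ^ 2)⁻¹ * ((φ (p t)).2 - H (t * c))) (𝓝[≠] 0)
      (𝓝 ((Φ (0, 1)).2 * q)) := by
    have h1 := hstrict.isLittleO.comp_tendsto (hp0.prodMk_nhds hι0')
    have hdiff : ∀ t : ℝ, p t - ι (t * c) = ((t : ℂ) ^ 2 * q) • ((0, 1) : E × ℂ) := by
      intro t
      simp [hp, hι, mul_smul]
    have h2 : (fun t : ℝ => (φ (p t)).2 - H (t * c) - (t : ℂ) ^ 2 * ((Φ (0, 1)).2 * q))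
        =o[𝓝[≠] 0] fun t : ℝ => (t : ℂ) ^ 2 := by
      have h3 : (fun t : ℝ => (φ (p t)).2 - H (t * c) - (t : ℂ) ^ 2 * ((Φ (0, 1)).2 * q))
          =O[𝓝[≠] 0] fun t : ℝ => φ (p t) - φ (ι (t * c)) - Φ (p t - ι (t * c)) := by
        refine Asymptotics.IsBigO.of_bound 1 (Eventually.of_forall fun t => ?_)
        rw [one_mul]
        refine le_trans (le_of_eq ?_) (norm_snd_le _)
        rw [hdiff, map_smul]
        simp only [hH, Prod.snd_sub, Prod.smul_snd, smul_eq_mul]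
        ring_nf
      refine h3.trans_isLittleO (h1.trans_isBigO ?_)
      refine Asymptotics.IsBigO.of_bound (‖q‖ * ‖((0, 1) : E × ℂ)‖)
        (Eventually.of_forall fun t => ?_)
      simp only [Function.comp_apply, hdiff, norm_smul, norm_mul]
      apply le_of_eq; ring
    have h4 := h2.tendsto_div_nhds_zero.add_const ((Φ (0, 1)).2 * q)
    rw [zero_add] at h4
    refine h4.congr' ?_
    filter_upwards [self_mem_nhdsWithin] with t ht0
    have ht' : (t : ℂ) ≠ 0 := by exact_mod_cast ht0
    field_simp
    ring
  refine tendsto_nhds_unique ((hB.add hA).congr fun t => ?_) (key (c • z)).1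
  ring

end Germ

theorem LocBiholEquivAt.exists_linearEquiv_quadratic {n : ℕ} {Q Q' : (Fin n → ℂ) → ℂ}
    (hQ' : Continuous Q')
    (hQ'h : ∀ (t : ℝ) z, Q' ((t : ℂ) • z) = (t : ℂ) ^ 2 * Q' z)
    (hQh : ∀ (t : ℝ) z, Q ((t : ℂ) • z) = (t : ℂ) ^ 2 * Q z)
    (h : LocBiholEquivAt n {p | p.2 = Q p.1} {p | p.2 = Q' p.1}) :
    ∃ (L : (Fin n → ℂ) ≃ₗ[ℂ] (Fin n → ℂ)) (l : ℂ), l ≠ 0 ∧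
      ∀ z, ∃ h : ℂ, ∀ c : ℂ, l * Q (c • z) + c ^ 2 * h = Q' (c • L z) := by
  obtain ⟨U, V, φ, ψ, hU, hV, hU0, hV0, hφ, hψ, -, -, hl, -, hφ0, hMM'⟩ := h
  have hM : ∀ᶠ p in 𝓝 (0 : (Fin n → ℂ) × ℂ), p.2 = Q p.1 → (φ p).2 = Q' (φ p).1 := by
    filter_upwards [hU.mem_nhds hU0] with p hp hpQ
    have : φ p ∈ φ '' ({p | p.2 = Q p.1} ∩ U) := ⟨p, ⟨hpQ, hp⟩, rfl⟩
    rw [hMM'] at this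
    exact this.1
  have hφa := hφ 0 hU0
  have hψa : AnalyticAt ℂ ψ (φ 0) := by rw [hφ0]; exact hψ 0 hV0
  set Φ := fderiv ℂ φ 0 with hΦ
  have hφd : HasStrictFDerivAt φ Φ 0 := hφa.hasStrictFDerivAt
  have hQuad := exists_analytic_quadratic_part hQ' hQ'h hQh hφa hφ0 hM
  have hz : ∀ z, (Φ (z, 0)).2 = 0 := fun z =>
    (tendsto_snd_div_sq_of_mapsTo_graph hQ' hQ'h hφd.hasFDerivAt hφ0 hM hQh z).2
  have hleft : ∀ x, fderiv ℂ ψ (φ 0) (Φ x) = x := by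
    have h1 : HasFDerivAt (ψ ∘ φ) (fderiv ℂ ψ (φ 0) ∘L Φ) 0 :=
      hψa.hasStrictFDerivAt.hasFDerivAt.comp 0 hφd.hasFDerivAt
    have h2 : HasFDerivAt (ψ ∘ φ) (ContinuousLinearMap.id ℂ _) 0 :=
      (hasFDerivAt_id _).congr_of_eventuallyEq
        (Filter.eventuallyEq_of_mem (hU.mem_nhds hU0) hl)
    exact fun x => DFunLike.congr_fun (h1.unique h2) x
  have hinj : Function.Injective Φ := fun x y hxy => by rw [← hleft x, hxy, hleft]
  have hsurj : Function.Surjective Φ :=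
    LinearMap.injective_iff_surjective (f := (Φ : ((Fin n → ℂ) × ℂ) →ₗ[ℂ] _)).1 hinj
  let L₀ : (Fin n → ℂ) →ₗ[ℂ] (Fin n → ℂ) :=
    LinearMap.fst ℂ (Fin n → ℂ) ℂ ∘ₗ (Φ : ((Fin n → ℂ) × ℂ) →ₗ[ℂ] ((Fin n → ℂ) × ℂ)) ∘ₗ
      LinearMap.inl ℂ (Fin n → ℂ) ℂ
  have hL₀ : Function.Injective L₀ := by
    rw [injective_iff_map_eq_zero]
    intro z hz0
    have h1 : Φ (z, 0) = Φ 0 := by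
      rw [map_zero]; exact Prod.ext hz0 (hz z)
    exact congrArg Prod.fst (hinj h1)
  refine ⟨LinearEquiv.ofInjectiveEndo L₀ hL₀, (Φ (0, 1)).2, ?_, fun z => ?_⟩
  · intro h0
    obtain ⟨⟨z, w⟩, hzw⟩ := hsurj (0, 1)
    have h1 : ((z, w) : (Fin n → ℂ) × ℂ) = (z, 0) + w • (0, 1) := by simp
    rw [h1, map_add, map_smul] at hzw
    have h2 := congrArg Prod.snd hzw
    simp [hz, h0] at h2
  · obtain ⟨h, hh⟩ := hQuad z
    refine ⟨h, fun c => ?_⟩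
    rw [hh c, ← map_smul]
    rfl

/-- The Hermitian, antiholomorphic and holomorphic parts of a quadratic form are determined by
its values on complex lines. -/
theorem eq_and_eq_of_forall_quadratic {l a b a' b' h : ℂ}
    (H : ∀ c : ℂ, l * (star c * c * a + star c ^ 2 * b) + c ^ 2 * h =
      star c * c * a' + star c ^ 2 * b') : l * a = a' ∧ l * b = b' := by
  have h1 := H 1
  have h2 := H Complex.I
  have h3 := H (1 + Complex.I)
  have hI := Complex.I_mul_I
  simp only [star_one, star_add, Complex.star_def, Complex.conj_I] at h1 h2 h3
  have ha : l * a = a' := by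
    linear_combination (h1 + h2) / 2 + (l * a - l * b - h - a' + b') * hI / 2
  have hs : l * b + h = b' := by linear_combination h1 - ha
  have hd : -l * b + h = -b' := by
    linear_combination (-Complex.I / 2) * h3 + Complex.I * ha + (-l * b + h + b') * hI
      - (Complex.I / 2) * (l * a - l * b - h - a' + b') * hI
  refine ⟨ha, ?_⟩
  linear_combination (hs - hd) / 2

section Polarization

variable {n : ℕ}

theorem Matrix.eq_zero_of_forall_star_dotProduct_mulVec {M : Matrix (Fin n) (Fin n) ℂ}
    (h : ∀ z, star z ⬝ᵥ M *ᵥ z = 0) : M = 0 := by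
  have hxy : ∀ x y, star x ⬝ᵥ M *ᵥ y = 0 := by
    intro x y
    have h1 := h (x + y)
    have h2 := h (x + Complex.I • y)
    simp only [star_add, star_smul, mulVec_add, mulVec_smul, add_dotProduct, dotProduct_add,
      smul_dotProduct, dotProduct_smul, smul_eq_mul, h x, h y, Complex.star_def,
      Complex.conj_I] at h1 h2
    linear_combination h1 / 2 - Complex.I / 2 * h2 +
      (star x ⬝ᵥ M *ᵥ y - star y ⬝ᵥ M *ᵥ x) / 2 * Complex.I_mul_I
  ext i j
  simpa using hxy (Pi.single i 1) (Pi.single j 1)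

theorem Matrix.IsSymm.eq_zero_of_forall_dotProduct_mulVec {M : Matrix (Fin n) (Fin n) ℂ}
    (hM : M.IsSymm) (h : ∀ z, z ⬝ᵥ M *ᵥ z = 0) : M = 0 := by
  have hxy : ∀ x y, x ⬝ᵥ M *ᵥ y = 0 := by
    intro x y
    have h1 := h (x + y)
    have h2 : y ⬝ᵥ M *ᵥ x = x ⬝ᵥ M *ᵥ y := by
      rw [dotProduct_mulVec, ← mulVec_transpose, hM.eq, dotProduct_comm]
    simp only [mulVec_add, add_dotProduct, dotProduct_add, h x, h y, h2] at h1
    linear_combination h1 / 2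
  ext i j
  simpa using hxy (Pi.single i 1) (Pi.single j 1)

theorem star_dotProduct_vecMulVec_mulVec (v m z : Fin n → ℂ) :
    star z ⬝ᵥ vecMulVec (star v) m *ᵥ z = star (v ⬝ᵥ z) * (m ⬝ᵥ z) := by
  rw [vecMulVec_mulVec, dotProduct_smul, star_dotProduct_star, dotProduct_comm v z]
  simp

theorem dotProduct_smul_vecMulVec_mulVec (v z : Fin n → ℂ) (b : ℂ) :
    z ⬝ᵥ (b • vecMulVec v v) *ᵥ z = b * (v ⬝ᵥ z) ^ 2 := by
  rw [smul_mulVec, vecMulVec_mulVec, dotProduct_smul, dotProduct_smul, dotProduct_comm z v]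
  simp [pow_two]

end Polarization

theorem Matrix.exists_eq_vecMulVec_of_rank_eq_one {ι κ : Type*} [Fintype κ] [Finite ι]
    [DecidableEq κ]
    {M : Matrix ι κ ℂ} (h : M.rank = 1) : ∃ u v, M = vecMulVec u v := by
  obtain ⟨⟨u, hu⟩, -, hspan⟩ := finrank_eq_one_iff'.1 h
  choose v hv using fun j => hspan ⟨M.mulVecLin (Pi.single j 1), LinearMap.mem_range_self _ _⟩
  refine ⟨u, v, ?_⟩
  ext i j
  have := congrFun (congrArg Subtype.val (hv j)) i
  simp at this
  rw [vecMulVec_apply, mul_comm, this]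

theorem rank_fromRows_conjTranspose_eq_one_iff {n : ℕ} {A B : Matrix (Fin n) (Fin n) ℂ}
    (hB : B.IsSymm) : (fromRows Aᴴ B).rank = 1 ↔
      ∃ (v m : Fin n → ℂ) (b : ℂ), v ≠ 0 ∧ (m ≠ 0 ∨ b ≠ 0) ∧
        A = vecMulVec (star v) m ∧ B = star b • vecMulVec v v := by
  constructor
  · intro h
    obtain ⟨u, v, huv⟩ := exists_eq_vecMulVec_of_rank_eq_one h
    have hne : fromRows Aᴴ B ≠ 0 := by
      intro h0
      rw [h0, rank_zero] at h
      exact zero_ne_one h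
    have hv : v ≠ 0 := by
      rintro rfl
      exact hne (huv.trans (by ext; simp [vecMulVec_apply]))
    obtain ⟨k, hk⟩ := Function.ne_iff.1 hv
    have hA : A = vecMulVec (star v) (star fun i => u (Sum.inl i)) := by
      rw [← conjTranspose_vecMulVec, ← conjTranspose_conjTranspose A]
      congr 1
      ext i j
      exact congrFun (congrFun huv (Sum.inl i)) j
    have hBu : ∀ i j, B i j = u (Sum.inr i) * v j := fun i j =>
      congrFun (congrFun huv (Sum.inr i)) j
    have hB' : B = (u (Sum.inr k) / v k) • vecMulVec v v := by
      ext i j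
      have h1 : u (Sum.inr i) * v k = u (Sum.inr k) * v i := by
        rw [← hBu, ← hBu, hB.apply]
      simp only [Matrix.smul_apply, vecMulVec_apply, smul_eq_mul, hBu]
      have hk' : v k ≠ 0 := hk
      field_simp
      linear_combination v j * h1
    refine ⟨v, _, star (u (Sum.inr k) / v k), hv, ?_, hA, by rwa [star_star]⟩
    by_contra! hcon
    obtain ⟨h1, h2⟩ := hcon
    apply hne
    rw [h1, vecMulVec_zero] at hA
    rw [star_eq_zero.1 h2, zero_smul] at hB'
    rw [hA, hB', conjTranspose_zero, fromRows_zero]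
  · rintro ⟨v, m, b, hv, hmb, rfl, rfl⟩
    have heq : fromRows (vecMulVec (star v) m)ᴴ (star b • vecMulVec v v) =
        vecMulVec (Sum.elim (star m) (star b • v)) v := by
      ext (i | i) j
      · simp [vecMulVec_apply, mul_comm]
      · simp [vecMulVec_apply, mul_assoc]
    rw [heq]
    refine le_antisymm (rank_vecMulVec_le _ _) (Nat.one_le_iff_ne_zero.2 fun h0 => ?_)
    rw [Matrix.rank, Submodule.finrank_eq_zero, LinearMap.range_eq_bot, ← toLin'_apply',
      LinearEquiv.map_eq_zero_iff] at h0
    obtain ⟨k, hk⟩ := Function.ne_iff.1 hv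
    have hk' : v k ≠ 0 := hk
    have h1 : ∀ i, (Sum.elim (star m) (star b • v) : Fin n ⊕ Fin n → ℂ) i * v k = 0 := fun i =>
      congrFun (congrFun h0 i) k
    have hm : m = 0 := by
      ext i
      simpa [hk'] using h1 (Sum.inl i)
    have hb : b = 0 := by
      simpa [hk'] using h1 (Sum.inr k)
    exact hmb.elim (· hm) (· hb)

theorem exists_linearEquiv_apply_eq_dotProduct {n : ℕ} {κ : Type*} [Finite κ] {i : κ → Fin n}
    (hi : Function.Injective i) {r : κ → Fin n → ℂ} (hr : LinearIndependent ℂ r) :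
    ∃ T : (Fin n → ℂ) ≃ₗ[ℂ] (Fin n → ℂ), ∀ k z, T z (i k) = r k ⬝ᵥ z := by
  have he : LinearIndependent ℂ fun k => (Pi.single (i k) 1 : Fin n → ℂ) := by
    simpa [Function.comp_def] using (Pi.basisFun ℂ (Fin n)).linearIndependent.comp i hi
  have : FiniteDimensional ℂ
      (Submodule.span ℂ (Set.range fun k => (Pi.single (i k) 1 : Fin n → ℂ))) :=
    FiniteDimensional.span_of_finite ℂ (Set.finite_range _)
  obtain ⟨G, hG⟩ := Submodule.exists_linearEquiv_restrict_eq
    (he.linearCombinationEquiv.symm ≪≫ₗ hr.linearCombinationEquiv)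
  have hGk : ∀ k, G (Pi.single (i k) 1) = r k := fun k => by
    have h := hG (he.linearCombinationEquiv (Finsupp.single k 1))
    simpa using h.symm
  set N := LinearMap.toMatrix' (G : (Fin n → ℂ) →ₗ[ℂ] (Fin n → ℂ)) with hN
  have hdet : IsUnit Nᵀ.det := by
    rw [det_transpose, hN, LinearMap.det_toMatrix']
    exact G.isUnit_det'
  refine ⟨Nᵀ.toLinearEquiv' ((isUnit_iff_isUnit_det _).2 hdet).invertible, fun k z => ?_⟩
  have h1 : N *ᵥ Pi.single (i k) 1 = r k := by
    rw [hN, LinearMap.toMatrix'_mulVec]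
    exact hGk k
  have h2 : (Nᵀ *ᵥ z) (i k) = (N *ᵥ Pi.single (i k) 1) ⬝ᵥ z := by
    rw [mulVec_single_one]
    rfl
  rw [← h1, ← h2]
  rfl

theorem analyticOnNhd_dotProduct_mulVec {n : ℕ} (C : Matrix (Fin n) (Fin n) ℂ)
    (s : Set (Fin n → ℂ)) : AnalyticOnNhd ℂ (fun z => z ⬝ᵥ C *ᵥ z) s := by
  intro z _
  have h : ∀ i, AnalyticAt ℂ (fun z : Fin n → ℂ => z i) z := fun i =>
    (ContinuousLinearMap.proj (R := ℂ) (φ := fun _ : Fin n => ℂ) i).analyticAt z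
  simp only [dotProduct, mulVec]
  refine Finset.analyticAt_fun_sum _ fun i _ => (h i).mul ?_
  exact Finset.analyticAt_fun_sum _ fun j _ => analyticAt_const.mul (h j)

/-- A linear change of `z` together with a shear and a rescaling of `w` is a biholomorphism. -/
theorem locBiholEquivAt_of_linearEquiv {n : ℕ} {Q Q' P : (Fin n → ℂ) → ℂ}
    (T : (Fin n → ℂ) ≃ₗ[ℂ] (Fin n → ℂ)) {c : ℂ} (hc : c ≠ 0)
    (hP : AnalyticOnNhd ℂ P Set.univ) (hP0 : P 0 = 0)
    (h : ∀ z, Q' (T z) = c * (Q z - P z)) :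
    LocBiholEquivAt n {p | p.2 = Q p.1} {p | p.2 = Q' p.1} := by
  have hT : ∀ S : (Fin n → ℂ) ≃ₗ[ℂ] (Fin n → ℂ),
      AnalyticOnNhd ℂ (fun p : (Fin n → ℂ) × ℂ => S p.1) Set.univ := fun S p _ =>
    ((S.toContinuousLinearEquiv : (Fin n → ℂ) →L[ℂ] (Fin n → ℂ)).analyticAt p.1).comp
      analyticAt_fst
  refine ⟨Set.univ, Set.univ, fun p => (T p.1, c * (p.2 - P p.1)),
    fun p => (T.symm p.1, c⁻¹ * p.2 + P (T.symm p.1)), isOpen_univ, isOpen_univ, trivial, trivial,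
    ?_, ?_, fun _ _ => trivial, fun _ _ => trivial, ?_, ?_, ?_, ?_⟩
  · intro p hp
    refine (hT T p hp).prod (analyticAt_const.mul (analyticAt_snd.sub ?_))
    exact (hP p.1 trivial).comp analyticAt_fst
  · intro p hp
    refine (hT T.symm p hp).prod ((analyticAt_const.mul analyticAt_snd).add ?_)
    exact AnalyticAt.comp (hP _ trivial) (hT T.symm p hp)
  · rintro ⟨z, w⟩ -
    simp [hc]
  · rintro ⟨z, w⟩ -
    simp [hc]
  · simp [hP0]
  · ext ⟨z, w⟩
    simp only [Set.inter_univ, Set.mem_image, Set.mem_ofPred_eq, Prod.mk.injEq, Prod.exists]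
    constructor
    · rintro ⟨x, y, rfl, rfl, rfl⟩
      exact (h x).symm
    · rintro rfl
      exact ⟨T.symm z, _, rfl, T.apply_symm_apply z, by rw [← h, T.apply_symm_apply]⟩

/-- A germ equivalence with a quadric of the form `w = conj(v·z) (m·z) + b conj(v·z)²`
forces the stacked matrix to have rank one. -/
theorem LocBiholEquivAt.rank_fromRows_eq_one {n : ℕ} {A B C : Matrix (Fin n) (Fin n) ℂ}
    (hB : B.IsSymm) {v m : Fin n → ℂ} {b : ℂ} (hv : v ≠ 0) (hmb : m ≠ 0 ∨ b ≠ 0)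
    {M' : Set ((Fin n → ℂ) × ℂ)}
    (hM' : ∀ p : (Fin n → ℂ) × ℂ, p ∈ M' ↔
      p.2 = star (v ⬝ᵥ p.1) * (m ⬝ᵥ p.1) + b * star (v ⬝ᵥ p.1) ^ 2)
    (h : LocBiholEquivAt n
      {p | p.2 = star p.1 ⬝ᵥ A *ᵥ p.1 + star (p.1 ⬝ᵥ B *ᵥ p.1) + p.1 ⬝ᵥ C *ᵥ p.1}
      M') :
    (fromRows Aᴴ B).rank = 1 := by
  obtain rfl : M' = {p : (Fin n → ℂ) × ℂ |
      p.2 = star (v ⬝ᵥ p.1) * (m ⬝ᵥ p.1) + b * star (v ⬝ᵥ p.1) ^ 2} := Set.ext hM'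
  have hA : ∀ (c : ℂ) (z : Fin n → ℂ),
      star (c • z) ⬝ᵥ A *ᵥ (c • z) = star c * c * (star z ⬝ᵥ A *ᵥ z) := fun c z => by
    rw [star_smul, mulVec_smul, smul_dotProduct, dotProduct_smul, smul_eq_mul, smul_eq_mul,
      mul_assoc]
  have hS : ∀ (D : Matrix (Fin n) (Fin n) ℂ) (c : ℂ) (z : Fin n → ℂ),
      (c • z) ⬝ᵥ D *ᵥ (c • z) = c ^ 2 * (z ⬝ᵥ D *ᵥ z) := fun D c z => by
    rw [mulVec_smul, smul_dotProduct, dotProduct_smul, smul_eq_mul, smul_eq_mul]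
    ring
  obtain ⟨L, l, hl, hL⟩ := h.exists_linearEquiv_quadratic
    (Q := fun z => star z ⬝ᵥ A *ᵥ z + star (z ⬝ᵥ B *ᵥ z) + z ⬝ᵥ C *ᵥ z)
    (Q' := fun z => star (v ⬝ᵥ z) * (m ⬝ᵥ z) + b * star (v ⬝ᵥ z) ^ 2)
    (by simp only [dotProduct]; fun_prop)
    (by
      intro t z
      simp only [dotProduct_smul, smul_eq_mul, star_mul', Complex.star_def, Complex.conj_ofReal]
      ring)
    (by
      intro t z
      simp only [hA, hS, star_mul', star_pow, Complex.star_def, Complex.conj_ofReal]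
      ring)
  have hparts : ∀ z, l * (star z ⬝ᵥ A *ᵥ z) = star (v ⬝ᵥ L z) * (m ⬝ᵥ L z) ∧
      l * star (z ⬝ᵥ B *ᵥ z) = b * star (v ⬝ᵥ L z) ^ 2 := by
    intro z
    obtain ⟨h, hh⟩ := hL z
    refine eq_and_eq_of_forall_quadratic (h := l * (z ⬝ᵥ C *ᵥ z) + h) fun c => ?_
    have := hh c
    simp only [hA, hS, dotProduct_smul, smul_eq_mul, star_mul', star_pow] at this
    linear_combination this
  set N := LinearMap.toMatrix' (L : (Fin n → ℂ) →ₗ[ℂ] (Fin n → ℂ)) with hN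
  have hdot : ∀ u z, u ⬝ᵥ L z = (u ᵥ* N) ⬝ᵥ z := fun u z => by
    rw [← dotProduct_mulVec, hN, LinearMap.toMatrix'_mulVec]
    rfl
  have hne : ∀ u, u ≠ 0 → u ᵥ* N ≠ 0 := by
    intro u hu h0
    apply hu
    ext i
    have h1 := hdot u (L.symm (Pi.single i 1))
    rw [h0, L.apply_symm_apply] at h1
    simpa using h1
  refine (rank_fromRows_conjTranspose_eq_one_iff hB).2
    ⟨v ᵥ* N, l⁻¹ • (m ᵥ* N), l⁻¹ * b, hne v hv, ?_, ?_, ?_⟩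
  · exact hmb.imp (fun hm => smul_ne_zero (inv_ne_zero hl) (hne m hm))
      (fun hb => mul_ne_zero (inv_ne_zero hl) hb)
  · refine sub_eq_zero.1 (eq_zero_of_forall_star_dotProduct_mulVec fun z => ?_)
    rw [sub_mulVec, dotProduct_sub, star_dotProduct_vecMulVec_mulVec, smul_dotProduct, ← hdot,
      ← hdot, smul_eq_mul]
    have h1 := (hparts z).1
    field_simp
    linear_combination h1
  · refine sub_eq_zero.1 (IsSymm.eq_zero_of_forall_dotProduct_mulVec ?_ fun z => ?_)
    · refine hB.sub (IsSymm.smul ?_ _)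
      rw [IsSymm, transpose_vecMulVec]
    · rw [sub_mulVec, dotProduct_sub, dotProduct_smul_vecMulVec_mulVec, ← hdot]
      apply star_injective
      have h1 := (hparts z).2
      simp only [star_sub, star_mul', star_pow, star_star, star_zero]
      field_simp
      linear_combination h1

/-- **Proposition 4.2:** the stacked matrix `[A*; B]` has rank exactly 1 iff the
quadric `w = z*Az + conj(zᵀBz) + zᵀCz` is locally biholomorphically equivalent at
the origin to one of the four exceptional quadrics. -/
theorem stmt_4 (n : ℕ) (hn : 2 ≤ n)
    (A B C : Matrix (Fin n) (Fin n) ℂ) (hB : B.IsSymm) (hC : C.IsSymm) :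
    (Matrix.fromRows Aᴴ B).rank = 1 ↔
      (LocBiholEquivAt n
        {p : (Fin n → ℂ) × ℂ |
          p.2 = star p.1 ⬝ᵥ A *ᵥ p.1 + star (p.1 ⬝ᵥ B *ᵥ p.1) + p.1 ⬝ᵥ C *ᵥ p.1}
        {p : (Fin n → ℂ) × ℂ |
          p.2 = (starRingEnd ℂ) (p.1 ⟨0, by omega⟩) * p.1 ⟨1, by omega⟩ +
            ((starRingEnd ℂ) (p.1 ⟨0, by omega⟩)) ^ 2} ∨
      LocBiholEquivAt n
        {p : (Fin n → ℂ) × ℂ |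
          p.2 = star p.1 ⬝ᵥ A *ᵥ p.1 + star (p.1 ⬝ᵥ B *ᵥ p.1) + p.1 ⬝ᵥ C *ᵥ p.1}
        {p : (Fin n → ℂ) × ℂ |
          p.2 = (starRingEnd ℂ) (p.1 ⟨0, by omega⟩) * p.1 ⟨1, by omega⟩} ∨
      (∃ a : ℝ, 0 ≤ a ∧
        LocBiholEquivAt n
          {p : (Fin n → ℂ) × ℂ |
            p.2 = star p.1 ⬝ᵥ A *ᵥ p.1 + star (p.1 ⬝ᵥ B *ᵥ p.1) + p.1 ⬝ᵥ C *ᵥ p.1}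
          {p : (Fin n → ℂ) × ℂ |
            p.2 = (starRingEnd ℂ) (p.1 ⟨0, by omega⟩) * p.1 ⟨0, by omega⟩ +
              (a : ℂ) * ((starRingEnd ℂ) (p.1 ⟨0, by omega⟩)) ^ 2}) ∨
      LocBiholEquivAt n
        {p : (Fin n → ℂ) × ℂ |
          p.2 = star p.1 ⬝ᵥ A *ᵥ p.1 + star (p.1 ⬝ᵥ B *ᵥ p.1) + p.1 ⬝ᵥ C *ᵥ p.1}
        {p : (Fin n → ℂ) × ℂ |
          p.2 = ((starRingEnd ℂ) (p.1 ⟨0, by omega⟩)) ^ 2}) := by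
  have hsingle : ∀ i : Fin n, (Pi.single i 1 : Fin n → ℂ) ≠ 0 := fun i => by simp
  constructor
  · intro h
    obtain ⟨v, m, b, hv, hmb, rfl, rfl⟩ := (rank_fromRows_conjTranspose_eq_one_iff hB).1 h
    have hP := analyticOnNhd_dotProduct_mulVec C Set.univ
    have hP0 : (0 : Fin n → ℂ) ⬝ᵥ C *ᵥ 0 = 0 := by simp
    have hloc : ∀ (Q' : (Fin n → ℂ) → ℂ) (T : (Fin n → ℂ) ≃ₗ[ℂ] (Fin n → ℂ)) (c : ℂ), c ≠ 0 →
        (∀ z, Q' (T z) = c * (star (v ⬝ᵥ z) * (m ⬝ᵥ z) + b * star (v ⬝ᵥ z) ^ 2)) →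
        LocBiholEquivAt n
          {p | p.2 = star p.1 ⬝ᵥ vecMulVec (star v) m *ᵥ p.1 +
            star (p.1 ⬝ᵥ (star b • vecMulVec v v) *ᵥ p.1) + p.1 ⬝ᵥ C *ᵥ p.1}
          {p | p.2 = Q' p.1} := by
      intro Q' T c hc h
      refine locBiholEquivAt_of_linearEquiv (Q := fun z => star z ⬝ᵥ vecMulVec (star v) m *ᵥ z +
        star (z ⬝ᵥ (star b • vecMulVec v v) *ᵥ z) + z ⬝ᵥ C *ᵥ z) T hc hP hP0 fun z => ?_
      rw [h, star_dotProduct_vecMulVec_mulVec, dotProduct_smul_vecMulVec_mulVec, star_mul',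
        star_star, star_pow]
      ring
    by_cases hli : LinearIndependent ℂ ![v, m]
    · have hinj : Function.Injective ![(⟨0, by omega⟩ : Fin n), ⟨1, by omega⟩] := by
        intro i j
        fin_cases i <;> fin_cases j <;> simp
      by_cases hb : b = 0
      · obtain ⟨T, hT⟩ := exists_linearEquiv_apply_eq_dotProduct hinj hli
        have hT0 : ∀ z, T z ⟨0, by omega⟩ = v ⬝ᵥ z := hT 0
        have hT1 : ∀ z, T z ⟨1, by omega⟩ = m ⬝ᵥ z := hT 1
        refine Or.inr (Or.inl (hloc
          (fun z => starRingEnd ℂ (z ⟨0, by omega⟩) * z ⟨1, by omega⟩) T 1 one_ne_zero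
          fun z => ?_))
        simp [hT0, hT1, hb]
      · have hli' : LinearIndependent ℂ ![v, b⁻¹ • m] := by
          convert! hli.units_smul ![1, (Units.mk0 b hb)⁻¹] using 1
          ext i
          fin_cases i <;> simp [Units.smul_def]
        obtain ⟨T, hT⟩ := exists_linearEquiv_apply_eq_dotProduct hinj hli'
        have hT0 : ∀ z, T z ⟨0, by omega⟩ = v ⬝ᵥ z := hT 0
        have hT1 : ∀ z, T z ⟨1, by omega⟩ = (b⁻¹ • m) ⬝ᵥ z := hT 1
        refine Or.inl (hloc
          (fun z => starRingEnd ℂ (z ⟨0, by omega⟩) * z ⟨1, by omega⟩ +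
            starRingEnd ℂ (z ⟨0, by omega⟩) ^ 2) T b⁻¹ (inv_ne_zero hb) fun z => ?_)
        simp only [hT0, hT1, smul_dotProduct, smul_eq_mul, starRingEnd_apply]
        field_simp
    · obtain ⟨k, rfl⟩ : ∃ k : ℂ, k • v = m := by
        rw [LinearIndependent.pair_iff' hv] at hli
        push Not at hli
        exact hli
      have hrow : ∀ e : ℂ, e ≠ 0 → ∃ T : (Fin n → ℂ) ≃ₗ[ℂ] (Fin n → ℂ),
          ∀ z, T z ⟨0, by omega⟩ = e * (v ⬝ᵥ z) := by
        intro e he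
        obtain ⟨T, hT⟩ := exists_linearEquiv_apply_eq_dotProduct
          (i := fun _ : Unit => (⟨0, by omega⟩ : Fin n)) (r := fun _ => e • v)
          (fun _ _ _ => rfl) (LinearIndependent.of_subsingleton () (smul_ne_zero he hv))
        exact ⟨T, fun z => by rw [← smul_eq_mul, ← smul_dotProduct]; exact hT () z⟩
      by_cases hk : k = 0
      · have hb : b ≠ 0 := hmb.resolve_left fun h => h (by simp [hk])
        obtain ⟨T, hT⟩ := hrow 1 one_ne_zero
        refine Or.inr (Or.inr (Or.inr (hloc
          (fun z => starRingEnd ℂ (z ⟨0, by omega⟩) ^ 2) T b⁻¹ (inv_ne_zero hb) fun z => ?_)))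
        simp only [hT, hk, smul_dotProduct, smul_eq_mul, starRingEnd_apply]
        field_simp
        ring
      · set e : ℂ := Complex.exp ((-(Complex.arg (b / k) / 2) : ℝ) * Complex.I) with he
        have hse : star e = Complex.exp ((Complex.arg (b / k) / 2 : ℝ) * Complex.I) := by
          rw [he, Complex.star_def, ← Complex.exp_conj, map_mul, Complex.conj_I,
            Complex.conj_ofReal]
          push_cast
          ring_nf
        have hee : star e * e = 1 := by
          rw [hse, he, ← Complex.exp_add, ← Complex.exp_zero]
          push_cast
          ring_nf
        have hb : (‖b / k‖ : ℂ) * star e ^ 2 = b / k := by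
          conv_rhs => rw [← Complex.norm_mul_exp_arg_mul_I (b / k)]
          rw [hse, ← Complex.exp_nat_mul]
          push_cast
          ring_nf
        obtain ⟨T, hT⟩ := hrow e (Complex.exp_ne_zero _)
        refine Or.inr (Or.inr (Or.inl ⟨‖b / k‖, norm_nonneg _, hloc
          (fun z => starRingEnd ℂ (z ⟨0, by omega⟩) * z ⟨0, by omega⟩ +
            (‖b / k‖ : ℝ) * starRingEnd ℂ (z ⟨0, by omega⟩) ^ 2) T k⁻¹ (inv_ne_zero hk)
          fun z => ?_⟩))
        simp only [hT, smul_dotProduct, smul_eq_mul, star_mul', starRingEnd_apply]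
        calc _ = star e * e * (star (v ⬝ᵥ z) * (v ⬝ᵥ z)) +
              (‖b / k‖ * star e ^ 2) * star (v ⬝ᵥ z) ^ 2 := by ring
          _ = _ := by
            rw [hee, hb]
            field_simp
  · rintro (h | h | ⟨a, -, h⟩ | h)
    · refine h.rank_fromRows_eq_one hB (hsingle ⟨0, by omega⟩) (Or.inr one_ne_zero)
        (m := Pi.single ⟨1, by omega⟩ 1) fun p => ?_
      simp only [Set.mem_ofPred_eq, single_one_dotProduct, one_mul, starRingEnd_apply]
    · refine h.rank_fromRows_eq_one hB (hsingle ⟨0, by omega⟩) (Or.inl (hsingle ⟨1, by omega⟩))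
        (b := 0) fun p => ?_
      simp only [Set.mem_ofPred_eq, single_one_dotProduct, zero_mul, add_zero, starRingEnd_apply]
    · refine h.rank_fromRows_eq_one hB (hsingle ⟨0, by omega⟩) (Or.inl (hsingle ⟨0, by omega⟩))
        (b := a) fun p => ?_
      simp only [Set.mem_ofPred_eq, single_one_dotProduct, starRingEnd_apply]
    · refine h.rank_fromRows_eq_one hB (hsingle ⟨0, by omega⟩) (Or.inr one_ne_zero)
        (m := 0) fun p => ?_
      simp only [Set.mem_ofPred_eq, single_one_dotProduct, zero_dotProduct, mul_zero, zero_add,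
        one_mul, starRingEnd_apply]
end

section
/- Let p, q, r, s ∈ ℂ with s ≠ 0. Consider the differential equation (p + qη)ζ(η) = (r + sη)ζ'(η) for polynomials ζ ∈ ℂ[η]. The equation has a nonconstant polynomial solution if and only if q = 0 and p/s is a positive integer. The equation has a nonzero constant solution if and only if p = q = 0. -/
open Polynomial

theorem coeff_succ_of_linear_mul_eq_linear_mul_derivative {R : Type*} [CommRing R]
    {p q r s : R} {ζ : R[X]} (h : (C p + C q * X) * ζ = (C r + C s * X) * derivative ζ) (k : ℕ) :
    p * ζ.coeff (k + 1) + q * ζ.coeff k =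
      r * (ζ.coeff (k + 2) * (k + 2)) + s * (ζ.coeff (k + 1) * (k + 1)) := by
  have hk := congrArg (fun f => f.coeff (k + 1)) h
  simp only [add_mul, mul_assoc, coeff_add, coeff_C_mul, coeff_X_mul, coeff_derivative] at hk
  rw [hk]
  push_cast
  ring

theorem linear_mul_pow_eq_linear_mul_derivative {R : Type*} [CommRing R] (r s : R) (m : ℕ) :
    C (m * s) * (C r + C s * X) ^ m = (C r + C s * X) * derivative ((C r + C s * X) ^ m) := by
  cases m with
  | zero => simp
  | succ k =>
    rw [derivative_pow_succ]
    simp only [derivative_C, derivative_C_mul, derivative_X, map_mul, map_add,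
      map_natCast, map_one, Nat.cast_add, Nat.cast_one]
    ring

/-- **Proposition 4.4 (a):** solvability of `(p + qη)ζ = (r + sη)ζ'` in `ℂ[η]`. -/
theorem stmt_5 (p q r s : ℂ) (hs : s ≠ 0) :
    ((∃ ζ : Polynomial ℂ, (¬ ∃ c : ℂ, ζ = Polynomial.C c) ∧
        (Polynomial.C p + Polynomial.C q * Polynomial.X) * ζ =
          (Polynomial.C r + Polynomial.C s * Polynomial.X) * derivative ζ) ↔
      (q = 0 ∧ ∃ m : ℕ, 0 < m ∧ p / s = (m : ℂ))) ∧
    ((∃ ζ : Polynomial ℂ, (∃ c : ℂ, c ≠ 0 ∧ ζ = Polynomial.C c) ∧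
        (Polynomial.C p + Polynomial.C q * Polynomial.X) * ζ =
          (Polynomial.C r + Polynomial.C s * Polynomial.X) * derivative ζ) ↔
      (p = 0 ∧ q = 0)) := by
  refine ⟨⟨?_, ?_⟩, ?_, ?_⟩
  · rintro ⟨ζ, hζ, h⟩
    have hdeg : ζ.natDegree ≠ 0 := fun h0 => hζ ⟨_, eq_C_of_natDegree_eq_zero h0⟩
    have hlead : ζ.leadingCoeff ≠ 0 :=
      leadingCoeff_ne_zero.2 fun h0 => hdeg (by simp [h0])
    obtain ⟨m, hm⟩ := Nat.exists_eq_succ_of_ne_zero hdeg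
    rw [leadingCoeff, hm] at hlead
    have hz (j : ℕ) (hj : m + 1 < j) : ζ.coeff j = 0 := coeff_eq_zero_of_natDegree_lt (by omega)
    have hq := coeff_succ_of_linear_mul_eq_linear_mul_derivative h (m + 1)
    have hp := coeff_succ_of_linear_mul_eq_linear_mul_derivative h m
    rw [hz (m + 1 + 1) (by omega), hz (m + 1 + 2) (by omega)] at hq
    have hq0 : q = 0 := by simpa [hlead] using hq
    rw [hz (m + 2) (by omega), hq0] at hp
    refine ⟨hq0, m + 1, m.succ_pos, ?_⟩
    rw [div_eq_iff hs]
    apply mul_right_cancel₀ hlead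
    push_cast
    linear_combination hp
  · rintro ⟨rfl, m, hm, h⟩
    rw [div_eq_iff hs] at h
    subst h
    refine ⟨(C r + C s * X) ^ m, ?_, ?_⟩
    · rintro ⟨c, hc⟩
      have hd := congrArg natDegree hc
      rw [natDegree_pow, add_comm, natDegree_linear hs, natDegree_C] at hd
      omega
    · rw [← linear_mul_pow_eq_linear_mul_derivative, C_0, zero_mul, add_zero]
  · rintro ⟨_, ⟨c, hc, rfl⟩, h⟩
    rw [derivative_C, mul_zero, mul_eq_zero, or_iff_left (C_ne_zero.2 hc)] at h
    constructor
    · simpa using congrArg (fun f => f.coeff 0) h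
    · simpa using congrArg (fun f => f.coeff 1) h
  · rintro ⟨rfl, rfl⟩
    exact ⟨C 1, ⟨1, one_ne_zero, rfl⟩, by simp⟩
end

section
/- Let p, q, r, s, t ∈ ℂ with t ≠ 0, and let ξ₁, ξ₂ be the two roots of r + sη + tη², with ξ₁ ≠ ξ₂. Consider the differential equation (p + qη)ζ(η) = (r + sη + tη²)ζ'(η) for polynomials ζ ∈ ℂ[η]. The equation has a nonconstant polynomial solution if and only if (qξ₁ + p)/(t(ξ₁ − ξ₂)) and (qξ₂ + p)/(t(ξ₂ − ξ₁)) are both nonnegative integers and at least one of them is positive. The equation has a nonzero constant solution if and only if qξ₁ + p = 0 and qξ₂ + p = 0. -/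
open Polynomial

/-- At a root `a` of `t (η - a) (η - b)`, the exponent of the equation
`(p + qη)ζ = t (η - a) (η - b) dζ/dη` is the multiplicity of `a` as a root of `ζ`. -/
theorem exponent_eq_rootMultiplicity {p q t a b : ℂ} {ζ : ℂ[X]} (hζ : ζ ≠ 0)
    (h : (C p + C q * X) * ζ = C t * (X - C a) * (X - C b) * derivative ζ) :
    q * a + p = t * (a - b) * (ζ.rootMultiplicity a : ℂ) := by
  obtain ⟨g, hg, hdvd⟩ := exists_eq_pow_rootMultiplicity_mul_and_not_dvd ζ hζ a
  generalize ζ.rootMultiplicity a = m at hg ⊢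
  have hga : g.eval a ≠ 0 := fun h0 => hdvd (dvd_iff_isRoot.mpr h0)
  have hder : (X - C a) * derivative ζ =
      (X - C a) ^ m * (C (m : ℂ) * g + (X - C a) * derivative g) := by
    rw [hg]
    cases m with
    | zero => simp
    | succ k =>
      simp only [derivative_mul, derivative_X_sub_C_pow, Nat.add_sub_cancel]
      ring
  have hred : (C p + C q * X) * g =
      C t * (X - C b) * (C (m : ℂ) * g + (X - C a) * derivative g) := by
    apply mul_left_cancel₀ (pow_ne_zero m (X_sub_C_ne_zero a))
    calc (X - C a) ^ m * ((C p + C q * X) * g)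
        = (C p + C q * X) * ζ := by rw [hg]; ring
      _ = C t * (X - C b) * ((X - C a) * derivative ζ) := by rw [h]; ring
      _ = _ := by rw [hder]; ring
  have hev := congrArg (eval a) hred
  simp only [eval_mul, eval_add, eval_sub, eval_C, eval_X, sub_self, zero_mul, add_zero] at hev
  apply mul_right_cancel₀ hga
  linear_combination hev

/-- The product `(η - a)^m (η - b)^n` solves the equation whose exponents at `a`, `b` are
`m`, `n`. -/
theorem pow_mul_pow_solves {p q t a b : ℂ} {m n : ℕ} (hab : a ≠ b)
    (ha : q * a + p = t * (a - b) * m) (hb : q * b + p = t * (b - a) * n) :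
    (C p + C q * X) * ((X - C a) ^ m * (X - C b) ^ n) =
      C t * (X - C a) * (X - C b) * derivative ((X - C a) ^ m * (X - C b) ^ n) := by
  have hq : q = t * (m + n) := by
    apply mul_right_cancel₀ (sub_ne_zero.mpr hab)
    linear_combination ha - hb
  have hp : p = -(t * (m * b + n * a)) := by
    subst hq
    linear_combination ha
  have hpow (c : ℂ) (k : ℕ) :
      (X - C c) * derivative ((X - C c) ^ k) = C (k : ℂ) * (X - C c) ^ k := by
    cases k with
    | zero => simp
    | succ k =>
      simp only [derivative_X_sub_C_pow, Nat.add_sub_cancel]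
      ring
  rw [derivative_mul, hq, hp]
  simp only [C_neg, C_mul, C_add]
  linear_combination (-(C t * (X - C b) * (X - C b) ^ n)) * hpow a m
    - C t * (X - C a) * (X - C a) ^ m * hpow b n

theorem linear_coeffs_eq_zero {p q a b : ℂ} (hab : a ≠ b)
    (ha : q * a + p = 0) (hb : q * b + p = 0) : p = 0 ∧ q = 0 := by
  have hq : q = 0 := by
    apply mul_right_cancel₀ (sub_ne_zero.mpr hab)
    linear_combination ha - hb
  subst hq
  exact ⟨by linear_combination ha, rfl⟩

/-- **Proposition 4.4 (b):** solvability of `(p + qη)ζ = (r + sη + tη²)ζ'` in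
`ℂ[η]`, where `ξ₁ ≠ ξ₂` are the roots of `r + sη + tη²`. -/
theorem stmt_6 (p q r s t ξ₁ ξ₂ : ℂ) (ht : t ≠ 0) (hξ : ξ₁ ≠ ξ₂)
    (hroots : Polynomial.C r + Polynomial.C s * Polynomial.X +
        Polynomial.C t * Polynomial.X ^ 2 =
      Polynomial.C t * (Polynomial.X - Polynomial.C ξ₁) *
        (Polynomial.X - Polynomial.C ξ₂)) :
    ((∃ ζ : Polynomial ℂ, (¬ ∃ c : ℂ, ζ = Polynomial.C c) ∧
        (Polynomial.C p + Polynomial.C q * Polynomial.X) * ζ =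
          (Polynomial.C r + Polynomial.C s * Polynomial.X +
            Polynomial.C t * Polynomial.X ^ 2) * derivative ζ) ↔
      (∃ m₁ m₂ : ℕ,
        (q * ξ₁ + p) / (t * (ξ₁ - ξ₂)) = (m₁ : ℂ) ∧
        (q * ξ₂ + p) / (t * (ξ₂ - ξ₁)) = (m₂ : ℂ) ∧
        (0 < m₁ ∨ 0 < m₂))) ∧
    ((∃ ζ : Polynomial ℂ, (∃ c : ℂ, c ≠ 0 ∧ ζ = Polynomial.C c) ∧
        (Polynomial.C p + Polynomial.C q * Polynomial.X) * ζ =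
          (Polynomial.C r + Polynomial.C s * Polynomial.X +
            Polynomial.C t * Polynomial.X ^ 2) * derivative ζ) ↔
      (q * ξ₁ + p = 0 ∧ q * ξ₂ + p = 0)) := by
  rw [hroots]
  have h₁₂ : t * (ξ₁ - ξ₂) ≠ 0 := mul_ne_zero ht (sub_ne_zero.mpr hξ)
  have h₂₁ : t * (ξ₂ - ξ₁) ≠ 0 := mul_ne_zero ht (sub_ne_zero.mpr hξ.symm)
  refine ⟨⟨?_, ?_⟩, ?_, ?_⟩
  · rintro ⟨ζ, hconst, h⟩
    have hζ : ζ ≠ 0 := fun h0 => hconst ⟨0, by rw [h0, C_0]⟩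
    have e₁ := exponent_eq_rootMultiplicity hζ h
    have e₂ := exponent_eq_rootMultiplicity (a := ξ₂) (b := ξ₁) hζ (by rw [h]; ring)
    refine ⟨ζ.rootMultiplicity ξ₁, ζ.rootMultiplicity ξ₂, ?_, ?_, ?_⟩
    · rw [e₁, mul_div_cancel_left₀ _ h₁₂]
    · rw [e₂, mul_div_cancel_left₀ _ h₂₁]
    · by_contra! hm
      rw [Nat.le_zero.mp hm.1, Nat.cast_zero, mul_zero] at e₁
      rw [Nat.le_zero.mp hm.2, Nat.cast_zero, mul_zero] at e₂
      obtain ⟨rfl, rfl⟩ := linear_coeffs_eq_zero hξ e₁ e₂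
      have hne : C t * (X - C ξ₁) * (X - C ξ₂) ≠ 0 :=
        mul_ne_zero (mul_ne_zero (C_ne_zero.mpr ht) (X_sub_C_ne_zero _)) (X_sub_C_ne_zero _)
      have hder : derivative ζ = 0 := by
        apply (mul_eq_zero.mp _).resolve_left hne
        rw [← h]
        simp
      exact hconst ⟨ζ.coeff 0, eq_C_of_derivative_eq_zero hder⟩
  · rintro ⟨m₁, m₂, e₁, e₂, hm⟩
    rw [div_eq_iff h₁₂, mul_comm] at e₁
    rw [div_eq_iff h₂₁, mul_comm] at e₂
    refine ⟨(X - C ξ₁) ^ m₁ * (X - C ξ₂) ^ m₂, ?_,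
      pow_mul_pow_solves hξ (by linear_combination e₁) (by linear_combination e₂)⟩
    rintro ⟨c, hc⟩
    have hdeg := congrArg natDegree hc
    rw [natDegree_C, natDegree_mul (pow_ne_zero _ (X_sub_C_ne_zero _))
      (pow_ne_zero _ (X_sub_C_ne_zero _)), natDegree_pow, natDegree_pow, natDegree_X_sub_C,
      natDegree_X_sub_C] at hdeg
    omega
  · rintro ⟨_, ⟨c, hc, rfl⟩, h⟩
    rw [derivative_C, mul_zero] at h
    have hlin := (mul_eq_zero.mp h).resolve_right (C_ne_zero.mpr hc)
    have hev (x : ℂ) : q * x + p = 0 := by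
      simpa [add_comm] using congrArg (eval x) hlin
    exact ⟨hev ξ₁, hev ξ₂⟩
  · rintro ⟨e₁, e₂⟩
    obtain ⟨rfl, rfl⟩ := linear_coeffs_eq_zero hξ e₁ e₂
    exact ⟨C 1, ⟨1, one_ne_zero, rfl⟩, by simp⟩
end

section
/- Let p, q, t, ξ ∈ ℂ with t ≠ 0. Consider the differential equation (p + qη)ζ(η) = t(η − ξ)² ζ'(η) for polynomials ζ ∈ ℂ[η]. The equation has a nonconstant polynomial solution if and only if q/t is a positive integer and qξ + p = 0. The equation has a nonzero constant solution if and only if p = q = 0. -/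
open Polynomial

/-- The Euler operator `(X - a) d/dX` acts on `(X - a) ^ m` as multiplication by `m`. -/
theorem X_sub_C_mul_derivative_pow {R : Type*} [CommRing R] (a : R) (m : ℕ) :
    (X - C a) * derivative ((X - C a) ^ m) = C (m : R) * (X - C a) ^ m := by
  cases m with
  | zero => simp
  | succ n =>
    rw [derivative_X_sub_C_pow, map_natCast, Nat.add_sub_cancel]
    ring

/-- A nonzero solution of `(p + qX) ζ = t (X - a)² ζ'` forces `q a + p = 0`, and `q / t` is the
multiplicity of `a` as a root of `ζ`. -/
theorem eq_mul_rootMultiplicity_of_mul_eq_mul_derivative {K : Type*} [Field K] {p q t a : K}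
    {ζ : K[X]} (hζ : ζ ≠ 0)
    (h : (C p + C q * X) * ζ = C t * (X - C a) ^ 2 * derivative ζ) :
    q * a + p = 0 ∧ q = t * (ζ.rootMultiplicity a : K) := by
  obtain ⟨g, hg, hdvd⟩ := exists_eq_pow_rootMultiplicity_mul_and_not_dvd ζ hζ a
  set m := ζ.rootMultiplicity a
  have hga : g.eval a ≠ 0 := fun h0 => hdvd (dvd_iff_isRoot.2 h0)
  have hX : X - C a ≠ 0 := X_sub_C_ne_zero a
  have key : (C p + C q * X) * g =
      (X - C a) * (C t * (C (m : K) * g + (X - C a) * derivative g)) := by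
    apply mul_left_cancel₀ (pow_ne_zero m hX)
    rw [hg, derivative_mul] at h
    linear_combination h + C t * (X - C a) * g * X_sub_C_mul_derivative_pow a m
  have hpq : q * a + p = 0 := by
    have := congrArg (eval a) key
    simp only [eval_mul, eval_add, eval_sub, eval_C, eval_X, sub_self, zero_mul,
      mul_eq_zero, hga, or_false] at this
    linear_combination this
  refine ⟨hpq, ?_⟩
  have hp : C p = -(C q * C a) := by
    rw [← C_mul, ← C_neg]
    congr 1
    linear_combination hpq
  have key' : C q * g = C t * (C (m : K) * g + (X - C a) * derivative g) := by
    apply mul_left_cancel₀ hX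
    linear_combination key - g * hp
  have := congrArg (eval a) key'
  simp only [eval_mul, eval_add, eval_sub, eval_C, eval_X, sub_self, zero_mul, add_zero] at this
  apply mul_right_cancel₀ hga
  linear_combination this

/-- **Proposition 4.4 (c):** solvability of `(p + qη)ζ = t(η − ξ)²ζ'` in `ℂ[η]`. -/
theorem stmt_7 (p q t ξ : ℂ) (ht : t ≠ 0) :
    ((∃ ζ : Polynomial ℂ, (¬ ∃ c : ℂ, ζ = Polynomial.C c) ∧
        (Polynomial.C p + Polynomial.C q * Polynomial.X) * ζ =
          Polynomial.C t * (Polynomial.X - Polynomial.C ξ) ^ 2 * derivative ζ) ↔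
      ((∃ m : ℕ, 0 < m ∧ q / t = (m : ℂ)) ∧ q * ξ + p = 0)) ∧
    ((∃ ζ : Polynomial ℂ, (∃ c : ℂ, c ≠ 0 ∧ ζ = Polynomial.C c) ∧
        (Polynomial.C p + Polynomial.C q * Polynomial.X) * ζ =
          Polynomial.C t * (Polynomial.X - Polynomial.C ξ) ^ 2 * derivative ζ) ↔
      (p = 0 ∧ q = 0)) := by
  refine ⟨⟨?_, ?_⟩, ⟨?_, ?_⟩⟩
  · rintro ⟨ζ, hnc, h⟩
    have hζ : ζ ≠ 0 := fun h0 => hnc ⟨0, by simp [h0]⟩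
    obtain ⟨hpq, hq⟩ := eq_mul_rootMultiplicity_of_mul_eq_mul_derivative hζ h
    refine ⟨⟨ζ.rootMultiplicity ξ, Nat.pos_of_ne_zero fun hm => hnc ?_, ?_⟩, hpq⟩
    · have hq0 : q = 0 := by simpa [hm] using hq
      have hp0 : p = 0 := by simpa [hq0] using hpq
      have hd : derivative ζ = 0 := by
        simpa [hp0, hq0, ht, X_sub_C_ne_zero] using h.symm
      exact ⟨_, eq_C_of_derivative_eq_zero hd⟩
    · rw [hq, mul_div_cancel_left₀ _ ht]
  · rintro ⟨⟨m, hm, hqt⟩, hpq⟩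
    refine ⟨(X - C ξ) ^ m, ?_, ?_⟩
    · rintro ⟨c, hc⟩
      have := congrArg natDegree hc
      rw [natDegree_pow, natDegree_X_sub_C, natDegree_C] at this
      omega
    · have hq : C q = C t * C (m : ℂ) := by
        rw [← C_mul, ← hqt, mul_div_cancel₀ _ ht]
      have hp : C p = -(C q * C ξ) := by
        rw [← C_mul, ← C_neg]
        congr 1
        linear_combination hpq
      linear_combination (X - C ξ) ^ m * hp + (X - C ξ) * (X - C ξ) ^ m * hq -
        C t * (X - C ξ) * X_sub_C_mul_derivative_pow ξ m
  · rintro ⟨_, ⟨c, hc, rfl⟩, h⟩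
    have h0 : C p + C q * X = 0 := by simpa [hc] using h
    exact ⟨by simpa using congrArg (coeff · 0) h0, by simpa using congrArg (coeff · 1) h0⟩
  · rintro ⟨rfl, rfl⟩
    exact ⟨C 1, ⟨1, one_ne_zero, rfl⟩, by simp⟩
end

section
/- Let A, C be complex 2×2 matrices with C symmetric and A invertible (rank 2), and let Q(z,ζ) = ζᵀAz + zᵀCz ∈ ℂ[z₁,z₂,ζ₁,ζ₂]. Suppose f(z,ζ) ∈ ℂ[z₁,z₂,ζ₁,ζ₂] satisfies the CR condition (∂Q/∂ζ₂)(∂f/∂ζ₁) = (∂Q/∂ζ₁)(∂f/∂ζ₂) in the polynomial ring. Then there exists a unique polynomial F(z,w) ∈ ℂ[z₁,z₂,w] such that f(z,ζ) = F(z, Q(z,ζ)) identically. Moreover, if w is given weight two and z₁, z₂ weight one, the weighted degree of F equals the total degree of f, and if f is homogeneous then F is weighted homogeneous of the same degree. -/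
open MvPolynomial Matrix

namespace MvPolynomial

variable {σ τ K : Type*} [Field K]

/-- A nonzero linear form over a field is irreducible. -/
theorem IsHomogeneous.irreducible_of_one {p : MvPolynomial σ K} (hp : p.IsHomogeneous 1)
    (h0 : p ≠ 0) : Irreducible p := by
  refine irreducible_of_totalDegree_eq_one (hp.totalDegree h0) fun x hx => ?_
  rw [isUnit_iff_ne_zero]
  rintro rfl
  exact h0 (by ext m; simpa using hx m)

/-- Over a field of characteristic zero every polynomial has an antiderivative. -/
theorem exists_pderiv_eq [CharZero K] (i : σ) (G : MvPolynomial σ K) :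
    ∃ H : MvPolynomial σ K, pderiv i H = G := by
  induction G using MvPolynomial.induction_on' with
  | monomial m c =>
    refine ⟨monomial (m + Finsupp.single i 1) (c / (m i + 1)), ?_⟩
    have : (m i : K) + 1 ≠ 0 := Nat.cast_add_one_ne_zero (m i)
    simp [pderiv_monomial, this]
  | add p q hp hq =>
    obtain ⟨P, rfl⟩ := hp
    obtain ⟨R, rfl⟩ := hq
    exact ⟨P + R, map_add _ _ _⟩

theorem notMem_vars_of_pderiv_eq_zero [CharZero K] {i : σ} {p : MvPolynomial σ K}
    (h : pderiv i p = 0) : i ∉ p.vars := by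
  classical
  intro hi
  obtain ⟨m, hm, him⟩ := (mem_vars_iff_mem_support i).mp hi
  have hle : Finsupp.single i 1 ≤ m := by
    simpa [Nat.one_le_iff_ne_zero] using him
  have hc := coeff_pderiv (i := i) p (m - Finsupp.single i 1)
  rw [h, tsub_add_cancel_of_le hle, coeff_zero, eq_comm] at hc
  have hne : (((m - Finsupp.single i 1 : σ →₀ ℕ) i : ℕ) : K) + 1 ≠ 0 := Nat.cast_add_one_ne_zero _
  exact mem_support_iff.mp hm ((mul_eq_zero.mp hc).resolve_right hne)

/-- If all the components of weight greater than `n` vanish, the weighted degree is at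
most `n`. -/
theorem weightedTotalDegree_le_of_component_eq_zero {w : σ → ℕ} {p : MvPolynomial σ K} {n : ℕ}
    (h : ∀ e, n < e → weightedHomogeneousComponent w e p = 0) : weightedTotalDegree w p ≤ n := by
  refine Finset.sup_le fun m hm => ?_
  by_contra! hlt
  have := congrArg (coeff m) (h _ hlt)
  rw [coeff_weightedHomogeneousComponent, if_pos rfl] at this
  exact mem_support_iff.mp hm this

section GradedHom

variable {w : σ → ℕ} {v : τ → ℕ} {g : σ → MvPolynomial τ K}

theorem weightedHomogeneousComponent_aeval (hg : ∀ i, (g i).IsWeightedHomogeneous v (w i)) (e : ℕ)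
    (p : MvPolynomial σ K) :
    weightedHomogeneousComponent v e (aeval g p) =
      aeval g (weightedHomogeneousComponent w e p) := by
  induction p using MvPolynomial.induction_on' with
  | monomial m c =>
    have hm : (monomial m c).IsWeightedHomogeneous w (Finsupp.weight w m) :=
      isWeightedHomogeneous_monomial w m c rfl
    have himage : (aeval g (monomial m c)).IsWeightedHomogeneous v (Finsupp.weight w m) := by
      rw [aeval_monomial, algebraMap_eq, Finsupp.weight_apply, Finsupp.prod, Finsupp.sum]
      exact (IsWeightedHomogeneous.prod _ _ _ fun i _ => (hg i).pow (m i)).C_mul c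
    by_cases he : e = Finsupp.weight w m
    · rw [he, hm.weightedHomogeneousComponent_same, himage.weightedHomogeneousComponent_same]
    · rw [hm.weightedHomogeneousComponent_ne _ he, himage.weightedHomogeneousComponent_ne _ he,
        map_zero]
  | add p q hp hq => simp only [map_add, hp, hq]

theorem weightedTotalDegree_aeval_of_injective
    (hg : ∀ i, (g i).IsWeightedHomogeneous v (w i))
    (hinj : Function.Injective (aeval g : MvPolynomial σ K →ₐ[K] MvPolynomial τ K))
    (p : MvPolynomial σ K) :
    weightedTotalDegree v (aeval g p) = weightedTotalDegree w p := by
  apply le_antisymm <;> refine weightedTotalDegree_le_of_component_eq_zero fun e he => ?_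
  · rw [weightedHomogeneousComponent_aeval hg, weightedHomogeneousComponent_eq_zero _ _ he,
      map_zero]
  · apply hinj
    rw [← weightedHomogeneousComponent_aeval hg, weightedHomogeneousComponent_eq_zero _ _ he,
      map_zero]

theorem IsWeightedHomogeneous.of_aeval_of_injective
    (hg : ∀ i, (g i).IsWeightedHomogeneous v (w i))
    (hinj : Function.Injective (aeval g : MvPolynomial σ K →ₐ[K] MvPolynomial τ K))
    {p : MvPolynomial σ K} {d : ℕ} (hp : (aeval g p).IsWeightedHomogeneous v d) :
    p.IsWeightedHomogeneous w d := by
  have : weightedHomogeneousComponent w d p = p := by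
    apply hinj
    rw [← weightedHomogeneousComponent_aeval hg, hp.weightedHomogeneousComponent_same]
  exact this ▸ weightedHomogeneousComponent_isWeightedHomogeneous d p

end GradedHom

/-- Substitution of `Q` for `w` in a polynomial in the variables `z` and `w`. -/
noncomputable abbrev substRight (Q : MvPolynomial (σ ⊕ τ) K) :
    MvPolynomial (σ ⊕ Unit) K →ₐ[K] MvPolynomial (σ ⊕ τ) K :=
  aeval (Sum.elim (fun j => X (Sum.inl j)) fun _ => Q)

theorem pderiv_inr_substRight (Q : MvPolynomial (σ ⊕ τ) K) (i : τ)
    (H : MvPolynomial (σ ⊕ Unit) K) :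
    pderiv (Sum.inr i) (substRight Q H) =
      substRight Q (pderiv (Sum.inr ()) H) * pderiv (Sum.inr i) Q := by
  classical
  induction H using MvPolynomial.induction_on with
  | C a => simp [algebraMap_eq]
  | add p q hp hq => simp only [map_add, hp, hq, add_mul]
  | mul_X p j hp =>
    rw [map_mul, Derivation.leibniz, hp, Derivation.leibniz]
    rcases j with j | _
    · simp [pderiv_X]
      ring
    · simp [pderiv_X]
      ring

theorem exists_substRight_eq_of_pderiv_eq_zero [CharZero K] (Q : MvPolynomial (σ ⊕ τ) K)
    {f : MvPolynomial (σ ⊕ τ) K} (h : ∀ i, pderiv (Sum.inr i) f = 0) :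
    ∃ F, substRight Q F = f := by
  obtain ⟨q, rfl⟩ := exists_rename_eq_of_vars_subset_range f (Sum.inl : σ → σ ⊕ τ)
    Sum.inl_injective (by
      rintro (j | i) hx
      · exact ⟨j, rfl⟩
      · exact absurd hx (notMem_vars_of_pderiv_eq_zero (h i)))
  refine ⟨rename Sum.inl q, ?_⟩
  rw [substRight, aeval_rename, rename_eq_aeval]
  rfl

theorem pderiv_comm (i j : σ) (p : MvPolynomial σ K) :
    pderiv i (pderiv j p) = pderiv j (pderiv i p) := by
  classical
  ext m
  simp only [coeff_pderiv, Finsupp.add_apply, Finsupp.single_apply]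
  rw [add_right_comm]
  by_cases h : i = j
  · subst h; ring
  · simp [h, Ne.symm h]
    ring

theorem totalDegree_pderiv_lt {i : σ} {p : MvPolynomial σ K} (h : pderiv i p ≠ 0) :
    (pderiv i p).totalDegree < p.totalDegree := by
  have hmem : ∀ m ∈ (pderiv i p).support, (m.sum fun _ k => k) < p.totalDegree := by
    intro m hm
    rw [mem_support_iff, coeff_pderiv] at hm
    have := le_totalDegree (mem_support_iff.mpr (left_ne_zero_of_mul hm))
    rw [Finsupp.sum_add_index' (fun _ => rfl) (fun _ _ _ => rfl),
      Finsupp.sum_single_index rfl] at this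
    omega
  obtain ⟨m, hm⟩ := support_nonempty.mpr h
  exact (Finset.sup_lt_iff (bot_le.trans_lt (hmem m hm))).mpr hmem

theorem pderiv_inr_rename_inl (i : τ) (p : MvPolynomial σ K) :
    pderiv (Sum.inr i) (rename (Sum.inl : σ → σ ⊕ τ) p) = 0 := by
  classical
  apply pderiv_eq_zero_of_notMem_vars
  intro h
  simpa using vars_rename _ p h

/-- A polynomial annihilated by the vector field `(∂Q/∂ζ₂) ∂/∂ζ₁ - (∂Q/∂ζ₁) ∂/∂ζ₂` is a polynomial
in `z` and `Q`, when `∂Q/∂ζ₁` and `∂Q/∂ζ₂` depend on `z` only, `∂Q/∂ζ₁` is prime and does not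
divide `∂Q/∂ζ₂`. -/
theorem exists_substRight_eq_of_pderiv_mul_eq [CharZero K] {Q : MvPolynomial (σ ⊕ Fin 2) K}
    {a b : MvPolynomial σ K}
    (hQa : pderiv (Sum.inr 0) Q = rename Sum.inl a)
    (hQb : pderiv (Sum.inr 1) Q = rename Sum.inl b)
    (hprime : Prime (rename Sum.inl a : MvPolynomial (σ ⊕ Fin 2) K))
    (hab : ¬ (rename Sum.inl a : MvPolynomial (σ ⊕ Fin 2) K) ∣ rename Sum.inl b)
    (f : MvPolynomial (σ ⊕ Fin 2) K)
    (hCR : pderiv (Sum.inr 1) Q * pderiv (Sum.inr 0) f =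
      pderiv (Sum.inr 0) Q * pderiv (Sum.inr 1) f) :
    ∃ F, substRight Q F = f := by
  rw [hQa, hQb] at hCR
  induction hn : f.totalDegree using Nat.strong_induction_on generalizing f with
  | _ n ih =>
    obtain ⟨g, hg0⟩ := (hprime.dvd_or_dvd (Dvd.intro _ hCR.symm)).resolve_left hab
    have hg1 : pderiv (Sum.inr 1) f = rename Sum.inl b * g := by
      apply mul_left_cancel₀ hprime.ne_zero
      rw [← hCR, hg0]
      ring
    have hG : ∃ G, substRight Q G = g := by
      by_cases hg : g = 0
      · exact ⟨0, by rw [hg, map_zero]⟩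
      have hne : pderiv (Sum.inr 0) f ≠ 0 := hg0 ▸ mul_ne_zero hprime.ne_zero hg
      refine ih g.totalDegree ?_ g ?_ rfl
      · have hlt := totalDegree_pderiv_lt hne
        rw [hg0, totalDegree_mul_of_isDomain hprime.ne_zero hg] at hlt
        omega
      · have hcomm := pderiv_comm (Sum.inr 0) (Sum.inr 1) f
        simpa [hg0, hg1, Derivation.leibniz, pderiv_inr_rename_inl] using hcomm
    obtain ⟨G, rfl⟩ := hG
    obtain ⟨H, rfl⟩ := exists_pderiv_eq (Sum.inr ()) G
    obtain ⟨R, hR⟩ := exists_substRight_eq_of_pderiv_eq_zero Q (f := f - substRight Q H) (by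
      intro i
      rw [map_sub, pderiv_inr_substRight, sub_eq_zero]
      fin_cases i
      · simp only [Fin.zero_eta, hg0, hQa, mul_comm]
      · simp only [Fin.mk_one, hg1, hQb, mul_comm])
    exact ⟨R + H, by rw [map_add, hR, sub_add_cancel]⟩

theorem substRight_injective [Infinite K] {Q : MvPolynomial (σ ⊕ τ) K} {a : MvPolynomial σ K}
    (ha : a ≠ 0)
    (hsolve : ∀ x, eval x a ≠ 0 → ∀ t : K, ∃ y : τ → K, eval (Sum.elim x y) Q = t) :
    Function.Injective (substRight Q) := by
  rw [injective_iff_map_eq_zero]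
  intro G hG
  have hmul : rename Sum.inl a * G = 0 := by
    refine MvPolynomial.funext fun x => ?_
    rw [map_mul, map_zero, eval_rename]
    by_cases hx : eval (x ∘ Sum.inl) a = 0
    · rw [hx, zero_mul]
    obtain ⟨y, hy⟩ := hsolve _ hx (x (Sum.inr ()))
    have h := congrArg (eval (Sum.elim (x ∘ Sum.inl) y)) hG
    rw [map_zero, substRight, aeval_def, algebraMap_eq, eval_eval₂] at h
    have hpoint : (fun s => eval (Sum.elim (x ∘ Sum.inl) y)
        ((Sum.elim (fun j => X (Sum.inl j)) fun _ => Q :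
          σ ⊕ Unit → MvPolynomial (σ ⊕ τ) K) s)) = x := by
      funext s
      rcases s with j | _
      · simp
      · simpa using hy
    have hid : (eval (Sum.elim (x ∘ Sum.inl) y)).comp C = RingHom.id K := by ext; simp
    rw [hpoint, hid, eval₂_id] at h
    rw [h, mul_zero]
  refine (mul_eq_zero.mp hmul).resolve_left fun h => ha ?_
  exact rename_injective _ Sum.inl_injective (h.trans (map_zero _).symm)

end MvPolynomial

/-- **Lemma 4.6:** the case `n = 2`, `B = 0` of the polynomial extension theorem,
where the rank condition becomes invertibility of `A` (rank 2).
Variables: `Sum.inl j` is `z_{j+1}`, `Sum.inr i` is `ζ_{i+1}`; in the ring for `F`,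
`Sum.inl j` is `z_{j+1}` and `Sum.inr ()` is `w`.  The CR condition is
`(∂Q/∂ζ₂)(∂f/∂ζ₁) = (∂Q/∂ζ₁)(∂f/∂ζ₂)`. -/
theorem stmt_9 (A C : Matrix (Fin 2) (Fin 2) ℂ) (hC : C.IsSymm)
    (hA : IsUnit A)
    (Q : MvPolynomial (Fin 2 ⊕ Fin 2) ℂ)
    (hQ : Q = (∑ i, ∑ j, MvPolynomial.C (A i j) * X (Sum.inr i) * X (Sum.inl j)) +
              (∑ i, ∑ j, MvPolynomial.C (C i j) * X (Sum.inl i) * X (Sum.inl j)))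
    (f : MvPolynomial (Fin 2 ⊕ Fin 2) ℂ)
    (hCR : pderiv (Sum.inr 1) Q * pderiv (Sum.inr 0) f =
        pderiv (Sum.inr 0) Q * pderiv (Sum.inr 1) f) :
    ∃ F : MvPolynomial (Fin 2 ⊕ Unit) ℂ,
      aeval (Sum.elim (fun j => (X (Sum.inl j) : MvPolynomial (Fin 2 ⊕ Fin 2) ℂ))
        (fun _ => Q)) F = f ∧
      (∀ G : MvPolynomial (Fin 2 ⊕ Unit) ℂ,
        aeval (Sum.elim (fun j => (X (Sum.inl j) : MvPolynomial (Fin 2 ⊕ Fin 2) ℂ))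
          (fun _ => Q)) G = f → G = F) ∧
      F.weightedTotalDegree (Sum.elim (fun _ : Fin 2 => 1) (fun _ : Unit => 2)) =
        f.totalDegree ∧
      ∀ d : ℕ, f.IsHomogeneous d →
        F.IsWeightedHomogeneous (Sum.elim (fun _ : Fin 2 => 1) (fun _ : Unit => 2)) d := by
  classical
  set L : Fin 2 → MvPolynomial (Fin 2) ℂ := fun i => ∑ j, MvPolynomial.C (A i j) * X j with hL
  have hQL (i : Fin 2) : pderiv (Sum.inr i) Q = rename Sum.inl (L i) := by
    fin_cases i <;>
      simp [hQ, hL, Derivation.leibniz, pderiv_X, Fin.sum_univ_two] <;> ring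
  have heval (x : Fin 2 → ℂ) (i : Fin 2) : eval x (L i) = (A *ᵥ x) i := by
    simp [hL, Matrix.mulVec, dotProduct]
  have hsurj (v : Fin 2 → ℂ) : ∃ x, A *ᵥ x = v :=
    (Matrix.mulVec_surjective_iff_isUnit.mpr hA) v
  obtain ⟨x₀, hx₀⟩ := hsurj ![1, 0]
  obtain ⟨x₁, hx₁⟩ := hsurj ![0, 1]
  have hL0 : L 0 ≠ 0 := fun h => by simpa [hx₀, h] using heval x₀ 0
  have hinl : Function.Injective (rename Sum.inl :
      MvPolynomial (Fin 2) ℂ →ₐ[ℂ] MvPolynomial (Fin 2 ⊕ Fin 2) ℂ) :=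
    rename_injective _ Sum.inl_injective
  have hprime : Prime (rename Sum.inl (L 0) : MvPolynomial (Fin 2 ⊕ Fin 2) ℂ) := by
    refine (IsHomogeneous.irreducible_of_one (IsHomogeneous.rename_isHomogeneous ?_)
      ((map_ne_zero_iff _ hinl).mpr hL0)).prime
    exact IsHomogeneous.sum _ _ _ fun j _ => (isHomogeneous_X _ j).C_mul _
  have hndvd : ¬ (rename Sum.inl (L 0) : MvPolynomial (Fin 2 ⊕ Fin 2) ℂ) ∣
      rename Sum.inl (L 1) := by
    rintro ⟨c, hc⟩
    have h := congrArg (eval (Sum.elim x₁ 0)) hc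
    simp [eval_rename, heval, hx₁] at h
  have hinj : Function.Injective (substRight Q) := by
    refine substRight_injective hL0 fun x hx t => ?_
    obtain ⟨y, hy⟩ : ∃ y, y * eval x (L 0) = t - ∑ i, ∑ j, C i j * x i * x j :=
      ⟨_, div_mul_cancel₀ _ hx⟩
    refine ⟨![y, 0], ?_⟩
    simp only [heval, Matrix.mulVec, dotProduct, Fin.sum_univ_two] at hy
    simp [hQ, Fin.sum_univ_two]
    linear_combination hy
  have hQhom : Q.IsHomogeneous 2 := by
    rw [hQ]
    refine .add ?_ ?_ <;>
      exact .sum _ _ _ fun i _ => .sum _ _ _ fun j _ =>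
        ((isHomogeneous_X _ _).C_mul _).mul (isHomogeneous_X _ _)
  have hgrade (s : Fin 2 ⊕ Unit) :
      (Sum.elim (fun j => (X (Sum.inl j) : MvPolynomial (Fin 2 ⊕ Fin 2) ℂ)) (fun _ => Q)
        s).IsWeightedHomogeneous 1
        (Sum.elim (fun _ : Fin 2 => 1) (fun _ : Unit => 2) s) := by
    rcases s with j | _
    · exact isHomogeneous_X _ _
    · exact hQhom
  obtain ⟨F, rfl⟩ := exists_substRight_eq_of_pderiv_mul_eq (hQL 0) (hQL 1) hprime hndvd f hCR
  refine ⟨F, rfl, fun G hG => hinj hG, ?_, fun d hd => ?_⟩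
  · rw [← weightedTotalDegree_one]
    exact (weightedTotalDegree_aeval_of_injective hgrade hinj F).symm
  · exact IsWeightedHomogeneous.of_aeval_of_injective hgrade hinj hd
end

section
/- Let β, δ ∈ ℂ with δ ≠ 0, and let L be the derivation on ℂ[z₁,z₂,ζ₁,ζ₂] given by L = δ z₂ ∂/∂ζ₁ − (z₁ + βz₂) ∂/∂ζ₂. Then for every integer d ≥ 0, the ℂ-vector space of homogeneous polynomials f ∈ ℂ[z₁,z₂,ζ₁,ζ₂] of total degree d satisfying Lf = 0 has dimension ⌊(d+2)²/4⌋. -/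
open MvPolynomial

/-- The derivation `p ∂/∂ζ₁ − q ∂/∂ζ₂` of `R[z₁, z₂, ζ₁, ζ₂]`. -/
noncomputable def crDerivation {R : Type*} [CommRing R] (p q : MvPolynomial (Fin 2 ⊕ Fin 2) R) :
    Derivation R (MvPolynomial (Fin 2 ⊕ Fin 2) R) (MvPolynomial (Fin 2 ⊕ Fin 2) R) :=
  p • pderiv (Sum.inr 0) - q • pderiv (Sum.inr 1)

theorem crDerivation_apply {R : Type*} [CommRing R] (p q f : MvPolynomial (Fin 2 ⊕ Fin 2) R) :
    crDerivation p q f = p * pderiv (Sum.inr 0) f - q * pderiv (Sum.inr 1) f := rfl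

/-- The exponent of the monomial `z₁ⁿ z₂ᵐ ζ₁ⁱ ζ₂ʲ`. -/
noncomputable def quadExponent (n m i j : ℕ) : (Fin 2 ⊕ Fin 2) →₀ ℕ :=
  Finsupp.equivFunOnFinite.symm (Sum.elim ![n, m] ![i, j])

@[simp]
theorem quadExponent_inl_zero (n m i j : ℕ) : quadExponent n m i j (Sum.inl 0) = n := rfl

@[simp]
theorem quadExponent_inl_one (n m i j : ℕ) : quadExponent n m i j (Sum.inl 1) = m := rfl

@[simp]
theorem quadExponent_inr_zero (n m i j : ℕ) : quadExponent n m i j (Sum.inr 0) = i := rfl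

@[simp]
theorem quadExponent_inr_one (n m i j : ℕ) : quadExponent n m i j (Sum.inr 1) = j := rfl

theorem eq_quadExponent (s : (Fin 2 ⊕ Fin 2) →₀ ℕ) :
    s = quadExponent (s (Sum.inl 0)) (s (Sum.inl 1)) (s (Sum.inr 0)) (s (Sum.inr 1)) := by
  ext x
  rcases x with x | x <;> fin_cases x <;> simp

theorem quadExponent_inj {n m i j n' m' i' j' : ℕ} :
    quadExponent n m i j = quadExponent n' m' i' j' ↔ n = n' ∧ m = m' ∧ i = i' ∧ j = j' := by
  constructor
  · intro h
    exact ⟨DFunLike.congr_fun h (Sum.inl 0), DFunLike.congr_fun h (Sum.inl 1),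
      DFunLike.congr_fun h (Sum.inr 0), DFunLike.congr_fun h (Sum.inr 1)⟩
  · rintro ⟨rfl, rfl, rfl, rfl⟩
    rfl

theorem degree_quadExponent (n m i j : ℕ) : (quadExponent n m i j).degree = n + m + i + j := by
  simp [Finsupp.degree_eq_sum, Fin.sum_univ_two, add_assoc]

theorem quadExponent_add_single_inl_zero (n m i j : ℕ) :
    quadExponent n m i j + Finsupp.single (Sum.inl 0) 1 = quadExponent (n + 1) m i j := by
  rw [eq_quadExponent (_ + _)]; simp

theorem quadExponent_add_single_inl_one (n m i j : ℕ) :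
    quadExponent n m i j + Finsupp.single (Sum.inl 1) 1 = quadExponent n (m + 1) i j := by
  rw [eq_quadExponent (_ + _)]; simp

theorem quadExponent_add_single_inr_zero (n m i j : ℕ) :
    quadExponent n m i j + Finsupp.single (Sum.inr 0) 1 = quadExponent n m (i + 1) j := by
  rw [eq_quadExponent (_ + _)]; simp

theorem quadExponent_add_single_inr_one (n m i j : ℕ) :
    quadExponent n m i j + Finsupp.single (Sum.inr 1) 1 = quadExponent n m i (j + 1) := by
  rw [eq_quadExponent (_ + _)]; simp

theorem monomial_quadExponent {R : Type*} [CommSemiring R] (n m i j : ℕ) :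
    monomial (quadExponent n m i j) (1 : R) =
      X (Sum.inl 0) ^ n * X (Sum.inl 1) ^ m * X (Sum.inr 0) ^ i * X (Sum.inr 1) ^ j := by
  rw [monomial_eq, Finsupp.prod_fintype _ _ (by simp)]
  simp [Fin.prod_univ_two, mul_assoc]

theorem coeff_X_inl_zero_mul {R : Type*} [CommSemiring R] (n m i j : ℕ)
    (f : MvPolynomial (Fin 2 ⊕ Fin 2) R) :
    coeff (quadExponent (n + 1) m i j) (X (Sum.inl 0) * f) = coeff (quadExponent n m i j) f := by
  rw [← quadExponent_add_single_inl_zero, add_comm, coeff_X_mul]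

theorem coeff_X_inl_one_mul {R : Type*} [CommSemiring R] (n m i j : ℕ)
    (f : MvPolynomial (Fin 2 ⊕ Fin 2) R) :
    coeff (quadExponent n (m + 1) i j) (X (Sum.inl 1) * f) = coeff (quadExponent n m i j) f := by
  rw [← quadExponent_add_single_inl_one, add_comm, coeff_X_mul]

section Coefficients

variable {R : Type*} [CommRing R] {f : MvPolynomial (Fin 2 ⊕ Fin 2) R}

theorem coeff_recursion_of_crDerivation_eq_zero
    (hf : crDerivation (X (Sum.inl 1)) (X (Sum.inl 0)) f = 0) (n m i j : ℕ) :
    coeff (quadExponent (n + 1) m (i + 1) j) f * (i + 1) =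
      coeff (quadExponent n (m + 1) i (j + 1)) f * (j + 1) := by
  have h := congrArg (coeff (quadExponent (n + 1) (m + 1) i j)) hf
  rw [crDerivation_apply, coeff_sub, coeff_X_inl_one_mul, coeff_X_inl_zero_mul, coeff_pderiv,
    coeff_pderiv, quadExponent_add_single_inr_zero, quadExponent_add_single_inr_one] at h
  simpa [sub_eq_zero] using h

theorem coeff_eq_zero_of_crDerivation_eq_zero_of_inl_one [NoZeroDivisors R] [CharZero R]
    (hf : crDerivation (X (Sum.inl 1)) (X (Sum.inl 0)) f = 0) (n i j : ℕ) :
    coeff (quadExponent n 0 i (j + 1)) f = 0 := by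
  have h := congrArg (coeff (quadExponent (n + 1) 0 i j)) hf
  rw [crDerivation_apply, coeff_sub, coeff_X_mul', if_neg (by simp), coeff_X_inl_zero_mul,
    coeff_pderiv, quadExponent_add_single_inr_one] at h
  simpa [Nat.cast_add_one_ne_zero] using h

theorem coeff_eq_zero_of_crDerivation_eq_zero_of_inl_zero [NoZeroDivisors R] [CharZero R]
    (hf : crDerivation (X (Sum.inl 1)) (X (Sum.inl 0)) f = 0) (m i j : ℕ) :
    coeff (quadExponent 0 m (i + 1) j) f = 0 := by
  have h := congrArg (coeff (quadExponent 0 (m + 1) i j)) hf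
  rw [crDerivation_apply, coeff_sub, coeff_X_mul' _ (Sum.inl 0), if_neg (by simp),
    coeff_X_inl_one_mul, coeff_pderiv, quadExponent_add_single_inr_zero] at h
  simpa [Nat.cast_add_one_ne_zero] using h

theorem coeff_eq_zero_of_crDerivation_eq_zero_of_lt [NoZeroDivisors R] [CharZero R]
    (hf : crDerivation (X (Sum.inl 1)) (X (Sum.inl 0)) f = 0) (n : ℕ) :
    ∀ m i j, n < i → coeff (quadExponent n m i j) f = 0 := by
  induction n with
  | zero =>
    rintro m (_ | i) j h
    · omega
    · exact coeff_eq_zero_of_crDerivation_eq_zero_of_inl_zero hf m i j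
  | succ n ih =>
    rintro m (_ | i) j h
    · omega
    · have hr := coeff_recursion_of_crDerivation_eq_zero hf n m i j
      rw [ih _ _ _ (by omega), zero_mul] at hr
      exact (mul_eq_zero.mp hr).resolve_right (Nat.cast_add_one_ne_zero i)

theorem eq_zero_of_crDerivation_eq_zero_of_coeff [NoZeroDivisors R] [CharZero R]
    (hf : crDerivation (X (Sum.inl 1)) (X (Sum.inl 0)) f = 0)
    (h : ∀ n m i, i ≤ n → coeff (quadExponent n m i 0) f = 0) : f = 0 := by
  have key : ∀ j n m i, coeff (quadExponent n m i j) f = 0 := by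
    intro j
    induction j with
    | zero =>
      intro n m i
      rcases lt_or_ge n i with hi | hi
      · exact coeff_eq_zero_of_crDerivation_eq_zero_of_lt hf n m i 0 hi
      · exact h n m i hi
    | succ j ih =>
      rintro n (_ | m) i
      · exact coeff_eq_zero_of_crDerivation_eq_zero_of_inl_one hf n i j
      · have hr := coeff_recursion_of_crDerivation_eq_zero hf n m i j
        rw [ih, zero_mul] at hr
        exact (mul_eq_zero.mp hr.symm).resolve_right (Nat.cast_add_one_ne_zero j)
  ext s
  rw [eq_quadExponent s, key, coeff_zero]

end Coefficients

/-- The product of `z₁ⁿ z₂ᵐ` with the `k`-th power of the invariant `z₁ζ₁ + z₂ζ₂`. -/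
noncomputable def crMonomial (R : Type*) [CommRing R] (n m k : ℕ) :
    MvPolynomial (Fin 2 ⊕ Fin 2) R :=
  X (Sum.inl 0) ^ n * X (Sum.inl 1) ^ m *
    (X (Sum.inl 0) * X (Sum.inr 0) + X (Sum.inl 1) * X (Sum.inr 1)) ^ k

theorem crDerivation_crMonomial {R : Type*} [CommRing R] (n m k : ℕ) :
    crDerivation (X (Sum.inl 1)) (X (Sum.inl 0)) (crMonomial R n m k) = 0 := by
  have h (j : Fin 2) : crDerivation (X (Sum.inl 1)) (X (Sum.inl 0))
      (X (Sum.inl j) : MvPolynomial (Fin 2 ⊕ Fin 2) R) = 0 := by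
    simp [crDerivation_apply]
  have hM : crDerivation (X (Sum.inl 1)) (X (Sum.inl 0))
      (X (Sum.inl 0) * X (Sum.inr 0) + X (Sum.inl 1) * X (Sum.inr 1) :
        MvPolynomial (Fin 2 ⊕ Fin 2) R) = 0 := by
    simp [crDerivation_apply, Derivation.leibniz]
    ring
  simp [crMonomial, Derivation.leibniz, Derivation.leibniz_pow, h, hM]

theorem isHomogeneous_crMonomial {R : Type*} [CommRing R] (n m k : ℕ) :
    (crMonomial R n m k).IsHomogeneous (n + m + 2 * k) :=
  ((isHomogeneous_X_pow _ n).mul (isHomogeneous_X_pow _ m)).mul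
    ((((isHomogeneous_X R _).mul (isHomogeneous_X R _)).add
      ((isHomogeneous_X R _).mul (isHomogeneous_X R _))).pow k)

theorem coeff_crMonomial {R : Type*} [CommRing R] (n m k n' m' i : ℕ) :
    coeff (quadExponent n' m' i 0) (crMonomial R n m k) =
      if n + k = n' ∧ m = m' ∧ k = i then 1 else 0 := by
  have hdvd := sub_dvd_pow_sub_pow
    (X (Sum.inl 0) * X (Sum.inr 0) + X (Sum.inl 1) * X (Sum.inr 1) :
      MvPolynomial (Fin 2 ⊕ Fin 2) R) (X (Sum.inl 0) * X (Sum.inr 0)) k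
  obtain ⟨q, hq⟩ := hdvd
  have h : crMonomial R n m k = monomial (quadExponent (n + k) m k 0) 1 +
      X (Sum.inr 1) * (X (Sum.inl 0) ^ n * X (Sum.inl 1) ^ m * X (Sum.inl 1) * q) := by
    rw [crMonomial, sub_eq_iff_eq_add.mp hq, monomial_quadExponent]
    ring
  rw [h, coeff_add, coeff_X_mul', coeff_monomial]
  simp [quadExponent_inj]

/-- The homogeneous polynomials of degree `d` killed by `p ∂/∂ζ₁ − q ∂/∂ζ₂`. -/
noncomputable def crKernel {R : Type*} [CommRing R] (p q : MvPolynomial (Fin 2 ⊕ Fin 2) R)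
    (d : ℕ) : Submodule R (MvPolynomial (Fin 2 ⊕ Fin 2) R) :=
  homogeneousSubmodule (Fin 2 ⊕ Fin 2) R d ⊓ LinearMap.ker (crDerivation p q).toLinearMap

theorem mem_crKernel {R : Type*} [CommRing R] {p q f : MvPolynomial (Fin 2 ⊕ Fin 2) R} {d : ℕ} :
    f ∈ crKernel p q d ↔ f.IsHomogeneous d ∧ crDerivation p q f = 0 := Iff.rfl

/-- Evaluation of the coefficients of `z₁^(d-k-m) z₂^m ζ₁^k` with `2k + m ≤ d`. -/
noncomputable def crCoeffs (R : Type*) [CommRing R] (d : ℕ) :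
    crKernel (X (Sum.inl 1) : MvPolynomial (Fin 2 ⊕ Fin 2) R) (X (Sum.inl 0)) d →ₗ[R]
      ((Σ k : Fin (d / 2 + 1), Fin (d - 2 * k + 1)) → R) :=
  LinearMap.pi fun t => (lcoeff R (quadExponent (d - t.1 - t.2) t.2 t.1 0)).comp
    (crKernel _ _ d).subtype

theorem crCoeffs_injective (R : Type*) [CommRing R] [NoZeroDivisors R] [CharZero R] (d : ℕ) :
    Function.Injective (crCoeffs R d) := by
  rw [injective_iff_map_eq_zero]
  rintro ⟨f, hf⟩ h
  obtain ⟨hd, hL⟩ := mem_crKernel.mp hf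
  refine Subtype.ext (eq_zero_of_crDerivation_eq_zero_of_coeff hL fun n m i hi => ?_)
  by_cases hdeg : n + m + i = d
  · have hc : coeff (quadExponent (d - i - m) m i 0) f = 0 :=
      congrFun h ⟨⟨i, by omega⟩, ⟨m, by dsimp only; omega⟩⟩
    rwa [show d - i - m = n by omega] at hc
  · exact hd.coeff_eq_zero (by rwa [degree_quadExponent])

theorem crCoeffs_surjective (R : Type*) [CommRing R] (d : ℕ) :
    Function.Surjective (crCoeffs R d) := by
  classical
  intro g
  have hmem (t : Σ k : Fin (d / 2 + 1), Fin (d - 2 * k + 1)) :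
      crMonomial R (d - 2 * t.1 - t.2) t.2 t.1 ∈ crKernel (X (Sum.inl 1)) (X (Sum.inl 0)) d := by
    have h := isHomogeneous_crMonomial (R := R) (d - 2 * t.1 - t.2) t.2 t.1
    rw [show d - 2 * t.1 - t.2 + t.2 + 2 * t.1 = d by omega] at h
    exact mem_crKernel.mpr ⟨h, crDerivation_crMonomial _ _ _⟩
  refine ⟨∑ t, g t • ⟨_, hmem t⟩, ?_⟩
  funext s
  rw [map_sum, Finset.sum_apply, Finset.sum_eq_single s]
  · have := s.1.2
    have := s.2.2
    simp [crCoeffs, coeff_crMonomial]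
    omega
  · intro t _ hts
    have : ¬ ((t.2 : ℕ) = s.2 ∧ (t.1 : ℕ) = s.1) := by
      rintro ⟨h2, h1⟩
      exact hts (Sigma.ext (Fin.ext h1) ((Fin.heq_ext_iff (by rw [h1])).mpr h2))
    simp only [map_smul, Pi.smul_apply, smul_eq_mul]
    refine mul_eq_zero_of_right _ ((coeff_crMonomial _ _ _ _ _ _).trans (if_neg fun h => this h.2))
  · simp

theorem sum_range_sub_two_mul_add_one (d : ℕ) :
    ∑ k ∈ Finset.range (d / 2 + 1), (d - 2 * k + 1) = (d + 2) ^ 2 / 4 := by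
  induction d using Nat.twoStepInduction with
  | zero => rfl
  | one => rfl
  | more d ih _ =>
    rw [show (d + 2) / 2 = d / 2 + 1 by omega, Finset.sum_range_succ']
    simp only [show ∀ k, d + 2 - 2 * (k + 1) = d - 2 * k by intro k; omega]
    rw [ih, show (d + 2 + 2) ^ 2 = (d + 2) ^ 2 + (d + 3) * 4 by ring,
      Nat.add_mul_div_right _ _ (by norm_num)]
    omega

theorem finrank_crKernel_X (K : Type*) [Field K] [CharZero K] (d : ℕ) :
    Module.finrank K (crKernel (X (Sum.inl 1) : MvPolynomial (Fin 2 ⊕ Fin 2) K)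
      (X (Sum.inl 0)) d) = (d + 2) ^ 2 / 4 := by
  rw [(LinearEquiv.ofBijective _ ⟨crCoeffs_injective K d, crCoeffs_surjective K d⟩).finrank_eq,
    Module.finrank_fintype_fun_eq_card, Fintype.card_sigma]
  simp only [Fintype.card_fin]
  rw [Fin.sum_univ_eq_sum_range (fun k => d - 2 * k + 1), sum_range_sub_two_mul_add_one]

/-- The substitution of `p, q` for `z₁, z₂`. -/
noncomputable def zSubst {R : Type*} [CommRing R] (p q : MvPolynomial (Fin 2 ⊕ Fin 2) R) :
    MvPolynomial (Fin 2 ⊕ Fin 2) R →ₐ[R] MvPolynomial (Fin 2 ⊕ Fin 2) R :=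
  aeval (Sum.elim ![p, q] fun i => X (Sum.inr i))

theorem crDerivation_zSubst {R : Type*} [CommRing R] {p q : MvPolynomial (Fin 2 ⊕ Fin 2) R}
    (hp : crDerivation q p p = 0) (hq : crDerivation q p q = 0)
    (f : MvPolynomial (Fin 2 ⊕ Fin 2) R) :
    crDerivation q p (zSubst p q f) =
      zSubst p q (crDerivation (X (Sum.inl 1)) (X (Sum.inl 0)) f) := by
  induction f using MvPolynomial.induction_on with
  | C a => simp [zSubst, ← algebraMap_eq]
  | add f g hf hg => simp only [map_add, hf, hg]
  | mul_X f i hf =>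
    have h : crDerivation q p (zSubst p q (X i)) =
        zSubst p q (crDerivation (X (Sum.inl 1)) (X (Sum.inl 0)) (X i)) := by
      rcases i with i | i <;> fin_cases i
      · simpa [zSubst, crDerivation_apply] using hp
      · simpa [zSubst, crDerivation_apply] using hq
      · simp [zSubst, crDerivation_apply]
      · simp [zSubst, crDerivation_apply]
    simp only [map_mul, Derivation.leibniz, smul_eq_mul, map_add, hf, h]

theorem isHomogeneous_zSubst {R : Type*} [CommRing R] {p q f : MvPolynomial (Fin 2 ⊕ Fin 2) R}
    (hp : p.IsHomogeneous 1) (hq : q.IsHomogeneous 1) {d : ℕ} (hf : f.IsHomogeneous d) :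
    (zSubst p q f).IsHomogeneous d := by
  have := hf.aeval (Sum.elim ![p, q] fun i => X (Sum.inr i)) (n := 1) (by
    rintro (i | i)
    · fin_cases i
      exacts [hp, hq]
    · exact isHomogeneous_X _ _)
  rwa [one_mul] at this

/-- The linear change of variables `z₁ ↦ z₁ + βz₂`, `z₂ ↦ δz₂`. -/
noncomputable def zEquiv {K : Type*} [Field K] (β : K) {δ : K} (hδ : δ ≠ 0) :
    MvPolynomial (Fin 2 ⊕ Fin 2) K ≃ₐ[K] MvPolynomial (Fin 2 ⊕ Fin 2) K :=
  have h : (C δ * C δ⁻¹ : MvPolynomial (Fin 2 ⊕ Fin 2) K) = 1 := by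
    rw [← C_mul, mul_inv_cancel₀ hδ, C_1]
  AlgEquiv.ofAlgHom (zSubst (X (Sum.inl 0) + C β * X (Sum.inl 1)) (C δ * X (Sum.inl 1)))
    (zSubst (X (Sum.inl 0) - C (β * δ⁻¹) * X (Sum.inl 1)) (C δ⁻¹ * X (Sum.inl 1)))
    (by
      ext1 i
      rcases i with i | i <;> fin_cases i <;> simp [zSubst, algebraMap_eq]
      · linear_combination (-C β * X (Sum.inl 1)) * h
      · linear_combination X (Sum.inl 1) * h)
    (by
      ext1 i
      rcases i with i | i <;> fin_cases i <;> simp [zSubst, algebraMap_eq]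
      · ring
      · linear_combination X (Sum.inl 1) * h)

theorem map_zEquiv_crKernel {K : Type*} [Field K] (β : K) {δ : K} (hδ : δ ≠ 0) (d : ℕ) :
    (crKernel (X (Sum.inl 1)) (X (Sum.inl 0)) d).map (zEquiv β hδ).toLinearMap =
      crKernel (C δ * X (Sum.inl 1)) (X (Sum.inl 0) + C β * X (Sum.inl 1)) d := by
  have hL (f) : crDerivation (C δ * X (Sum.inl 1)) (X (Sum.inl 0) + C β * X (Sum.inl 1))
      (zEquiv β hδ f) =
        zEquiv β hδ (crDerivation (X (Sum.inl 1)) (X (Sum.inl 0)) f) :=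
    crDerivation_zSubst (by simp [crDerivation_apply])
      (by simp [crDerivation_apply]) f
  ext f
  rw [Submodule.mem_map]
  constructor
  · rintro ⟨g, hg, rfl⟩
    obtain ⟨hd, h0⟩ := mem_crKernel.mp hg
    refine mem_crKernel.mpr ⟨isHomogeneous_zSubst ?_ (isHomogeneous_C_mul_X _ _) hd,
      (hL g).trans (by rw [h0, map_zero])⟩
    exact (isHomogeneous_X _ _).add (isHomogeneous_C_mul_X _ _)
  · intro hf
    obtain ⟨hd, h0⟩ := mem_crKernel.mp hf
    refine ⟨(zEquiv β hδ).symm f, mem_crKernel.mpr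
      ⟨isHomogeneous_zSubst ?_ (isHomogeneous_C_mul_X _ _) hd, ?_⟩,
      (zEquiv β hδ).apply_symm_apply f⟩
    · exact (isHomogeneous_X _ _).sub (isHomogeneous_C_mul_X _ _)
    · rw [← map_eq_zero_iff _ (zEquiv β hδ).injective, ← hL, AlgEquiv.apply_symm_apply, h0]

/-- **Dimension count in Lemma 4.6:** the space of homogeneous polynomials of
degree `d` in `z₁, z₂, ζ₁, ζ₂` killed by the derivation
`L = δ z₂ ∂/∂ζ₁ − (z₁ + β z₂) ∂/∂ζ₂` has dimension `⌊(d+2)²/4⌋`.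
Variables: `Sum.inl j` is `z_{j+1}`, `Sum.inr i` is `ζ_{i+1}`. -/
theorem stmt_10 (β δ : ℂ) (hδ : δ ≠ 0) (d : ℕ) :
    Module.finrank ℂ
      ↥(MvPolynomial.homogeneousSubmodule (Fin 2 ⊕ Fin 2) ℂ d ⊓
        LinearMap.ker
          ((LinearMap.mulLeft ℂ
              (MvPolynomial.C δ * (X (Sum.inl 1) : MvPolynomial (Fin 2 ⊕ Fin 2) ℂ))).comp
              (pderiv (Sum.inr 0)).toLinearMap -
            (LinearMap.mulLeft ℂ
              ((X (Sum.inl 0) : MvPolynomial (Fin 2 ⊕ Fin 2) ℂ) +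
                MvPolynomial.C β * X (Sum.inl 1))).comp
              (pderiv (Sum.inr 1)).toLinearMap)) = (d + 2) ^ 2 / 4 := by
  change Module.finrank ℂ
    (crKernel (C δ * X (Sum.inl 1)) (X (Sum.inl 0) + C β * X (Sum.inl 1)) d) = _
  rw [← map_zEquiv_crKernel β hδ d, ← finrank_crKernel_X ℂ d]
  exact LinearEquiv.finrank_map_eq (zEquiv β hδ).toLinearEquiv _
end

section
/- For every natural number d, the identity C(d+3, 3) = Σ_{j=1}^{d} 2⌊(j+1)/2⌋(d − j + 1) + ⌊(d+2)²/4⌋ holds, where C(d+3,3) is the binomial coefficient (d+3 choose 3). -/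
theorem sum_Icc_two_mul_half (n : ℕ) :
    ∑ j ∈ Finset.Icc 1 n, 2 * ((j + 1) / 2) = (n + 1) ^ 2 / 2 := by
  induction n with
  | zero => simp
  | succ n ih =>
    rw [Finset.sum_Icc_succ_top (by omega), ih]
    obtain ⟨m, rfl | rfl⟩ := Nat.even_or_odd' n
    · ring_nf
      omega
    · ring_nf
      omega

theorem sum_Icc_mul_sub_succ (f : ℕ → ℕ) (d : ℕ) :
    ∑ j ∈ Finset.Icc 1 (d + 1), f j * (d + 1 - j + 1) =
      (∑ j ∈ Finset.Icc 1 d, f j * (d - j + 1)) + ∑ j ∈ Finset.Icc 1 (d + 1), f j := by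
  rw [Finset.sum_Icc_succ_top (by omega), Finset.sum_Icc_succ_top (by omega), ← add_assoc,
    ← Finset.sum_add_distrib]
  congr 1
  · refine Finset.sum_congr rfl fun j hj => ?_
    rw [Nat.sub_add_comm (Finset.mem_Icc.mp hj).2]
    ring
  · simp

/-- **Counting identity from Lemma 4.6:**
`C(d+3,3) = Σ_{j=1}^{d} 2⌊(j+1)/2⌋(d−j+1) + ⌊(d+2)²/4⌋`. -/
theorem stmt_11 (d : ℕ) :
    Nat.choose (d + 3) 3 =
      (∑ j ∈ Finset.Icc 1 d, 2 * ((j + 1) / 2) * (d - j + 1)) + (d + 2) ^ 2 / 4 := by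
  induction d with
  | zero => simp
  | succ d ih =>
    rw [sum_Icc_mul_sub_succ (fun j => 2 * ((j + 1) / 2)), sum_Icc_two_mul_half,
      show d + 1 + 3 = (d + 3) + 1 by ring, Nat.choose_succ_succ' (d + 3) 2, ih,
      Nat.choose_two_right, show d + 3 - 1 = d + 2 by omega]
    obtain ⟨m, rfl | rfl⟩ := Nat.even_or_odd' d
    · ring_nf
      omega
    · ring_nf
      omega
end

section
/- Let n ≥ 2 and let M ⊂ ℂ^{n+1} be given by w = ρ(z,z̄) = ‖z‖⁴ = (|z₁|² + ⋯ + |zₙ|²)². The function f(z,z̄) = ‖z‖² = |z₁|² + ⋯ + |zₙ|² satisfies ρ_{z̄_ℓ} ∂f/∂z̄_k − ρ_{z̄_k} ∂f/∂z̄_ℓ = 0 for all 1 ≤ k,ℓ ≤ n (so f is CR on M), yet there is no holomorphic function F on any neighborhood of 0 ∈ ℂ^{n+1} such that F(z, ‖z‖⁴) = ‖z‖² for all z in a neighborhood of 0 ∈ ℂⁿ. -/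
open Filter Asymptotics Topology

/-- No function analytic at `0` agrees with `|t|²` up to an error of order `o(t²)`. -/
theorem not_analyticAt_sub_normSq_isLittleO {h : ℂ → ℂ} (hh : AnalyticAt ℂ h 0) :
    ¬ (fun t : ℂ => h t - t * star t) =o[𝓝 0] fun t => t ^ 2 := by
  intro ho
  have h0 : h 0 = 0 := by
    have := ho.eventuallyLE.self_of_nhds
    simpa using this
  have dslope_an : ∀ g : ℂ → ℂ, AnalyticAt ℂ g 0 → AnalyticAt ℂ (dslope g 0) 0 := by
    rintro g ⟨p, hp⟩
    exact ⟨_, hp.has_fpower_series_dslope_fslope⟩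
  have hm := dslope_an h hh
  have hk := dslope_an _ hm
  have hdiv : Tendsto (fun t : ℂ => (h t - t * star t) / t ^ 2) (𝓝[≠] 0) (𝓝 0) :=
    ho.tendsto_div_nhds_zero.mono_left nhdsWithin_le_nhds
  have m0 : dslope h 0 0 = 0 := by
    have h1 : Tendsto (dslope h 0) (𝓝[≠] 0) (𝓝 (dslope h 0 0)) :=
      hm.continuousAt.tendsto.mono_left nhdsWithin_le_nhds
    have h2 : Tendsto (fun t : ℂ => (h t - t * star t) / t ^ 2 * t + star t) (𝓝[≠] 0) (𝓝 0) := by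
      have hid : Tendsto (fun t : ℂ => t) (𝓝[≠] 0) (𝓝 0) := tendsto_id.mono_left nhdsWithin_le_nhds
      simpa using (hdiv.mul hid).add hid.star
    refine tendsto_nhds_unique h1 (h2.congr' ?_)
    filter_upwards [self_mem_nhdsWithin] with t ht
    have ht : t ≠ 0 := ht
    rw [dslope_of_ne _ ht, slope_def_field, h0]
    field_simp
    ring
  have hlim : Tendsto (fun t : ℂ => star t / t) (𝓝[≠] 0) (𝓝 (dslope (dslope h 0) 0 0)) := by
    have h1 : Tendsto (dslope (dslope h 0) 0) (𝓝[≠] 0) (𝓝 (dslope (dslope h 0) 0 0)) :=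
      hk.continuousAt.tendsto.mono_left nhdsWithin_le_nhds
    have h2 := h1.sub hdiv
    rw [sub_zero] at h2
    refine h2.congr' ?_
    filter_upwards [self_mem_nhdsWithin] with t ht
    have ht : t ≠ 0 := ht
    rw [dslope_of_ne _ ht, slope_def_field, m0, dslope_of_ne _ ht, slope_def_field, h0]
    field_simp
    ring
  have along : ∀ c : ℂ, c ≠ 0 → star c / c = dslope (dslope h 0) 0 0 := by
    intro c hc
    have hray : Tendsto (fun s : ℝ => (s : ℂ) * c) (𝓝[≠] 0) (𝓝[≠] 0) := by
      refine tendsto_nhdsWithin_iff.2 ⟨?_, ?_⟩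
      · have : Continuous fun s : ℝ => (s : ℂ) * c := by fun_prop
        simpa using (this.tendsto 0).mono_left nhdsWithin_le_nhds
      · filter_upwards [self_mem_nhdsWithin] with s hs
        exact mul_ne_zero (Complex.ofReal_ne_zero.2 hs) hc
    refine tendsto_nhds_unique (tendsto_const_nhds.congr' ?_) (hlim.comp hray)
    filter_upwards [self_mem_nhdsWithin] with s hs
    have hs' : (s : ℂ) ≠ 0 := Complex.ofReal_ne_zero.2 hs
    simp only [Function.comp_apply, Complex.star_def, map_mul, Complex.conj_ofReal]
    rw [mul_div_mul_left _ _ hs']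
  have h1 := along 1 one_ne_zero
  have h2 := along Complex.I Complex.I_ne_zero
  rw [← h1] at h2
  norm_num [neg_div] at h2

/-- **Example 3.1:** on `M = {w = ‖z‖⁴}` the function `f = ‖z‖²` is CR (the
CR vector fields annihilate it; Wirtinger derivatives are computed via the
holomorphic complexifications `ρ(z,ζ) = (Σ zᵢζᵢ)²` and `f(z,ζ) = Σ zᵢζᵢ`
evaluated at `ζ = z̄`), yet `f` is the restriction of no holomorphic function
on any neighborhood of `0 ∈ ℂ^{n+1}`. -/
theorem stmt_15 (n : ℕ) (hn : 2 ≤ n) :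
    (∀ z : Fin n → ℂ, ∀ k ℓ : Fin n,
      fderiv ℂ (fun p : (Fin n → ℂ) × (Fin n → ℂ) => (∑ i, p.1 i * p.2 i) ^ 2)
          (z, star z) (0, Pi.single ℓ 1) *
        fderiv ℂ (fun p : (Fin n → ℂ) × (Fin n → ℂ) => ∑ i, p.1 i * p.2 i)
          (z, star z) (0, Pi.single k 1) -
      fderiv ℂ (fun p : (Fin n → ℂ) × (Fin n → ℂ) => (∑ i, p.1 i * p.2 i) ^ 2)
          (z, star z) (0, Pi.single k 1) *
        fderiv ℂ (fun p : (Fin n → ℂ) × (Fin n → ℂ) => ∑ i, p.1 i * p.2 i)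
          (z, star z) (0, Pi.single ℓ 1) = 0) ∧
    ¬ ∃ F : (Fin n → ℂ) × ℂ → ℂ, AnalyticAt ℂ F 0 ∧
      ∀ᶠ z : Fin n → ℂ in 𝓝 0,
        F (z, (∑ i, z i * star (z i)) ^ 2) = ∑ i, z i * star (z i) := by
  refine ⟨fun z k ℓ => ?_, ?_⟩
  · have hq : DifferentiableAt ℂ
        (fun p : (Fin n → ℂ) × (Fin n → ℂ) => ∑ i, p.1 i * p.2 i) (z, star z) := by
      fun_prop
    rw [fderiv_fun_pow 2 hq]
    simp only [smul_apply, smul_eq_mul]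
    ring
  · rintro ⟨F, hF, hEq⟩
    let i₀ : Fin n := ⟨0, by omega⟩
    let e : ℂ →L[ℂ] (Fin n → ℂ) := ContinuousLinearMap.single ℂ (fun _ => ℂ) i₀
    have hsum : ∀ t : ℂ, ∑ i, e t i * star (e t i) = t * star t := by
      intro t
      rw [Finset.sum_eq_single i₀]
      · simp [e]
      · intro b _ hb
        simp [e, hb]
      · simp
    have he : Tendsto e (𝓝 0) (𝓝 0) := by simpa using e.continuous.tendsto 0
    have hEq' : ∀ᶠ t : ℂ in 𝓝 0, F (e t, (t * star t) ^ 2) = t * star t := by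
      filter_upwards [he.eventually hEq] with t ht
      simpa only [hsum] using ht
    have hh : AnalyticAt ℂ (fun t : ℂ => F (e t, 0)) 0 := by
      refine AnalyticAt.fun_comp (g := F) (f := fun t : ℂ => (e t, (0 : ℂ))) ?_
        ((e.analyticAt 0).prod analyticAt_const)
      simp only [map_zero]
      exact hF
    refine not_analyticAt_sub_normSq_isLittleO hh ?_
    have hcurve : Tendsto (fun t : ℂ => ((e t, (0 : ℂ)), (e t, (t * star t) ^ 2))) (𝓝 0)
        (𝓝 ((0, 0), (0, 0))) := by
      have : Continuous fun t : ℂ => ((e t, (0 : ℂ)), (e t, (t * star t) ^ 2)) := by fun_prop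
      simpa using this.tendsto 0
    have hO := hF.hasStrictFDerivAt.isBigO_sub.comp_tendsto hcurve
    have hO' : (fun t : ℂ => F (e t, 0) - t * star t) =O[𝓝 0] fun t : ℂ => t ^ 4 := by
      refine (hO.congr' ?_ EventuallyEq.rfl).trans (IsBigO.of_bound 1 ?_)
      · filter_upwards [hEq'] with t ht
        simp only [Function.comp_apply, ht]
      · refine Eventually.of_forall fun t => le_of_eq ?_
        simp only [Function.comp_apply, Prod.mk_sub_mk, sub_self, zero_sub, Prod.norm_def, norm_zero,
          norm_neg, norm_pow, norm_mul, norm_star, one_mul]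
        rw [max_eq_right (by positivity)]
        ring
    exact hO'.trans_isLittleO (isLittleO_pow_pow (by norm_num))
end

section
/- Let M ⊂ ℂ³ be the quadric given by w = Q(z,z̄) = z̄₁ z₂. The function f(z,z̄) = z̄₁ satisfies Q_{z̄₂} ∂f/∂z̄₁ − Q_{z̄₁} ∂f/∂z̄₂ = 0 (so f is CR on M), yet there is no holomorphic function F on any neighborhood of 0 ∈ ℂ³ such that F(z₁, z₂, z̄₁z₂) = z̄₁ for all (z₁,z₂) in a neighborhood of 0 ∈ ℂ². -/
open Filter Asymptotics Topology

/-- Complex conjugation is nowhere complex differentiable. -/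
theorem not_differentiableAt_complex_star (a : ℂ) :
    ¬ DifferentiableAt ℂ (fun z : ℂ => star z) a := by
  intro h
  have hℝ : HasFDerivAt (fun z : ℂ => star z)
      (Complex.conjCLE : ℂ →L[ℝ] ℂ) a := Complex.conjCLE.hasFDerivAt
  have key := (h.hasFDerivAt.restrictScalars ℝ).unique hℝ
  have h1 := DFunLike.congr_fun key 1
  have hI := DFunLike.congr_fun key Complex.I
  have hlin := (fderiv ℂ (fun z : ℂ => star z) a).map_smul Complex.I 1
  simp only [ContinuousLinearMap.coe_restrictScalars', ContinuousLinearEquiv.coe_coe,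
    Complex.conjCLE_apply, map_one, Complex.conj_I] at h1 hI
  rw [smul_eq_mul, mul_one, hI, h1, smul_eq_mul, mul_one] at hlin
  have him := congrArg Complex.im hlin
  norm_num at him

/-- The derivative of a second-factor coordinate is that coordinate of the direction. -/
theorem fderiv_snd_apply_coord {ι κ : Type*} [Fintype ι] [Fintype κ] (i : κ)
    (x v : (ι → ℂ) × (κ → ℂ)) :
    fderiv ℂ (fun p : (ι → ℂ) × (κ → ℂ) => p.2 i) x v = v.2 i := by
  have h : HasFDerivAt (fun p : (ι → ℂ) × (κ → ℂ) => p.2 i)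
      ((ContinuousLinearMap.proj (R := ℂ) (φ := fun _ : κ => ℂ) i).comp
        (ContinuousLinearMap.snd ℂ (ι → ℂ) (κ → ℂ))) x :=
    ((ContinuousLinearMap.proj (R := ℂ) (φ := fun _ : κ => ℂ) i).comp
      (ContinuousLinearMap.snd ℂ (ι → ℂ) (κ → ℂ))).hasFDerivAt
  rw [h.fderiv]
  rfl

/-- **Example 3.2:** on the quadric `M = {w = z̄₁ z₂} ⊂ ℂ³`, the function
`f = z̄₁` is CR (the CR vector field `L = Q_{z̄₂} ∂/∂z̄₁ − Q_{z̄₁} ∂/∂z̄₂`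
annihilates it; Wirtinger derivatives are computed via the holomorphic
complexifications `Q(z,ζ) = ζ₁z₂`, `f(z,ζ) = ζ₁` evaluated at `ζ = z̄`),
yet `f` is the restriction of no holomorphic function near `0 ∈ ℂ³`. -/
theorem stmt_16 :
    (∀ z : Fin 2 → ℂ,
      fderiv ℂ (fun p : (Fin 2 → ℂ) × (Fin 2 → ℂ) => p.2 0 * p.1 1)
          (z, star z) (0, Pi.single 1 1) *
        fderiv ℂ (fun p : (Fin 2 → ℂ) × (Fin 2 → ℂ) => p.2 0)
          (z, star z) (0, Pi.single 0 1) -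
      fderiv ℂ (fun p : (Fin 2 → ℂ) × (Fin 2 → ℂ) => p.2 0 * p.1 1)
          (z, star z) (0, Pi.single 0 1) *
        fderiv ℂ (fun p : (Fin 2 → ℂ) × (Fin 2 → ℂ) => p.2 0)
          (z, star z) (0, Pi.single 1 1) = 0) ∧
    ¬ ∃ F : (Fin 2 → ℂ) × ℂ → ℂ, AnalyticAt ℂ F 0 ∧
      ∀ᶠ z : Fin 2 → ℂ in 𝓝 0,
        F (z, star (z 0) * z 1) = star (z 0) := by
  refine ⟨fun z => ?_, ?_⟩
  · have hQ : fderiv ℂ (fun p : (Fin 2 → ℂ) × (Fin 2 → ℂ) => p.2 0 * p.1 1)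
        (z, star z) (0, Pi.single 1 1) = 0 := by
      rw [fderiv_fun_mul (by fun_prop) (by fun_prop)]
      have h : HasFDerivAt (fun p : (Fin 2 → ℂ) × (Fin 2 → ℂ) => p.1 1)
          ((ContinuousLinearMap.proj (R := ℂ) (φ := fun _ : Fin 2 => ℂ) 1).comp
            (ContinuousLinearMap.fst ℂ (Fin 2 → ℂ) (Fin 2 → ℂ))) (z, star z) :=
        ((ContinuousLinearMap.proj (R := ℂ) (φ := fun _ : Fin 2 => ℂ) 1).comp
          (ContinuousLinearMap.fst ℂ (Fin 2 → ℂ) (Fin 2 → ℂ))).hasFDerivAt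
      simp [h.fderiv, fderiv_snd_apply_coord]
    rw [hQ, fderiv_snd_apply_coord, fderiv_snd_apply_coord]
    simp
  · rintro ⟨F, hF, hFf⟩
    have hline : DifferentiableAt ℂ (fun t : ℂ => ((Pi.single 0 t : Fin 2 → ℂ), (0 : ℂ))) 0 :=
      ((ContinuousLinearMap.single ℂ (fun _ : Fin 2 => ℂ) 0).differentiableAt).prodMk
        (differentiableAt_const _)
    have hzero : ((Pi.single 0 (0 : ℂ) : Fin 2 → ℂ), (0 : ℂ)) = 0 := by simp
    have hcomp : DifferentiableAt ℂ (fun t : ℂ => F ((Pi.single 0 t : Fin 2 → ℂ), (0 : ℂ))) 0 :=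
      DifferentiableAt.comp (g := F) 0 (hzero ▸ hF.differentiableAt) hline
    have htend : Tendsto (fun t : ℂ => (Pi.single 0 t : Fin 2 → ℂ)) (𝓝 0) (𝓝 0) := by
      have h := (ContinuousLinearMap.single ℂ (fun _ : Fin 2 => ℂ) 0).continuous.tendsto 0
      rwa [map_zero] at h
    refine not_differentiableAt_complex_star 0 (hcomp.congr_of_eventuallyEq ?_)
    filter_upwards [htend.eventually hFf] with t ht
    simpa using ht.symm
end
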